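/- Let g be a Riemannian metric on T². If there exists a bounded geodesic ray c: [0,∞) → ℝ² on the universal covering ℝ², then the geodesic flow of g has positive topological entropy. -/

import Mathlib

open Filter Topology Set
open scoped ENNReal

noncomputable section

/-- The Euclidean norm of a point of `ℝ × ℝ` (the universal covering of `T²`). -/
def norm2 (p : ℝ × ℝ) : ℝ := Real.sqrt (p.1 ^ 2 + p.2 ^ 2)

/-- The translation vector of the covering transformation `τ_{(m,n)}` of `T² = ℝ²/ℤ²`. -/
def lat (k : ℤ × ℤ) : ℝ × ℝ := ((k.1 : ℝ), (k.2 : ℝ))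

/-- The transl of a curve in `ℝ²` by the covering transformation `τ_k`. -/
def transl (k : ℤ × ℤ) (c : ℝ → ℝ × ℝ) : ℝ → ℝ × ℝ := fun t => c t + lat k

/-- The asymptotic direction `δ(τ_k)` of the axes of the translation element `τ_k`. -/
def latDir (k : ℤ × ℤ) : ℝ × ℝ := (norm2 (lat k))⁻¹ • lat k

/-- A smooth Riemannian metric on the torus `T² = ℝ²/ℤ²`, described through its lift to the
universal covering `ℝ²`: a smooth family of positive definite symmetric bilinear forms on the
tangent spaces of `ℝ²`, invariant under the deck transformation group `ℤ²`. -/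
structure TorusMetric where
  g : (ℝ × ℝ) → (ℝ × ℝ) → (ℝ × ℝ) → ℝ
  smooth : ContDiff ℝ (⊤ : ℕ∞) fun p : (ℝ × ℝ) × (ℝ × ℝ) × (ℝ × ℝ) => g p.1 p.2.1 p.2.2
  symm : ∀ x v w, g x v w = g x w v
  linear : ∀ x w, IsLinearMap ℝ fun v => g x v w
  posdef : ∀ x v, v ≠ 0 → 0 < g x v v
  periodic : ∀ (k : ℤ × ℤ) (x v w : ℝ × ℝ), g (x + lat k) v w = g x v w

namespace TorusMetric

/-- The Riemannian length of the curve `c` between the parameters `a` and `b`. -/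
def length (M : TorusMetric) (c : ℝ → ℝ × ℝ) (a b : ℝ) : ℝ :=
  ∫ t in a..b, Real.sqrt (M.g (c t) (deriv c t) (deriv c t))

/-- The Riemannian distance on the universal covering `ℝ²` (hence also on `T²`). -/
def dist (M : TorusMetric) (x y : ℝ × ℝ) : ℝ :=
  sInf {L | ∃ c : ℝ → ℝ × ℝ, ContDiff ℝ 1 c ∧ c 0 = x ∧ c 1 = y ∧ L = M.length c 0 1}

/-- A (complete, unit speed) geodesic of the lifted metric on the universal covering `ℝ²`:
a smooth curve with constant unit speed which is locally length minimizing. -/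
def IsGeodesic (M : TorusMetric) (c : ℝ → ℝ × ℝ) : Prop :=
  ContDiff ℝ (⊤ : ℕ∞) c ∧ (∀ t, M.g (c t) (deriv c t) (deriv c t) = 1) ∧
    ∀ t : ℝ, ∃ ε > 0, ∀ s₁ s₂, t - ε ≤ s₁ → s₁ ≤ s₂ → s₂ ≤ t + ε →
      M.dist (c s₁) (c s₂) = M.length c s₁ s₂

end TorusMetric

/-- The distance between two points of the unit tangent bundle `ST²` of the torus; points of
`ST²` are represented by points of the tangent bundle `ℝ² × ℝ²` of the universal covering
(the deck transformations act trivially on the vector component). -/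
def phaseDist (p q : (ℝ × ℝ) × (ℝ × ℝ)) : ℝ :=
  sInf {r : ℝ | ∃ k : ℤ × ℤ, r = norm2 (p.1 - (q.1 + lat k)) + norm2 (p.2 - q.2)}

/-- A `(φ,ε)`-separated set with respect to time `T` for the geodesic flow `φ` of `M` on
`ST²`: a finite family of geodesics (each geodesic `c` representing the phase point
`(c 0, ċ 0) ∈ ST²`, of which `t ↦ (c t, ċ t)` is the flow orbit) such that any two distinct
members satisfy `max_{0 ≤ t ≤ T} d(φᵗ v, φᵗ w) > ε`. -/
def IsSeparated (M : TorusMetric) (ε T : ℝ) (F : Finset (ℝ → ℝ × ℝ)) : Prop :=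
  (∀ c ∈ F, M.IsGeodesic c) ∧
    ∀ c₁ ∈ F, ∀ c₂ ∈ F, c₁ ≠ c₂ →
      ∃ t ∈ Set.Icc (0 : ℝ) T, ε < phaseDist (c₁ t, deriv c₁ t) (c₂ t, deriv c₂ t)

/-- `r_T(φ, ε)`: the maximal cardinality of `(φ,ε)`-separated sets with respect to `T`. -/
def sepCount (M : TorusMetric) (ε T : ℝ) : ℝ≥0∞ :=
  ⨆ (F : Finset (ℝ → ℝ × ℝ)) (_ : IsSeparated M ε T F), (F.card : ℝ≥0∞)

/-- Extended real logarithm of an extended nonnegative real. -/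
def elog (x : ℝ≥0∞) : EReal :=
  if x = 0 then ⊥ else if x = ⊤ then ⊤ else ((Real.log x.toReal : ℝ) : EReal)

/-- Bowen's topological entropy `h_top(g)` of the geodesic flow of `g` on `ST²`:
`lim_{ε → 0} limsup_{T → ∞} (1/T) log r_T(φ,ε)`; since `r_T(φ,ε)` is monotone in `ε`,
the limit `ε → 0` is realized as the supremum over `ε > 0`. -/
def topEnt (M : TorusMetric) : EReal :=
  ⨆ (ε : ℝ) (_ : 0 < ε),
    Filter.limsup (fun T : ℝ => ((T⁻¹ : ℝ) : EReal) * elog (sepCount M ε T)) Filter.atTop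

/-- The forward ray `c⁺` of `c` is escaping: `‖c(t)‖ → ∞` as `t → ∞`. -/
def EscapesForward (c : ℝ → ℝ × ℝ) : Prop :=
  Filter.Tendsto (fun t => norm2 (c t)) Filter.atTop Filter.atTop

/-- The backward ray `c⁻` of `c` is escaping: `‖c(-t)‖ → ∞` as `t → ∞`. -/
def EscapesBackward (c : ℝ → ℝ × ℝ) : Prop :=
  Filter.Tendsto (fun t => norm2 (c (-t))) Filter.atTop Filter.atTop

/-- `z ∈ S¹` is the asymptotic direction `δ(c⁺) = lim_{t → ∞} c(t)/‖c(t)‖` of the forward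
ray of `c`. -/
def HasDirection (c : ℝ → ℝ × ℝ) (z : ℝ × ℝ) : Prop :=
  norm2 z = 1 ∧ Filter.Tendsto (fun t => (norm2 (c t))⁻¹ • c t) Filter.atTop (nhds z)

/-- The canonical projection `π : S¹ → P¹(ℝ) ≅ ℝ ∪ {∞}`, sending `(x, y)` to `y/x` if
`x ≠ 0` and to `∞` otherwise; `ℝ ∪ {∞}` is the one-point compactification of `ℝ`. -/
def projPt (z : ℝ × ℝ) : OnePoint ℝ :=
  if z.1 = 0 then OnePoint.infty else ((z.2 / z.1 : ℝ) : OnePoint ℝ)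

/-- `crossDet v w ≠ 0` expresses transversality of two directions in `ℝ²`. -/
def crossDet (v w : ℝ × ℝ) : ℝ := v.1 * w.2 - v.2 * w.1

/-- The set of points at which the curve `c₁` (restricted to parameters in `D₁`) and the
curve `c₂` (restricted to parameters in `D₂`) intersect transversally. -/
def transInter (c₁ c₂ : ℝ → ℝ × ℝ) (D₁ D₂ : Set ℝ) : Set (ℝ × ℝ) :=
  {x | ∃ s ∈ D₁, ∃ t ∈ D₂, c₁ s = x ∧ c₂ t = x ∧ crossDet (deriv c₁ s) (deriv c₂ t) ≠ 0}

/-- The geodesic `c` is an axis of the (nontrivial) translation element `τ_k`: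
`τ_k c(t) = c(t + ℓ)` for some `ℓ` and all `t`. -/
def IsAxisOf (M : TorusMetric) (c : ℝ → ℝ × ℝ) (k : ℤ × ℤ) : Prop :=
  M.IsGeodesic c ∧ k ≠ 0 ∧ ∃ ℓ : ℝ, ∀ t, c (t + ℓ) = c t + lat k

/-- The geodesic `c` is an axis of some nontrivial translation element. -/
def IsAxis (M : TorusMetric) (c : ℝ → ℝ × ℝ) : Prop := ∃ k : ℤ × ℤ, IsAxisOf M c k

/-- The curve `c` is minimal: each of its segments minimizes the Riemannian length between
its endpoints. -/
def IsMinimal (M : TorusMetric) (c : ℝ → ℝ × ℝ) : Prop :=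
  ∀ s t : ℝ, s ≤ t → M.dist (c s) (c t) = M.length c s t

/-- Equivalence of translation elements: `τ₁^a = τ₂^b` for some nonzero integers `a, b`. -/
def TransEquiv (k₁ k₂ : ℤ × ℤ) : Prop := ∃ a b : ℤ, a ≠ 0 ∧ b ≠ 0 ∧ a • k₁ = b • k₂

/-- A translation element is primitive if it is not a nontrivial power of another
translation element. -/
def IsPrimitive (k : ℤ × ℤ) : Prop := k ≠ 0 ∧ ∀ (j : ℤ × ℤ) (n : ℤ), k = n • j → IsUnit n

/-- The metric `g` on `T²` is flat, i.e. its Gaussian curvature vanishes identically;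
equivalently (by the theorems of Myers–Steenrod and Cartan–Hadamard), the universal covering
`ℝ²` with the induced Riemannian distance is isometric to the Euclidean plane. -/
def IsFlat (M : TorusMetric) : Prop :=
  ∃ F : (ℝ × ℝ) ≃ (ℝ × ℝ), ∀ x y, M.dist x y = norm2 (F x - F y)

/-! ### Periodic functions on the plane -/

theorem exists_lat_mem (x : ℝ × ℝ) : ∃ k : ℤ × ℤ, x + lat k ∈ Icc (0 : ℝ × ℝ) 1 := by
  refine ⟨(-⌊x.1⌋, -⌊x.2⌋), ?_⟩
  have h1 := Int.floor_le x.1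
  have h2 := Int.floor_le x.2
  have h3 := Int.lt_floor_add_one x.1
  have h4 := Int.lt_floor_add_one x.2
  simp only [lat, mem_Icc, Prod.le_def, Prod.fst_add, Prod.snd_add, Prod.fst_zero, Prod.snd_zero,
    Prod.fst_one, Prod.snd_one, Int.cast_neg]
  constructor <;> constructor <;> linarith

theorem periodic_bounded {G F : Type*} [TopologicalSpace G] [NormedAddCommGroup F]
    {f : (ℝ × ℝ) × G → F} (hf : Continuous f)
    (hp : ∀ (k : ℤ × ℤ) x y, f (x + lat k, y) = f (x, y)) {K : Set G} (hK : IsCompact K) :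
    ∃ C, 0 < C ∧ ∀ x, ∀ y ∈ K, ‖f (x, y)‖ ≤ C := by
  have hc : IsCompact (Icc (0 : ℝ × ℝ) 1 ×ˢ K) := isCompact_Icc.prod hK
  obtain ⟨C, hC⟩ := hc.exists_bound_of_continuousOn hf.continuousOn
  refine ⟨max C 1, by positivity, fun x y hy => ?_⟩
  obtain ⟨k, hk⟩ := exists_lat_mem x
  rw [← hp k]
  exact (hC _ ⟨hk, hy⟩).trans (le_max_left _ _)

theorem periodic_bounded' {F : Type*} [NormedAddCommGroup F]
    {f : (ℝ × ℝ) → F} (hf : Continuous f)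
    (hp : ∀ (k : ℤ × ℤ) x, f (x + lat k) = f x) :
    ∃ C, 0 < C ∧ ∀ x, ‖f x‖ ≤ C := by
  obtain ⟨C, h0, h⟩ := periodic_bounded (G := Unit) (f := fun p => f p.1) (by fun_prop)
    (fun k x _ => hp k x) (isCompact_univ)
  exact ⟨C, h0, fun x => h x () trivial⟩

/-- A positive continuous periodic function is bounded below. -/
theorem periodic_pos {G : Type*} [TopologicalSpace G]
    {f : (ℝ × ℝ) × G → ℝ} (hf : Continuous f)
    (hp : ∀ (k : ℤ × ℤ) x y, f (x + lat k, y) = f (x, y)) {K : Set G} (hK : IsCompact K)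
    (h0 : ∀ x, ∀ y ∈ K, 0 < f (x, y)) :
    ∃ c, 0 < c ∧ ∀ x, ∀ y ∈ K, c ≤ f (x, y) := by
  have hc : IsCompact (Icc (0 : ℝ × ℝ) 1 ×ˢ K) := isCompact_Icc.prod hK
  obtain ⟨c, hc0, hc⟩ := hc.exists_forall_le' hf.continuousOn (a := 0) (fun z hz => h0 _ _ hz.2)
  refine ⟨c, hc0, fun x y hy => ?_⟩
  obtain ⟨k, hk⟩ := exists_lat_mem x
  rw [← hp k]
  exact hc _ ⟨hk, hy⟩

theorem fderiv_periodic {F : Type*} [NormedAddCommGroup F] [NormedSpace ℝ F]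
    {f : (ℝ × ℝ) → F} (hp : ∀ (k : ℤ × ℤ) x, f (x + lat k) = f x) (k : ℤ × ℤ) (x : ℝ × ℝ) :
    fderiv ℝ f (x + lat k) = fderiv ℝ f x := by
  rw [← fderiv_comp_add_right (f := f) (x := x) (lat k)]
  congr 1
  funext y
  exact hp k y

theorem lipschitz_of_periodic {E F : Type*} [NormedAddCommGroup E] [NormedSpace ℝ E]
    [ProperSpace E]
    [NormedAddCommGroup F] [NormedSpace ℝ F]
    {f : (ℝ × ℝ) × E → F} (hf : ContDiff ℝ 1 f)
    (hp : ∀ (k : ℤ × ℤ) x y, f (x + lat k, y) = f (x, y)) {R : ℝ}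
    (h0 : ∀ x y, R ≤ ‖y‖ → f (x, y) = 0) :
    ∃ K, LipschitzWith K f ∧ ∀ z, ‖f z‖ ≤ K := by
  have hK : IsCompact (Metric.closedBall (0 : E) R) := isCompact_closedBall _ _
  obtain ⟨C, hC, hb⟩ := periodic_bounded hf.continuous hp hK
  have hp' : ∀ (k : ℤ × ℤ) x y, fderiv ℝ f (x + lat k, y) = fderiv ℝ f (x, y) := by
    intro k x y
    have := fderiv_comp_add_right (𝕜 := ℝ) (f := f) (x := (x, y)) (lat k, (0 : E))
    simp only [Prod.mk_add_mk, add_zero] at this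
    rw [← this]
    congr 1
    funext z
    obtain ⟨z1, z2⟩ := z
    simpa using hp k z1 z2
  obtain ⟨D, hD, hd⟩ := periodic_bounded (hf.continuous_fderiv (by norm_num)) hp' hK
  have hd' : ∀ z, ‖fderiv ℝ f z‖ ≤ D := by
    rintro ⟨x, y⟩
    by_cases hy : y ∈ Metric.closedBall (0 : E) R
    · exact hd x y hy
    · have : f =ᶠ[𝓝 (x, y)] fun _ => 0 := by
        have ho : IsOpen {z : (ℝ × ℝ) × E | R < ‖z.2‖} :=
          isOpen_lt continuous_const (by fun_prop)
        filter_upwards [ho.mem_nhds (show R < ‖y‖ by simpa using hy)] with z hz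
        exact h0 z.1 z.2 (le_of_lt hz)
      rw [this.fderiv_eq]
      simp [hD.le]
  have hcoe : ((max C D).toNNReal : ℝ) = max C D := Real.coe_toNNReal _ (by positivity)
  refine ⟨(max C D).toNNReal, ?_, ?_⟩
  · refine lipschitzWith_of_nnnorm_fderiv_le (hf.differentiable (by norm_num)) fun z => ?_
    rw [← NNReal.coe_le_coe, hcoe]
    exact (hd' z).trans (le_max_right _ _)
  · rintro ⟨x, y⟩
    rw [hcoe]
    by_cases hy : y ∈ Metric.closedBall (0 : E) R
    · exact (hb x y hy).trans (le_max_left _ _)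
    · rw [h0 x y (by simp at hy; exact hy.le)]
      simp [hC.le]

theorem periodic_taylor {f : (ℝ × ℝ) → ℝ} (hf : ContDiff ℝ 2 f)
    (hp : ∀ (k : ℤ × ℤ) x, f (x + lat k) = f x) :
    ∃ C, 0 < C ∧ (∀ x, |f x| ≤ C) ∧ (∀ x, ‖fderiv ℝ f x‖ ≤ C) ∧
      (∀ x y, |f (x + y) - f x| ≤ C * ‖y‖) ∧
      ∀ x y, |f (x + y) - f x - fderiv ℝ f x y| ≤ C * ‖y‖ ^ 2 := by
  obtain ⟨A, hA0, hA⟩ := periodic_bounded' hf.continuous hp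
  have hf1 : ContDiff ℝ 1 (fderiv ℝ f) := hf.fderiv_right (by norm_num)
  obtain ⟨B, hB0, hB⟩ := periodic_bounded' hf1.continuous (fderiv_periodic hp)
  obtain ⟨D, hD0, hD⟩ := periodic_bounded' (hf1.continuous_fderiv (by norm_num))
    (fderiv_periodic (fderiv_periodic hp))
  have hlip : ∀ x y, ‖fderiv ℝ f y - fderiv ℝ f x‖ ≤ D * ‖y - x‖ := fun x y =>
    (convex_univ).norm_image_sub_le_of_norm_fderiv_le
      (fun z _ => (hf1.differentiable (by norm_num)) z) (fun z _ => hD z) (mem_univ x) (mem_univ y)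
  have hdf := hf.differentiable (by norm_num)
  refine ⟨A + B + D, by positivity, fun x => ?_, fun x => ?_, fun x y => ?_, fun x y => ?_⟩
  · have := hA x
    rw [Real.norm_eq_abs] at this; linarith
  · have := hB x
    linarith
  · have h := (convex_univ).norm_image_sub_le_of_norm_fderiv_le
      (fun z _ => hdf z) (fun z _ => hB z) (mem_univ x) (mem_univ (x + y))
    rw [add_sub_cancel_left, Real.norm_eq_abs] at h
    nlinarith [norm_nonneg y]
  · have h := (convex_closedBall x ‖y‖).norm_image_sub_le_of_norm_hasFDerivWithin_le'
      (f := f) (f' := fderiv ℝ f) (φ := fderiv ℝ f x) (C := D * ‖y‖) (x := x) (y := x + y)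
      (fun z _ => (hdf z).hasFDerivAt.hasFDerivWithinAt)
      (fun z hz => (hlip x z).trans (by
        rw [Metric.mem_closedBall, dist_eq_norm] at hz
        gcongr)) (by simp) (by simp)
    rw [add_sub_cancel_left, Real.norm_eq_abs] at h
    nlinarith [norm_nonneg y, sq_nonneg ‖y‖]

/-! ### Global flow of a bounded Lipschitz vector field -/

theorem exists_global_flow {E : Type*} [NormedAddCommGroup E] [NormedSpace ℝ E] [CompleteSpace E]
    {U : E → E} {K : NNReal} (hK : LipschitzWith K U) {B : NNReal} (hB : ∀ z, ‖U z‖ ≤ B) :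
    ∃ Φ : ℝ → E → E, ∀ z, Φ 0 z = z ∧ ∀ t, HasDerivAt (fun t => Φ t z) (U (Φ t z)) t := by
  have key : ∀ (n : ℕ) (z : E), ∃ α : ℝ → E, α 0 = z ∧
      ∀ t ∈ Ioo (-(n + 1 : ℝ)) (n + 1), HasDerivAt α (U (α t)) t := by
    intro n z
    have hn : (0 : ℝ) ≤ n := Nat.cast_nonneg n
    have hpl : IsPicardLindelof (fun _ => U) (tmin := -(n + 1 : ℝ)) (tmax := n + 1)
        ⟨0, by constructor <;> linarith⟩ z (B * (n + 1)) 0 B K :=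
      IsPicardLindelof.of_time_independent (fun x _ => hB x) (hK.lipschitzOnWith) (by
        simp)
    obtain ⟨α, h0, hα⟩ := hpl.exists_eq_forall_mem_Icc_hasDerivWithinAt₀
    exact ⟨α, h0, fun t ht => (hα t (Ioo_subset_Icc_self ht)).hasDerivAt (Icc_mem_nhds ht.1 ht.2)⟩
  choose α h0 hα using key
  have huniq : ∀ (n m : ℕ) z (t : ℝ), |t| < n + 1 → n ≤ m → α n z t = α m z t := by
    intro n m z t ht hnm
    have hn : (0 : ℝ) ≤ n := Nat.cast_nonneg n
    have hnm' : (n : ℝ) ≤ m := by exact_mod_cast hnm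
    have := ODE_solution_unique_of_mem_Ioo (v := fun _ => U) (s := fun _ => univ) (K := K)
      (a := -(n + 1 : ℝ)) (b := n + 1) (t₀ := 0) (f := α n z) (g := α m z)
      (fun t _ => hK.lipschitzOnWith) (by constructor <;> linarith)
      (fun t ht => ⟨hα n z t ht, trivial⟩)
      (fun t ht => ⟨hα m z t ⟨by linarith [ht.1], by linarith [ht.2]⟩, trivial⟩)
      (by rw [h0, h0])
    exact this (abs_lt.mp ht)
  refine ⟨fun t z => α ⌈|t|⌉₊ z t, fun z => ⟨h0 _ _, fun t => ?_⟩⟩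
  have hm := Nat.le_ceil |t|
  have hloc : (fun s => α ⌈|s|⌉₊ z s) =ᶠ[𝓝 t] α (⌈|t|⌉₊ + 1) z := by
    have ho : IsOpen {s : ℝ | |s| < |t| + 1} := isOpen_lt (by fun_prop) (by fun_prop)
    filter_upwards [ho.mem_nhds (show |t| < |t| + 1 by linarith)] with s hs
    apply huniq
    · linarith [Nat.le_ceil |s|]
    · calc ⌈|s|⌉₊ ≤ ⌈|t| + 1⌉₊ := Nat.ceil_mono (le_of_lt hs)
        _ = _ := Nat.ceil_add_one (abs_nonneg t)
  have := hα (⌈|t|⌉₊ + 1) z t (by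
    rw [mem_Ioo, ← abs_lt]; push_cast; linarith)
  have he : α ⌈|t|⌉₊ z t = α (⌈|t|⌉₊ + 1) z t := hloc.eq_of_nhds
  beta_reduce
  rw [he]
  exact this.congr_of_eventuallyEq hloc

/-! ### The Hamiltonian vector field of the metric -/

theorem HasDerivAt.fst' {E F : Type*} [NormedAddCommGroup E] [NormedSpace ℝ E]
    [NormedAddCommGroup F] [NormedSpace ℝ F] {f : ℝ → E × F} {f' : E × F} {t : ℝ}
    (h : HasDerivAt f f' t) : HasDerivAt (fun t => (f t).1) f'.1 t := by
  have := (h.hasFDerivAt.fst).hasDerivAt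
  simpa using this

theorem HasDerivAt.snd' {E F : Type*} [NormedAddCommGroup E] [NormedSpace ℝ E]
    [NormedAddCommGroup F] [NormedSpace ℝ F] {f : ℝ → E × F} {f' : E × F} {t : ℝ}
    (h : HasDerivAt f f' t) : HasDerivAt (fun t => (f t).2) f'.2 t := by
  have := (h.hasFDerivAt.snd).hasDerivAt
  simpa using this

/-- The phase space `ℝ² × ℝ²` of positions and momenta. -/
abbrev Ph := (ℝ × ℝ) × (ℝ × ℝ)

/-- The standard pairing on `ℝ²`. -/
def dot (p v : ℝ × ℝ) : ℝ := p.1 * v.1 + p.2 * v.2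

def gE (M : TorusMetric) (x : ℝ × ℝ) : ℝ := M.g x (1, 0) (1, 0)
def gF (M : TorusMetric) (x : ℝ × ℝ) : ℝ := M.g x (1, 0) (0, 1)
def gG (M : TorusMetric) (x : ℝ × ℝ) : ℝ := M.g x (0, 1) (0, 1)

theorem g_eq (M : TorusMetric) (x v w : ℝ × ℝ) :
    M.g x v w = gE M x * (v.1 * w.1) + gF M x * (v.1 * w.2 + v.2 * w.1) +
      gG M x * (v.2 * w.2) := by
  have key : ∀ (v w : ℝ × ℝ), M.g x v w = v.1 * M.g x (1, 0) w + v.2 * M.g x (0, 1) w := by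
    intro v w
    have h := M.linear x w
    have hv : v = v.1 • ((1 : ℝ), (0 : ℝ)) + v.2 • ((0 : ℝ), (1 : ℝ)) := by
      ext <;> simp
    conv_lhs => rw [hv]
    rw [h.map_add, h.map_smul, h.map_smul]
    simp
  rw [key v w, M.symm x (1, 0) w, M.symm x (0, 1) w, key w, key w (0, 1), M.symm x (0, 1) (1, 0)]
  simp only [gE, gF, gG]
  ring

theorem gE_pos (M : TorusMetric) (x : ℝ × ℝ) : 0 < gE M x := M.posdef x (1, 0) (by simp)

/-- The determinant of the metric. -/
def gdet (M : TorusMetric) (x : ℝ × ℝ) : ℝ := gE M x * gG M x - gF M x ^ 2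

theorem gdet_pos (M : TorusMetric) (x : ℝ × ℝ) : 0 < gdet M x := by
  have h1 := gE_pos M x
  have h2 := M.posdef x (-gF M x, gE M x) (by
    intro h
    have := congrArg Prod.snd h
    simp at this
    linarith)
  rw [g_eq] at h2
  simp only at h2
  have : 0 < gE M x * gdet M x := by
    unfold gdet; nlinarith
  exact pos_of_mul_pos_right this h1.le

theorem gE_smooth (M : TorusMetric) : ContDiff ℝ (⊤ : ℕ∞) (gE M) :=
  M.smooth.comp (f := fun x : ℝ × ℝ => (x, ((1 : ℝ), (0 : ℝ)), ((1 : ℝ), (0 : ℝ)))) (by fun_prop)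
theorem gF_smooth (M : TorusMetric) : ContDiff ℝ (⊤ : ℕ∞) (gF M) :=
  M.smooth.comp (f := fun x : ℝ × ℝ => (x, ((1 : ℝ), (0 : ℝ)), ((0 : ℝ), (1 : ℝ)))) (by fun_prop)
theorem gG_smooth (M : TorusMetric) : ContDiff ℝ (⊤ : ℕ∞) (gG M) :=
  M.smooth.comp (f := fun x : ℝ × ℝ => (x, ((0 : ℝ), (1 : ℝ)), ((0 : ℝ), (1 : ℝ)))) (by fun_prop)

theorem gE_per (M : TorusMetric) (k : ℤ × ℤ) (x : ℝ × ℝ) : gE M (x + lat k) = gE M x :=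
  M.periodic k x _ _
theorem gF_per (M : TorusMetric) (k : ℤ × ℤ) (x : ℝ × ℝ) : gF M (x + lat k) = gF M x :=
  M.periodic k x _ _
theorem gG_per (M : TorusMetric) (k : ℤ × ℤ) (x : ℝ × ℝ) : gG M (x + lat k) = gG M x :=
  M.periodic k x _ _

/-- The momentum `g_x(v, ·)`. -/
def mom (M : TorusMetric) (x v : ℝ × ℝ) : ℝ × ℝ :=
  (gE M x * v.1 + gF M x * v.2, gF M x * v.1 + gG M x * v.2)

/-- The velocity with given momentum. -/
def vel (M : TorusMetric) (x p : ℝ × ℝ) : ℝ × ℝ :=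
  ((gdet M x)⁻¹ * (gG M x * p.1 - gF M x * p.2), (gdet M x)⁻¹ * (gE M x * p.2 - gF M x * p.1))

theorem dot_mom (M : TorusMetric) (x v w : ℝ × ℝ) : dot (mom M x v) w = M.g x v w := by
  rw [g_eq]; simp only [dot, mom]; ring

theorem mom_vel (M : TorusMetric) (x p : ℝ × ℝ) : mom M x (vel M x p) = p := by
  have h := (gdet_pos M x).ne'
  ext <;> simp only [mom, vel] <;> field_simp <;> simp only [gdet] <;> ring

theorem vel_mom (M : TorusMetric) (x v : ℝ × ℝ) : vel M x (mom M x v) = v := by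
  have h := (gdet_pos M x).ne'
  ext <;> simp only [mom, vel] <;> field_simp <;> simp only [gdet] <;> ring

theorem vel_smul (M : TorusMetric) (x p : ℝ × ℝ) (a : ℝ) : vel M x (a • p) = a • vel M x p := by
  ext <;> simp only [vel, Prod.smul_fst, Prod.smul_snd, smul_eq_mul] <;> ring

theorem vel_sub (M : TorusMetric) (x p q : ℝ × ℝ) :
    vel M x (p - q) = vel M x p - vel M x q := by
  ext <;> simp only [vel, Prod.fst_sub, Prod.snd_sub] <;> ring

theorem mom_sub (M : TorusMetric) (x p q : ℝ × ℝ) :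
    mom M x (p - q) = mom M x p - mom M x q := by
  ext <;> simp only [mom, Prod.fst_sub, Prod.snd_sub] <;> ring

theorem mom_smul (M : TorusMetric) (x p : ℝ × ℝ) (a : ℝ) : mom M x (a • p) = a • mom M x p := by
  ext <;> simp only [mom, Prod.smul_fst, Prod.smul_snd, smul_eq_mul] <;> ring

theorem dot_smul_left (a : ℝ) (p v : ℝ × ℝ) : dot (a • p) v = a * dot p v := by
  simp only [dot, Prod.smul_fst, Prod.smul_snd, smul_eq_mul]; ring

theorem dot_smul_right (a : ℝ) (p v : ℝ × ℝ) : dot p (a • v) = a * dot p v := by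
  simp only [dot, Prod.smul_fst, Prod.smul_snd, smul_eq_mul]; ring

/-- The kinetic energy. -/
def ham (M : TorusMetric) (z : Ph) : ℝ := dot z.2 (vel M z.1 z.2) / 2

theorem g_vel (M : TorusMetric) (z : Ph) :
    M.g z.1 (vel M z.1 z.2) (vel M z.1 z.2) = 2 * ham M z := by
  rw [← dot_mom, mom_vel, ham]; ring

theorem ham_mom (M : TorusMetric) (x v : ℝ × ℝ) : ham M (x, mom M x v) = M.g x v v / 2 := by
  simp only [ham, vel_mom, dot_mom]

/-- The derivative of the metric in the direction `ξ` evaluated on `v`. -/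
def gder (M : TorusMetric) (x ξ v : ℝ × ℝ) : ℝ :=
  fderiv ℝ (gE M) x ξ * v.1 ^ 2 + 2 * (fderiv ℝ (gF M) x ξ * (v.1 * v.2)) +
    fderiv ℝ (gG M) x ξ * v.2 ^ 2

/-- The derivative of the momentum along geodesics. -/
def force (M : TorusMetric) (x p : ℝ × ℝ) : ℝ × ℝ :=
  (gder M x (1, 0) (vel M x p) / 2, gder M x (0, 1) (vel M x p) / 2)

theorem clm_apply_eq (L : ℝ × ℝ →L[ℝ] ℝ) (ξ : ℝ × ℝ) :
    L ξ = ξ.1 * L (1, 0) + ξ.2 * L (0, 1) := by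
  have hv : ξ = ξ.1 • ((1 : ℝ), (0 : ℝ)) + ξ.2 • ((0 : ℝ), (1 : ℝ)) := by
    ext <;> simp
  conv_lhs => rw [hv]
  rw [map_add, map_smul, map_smul, smul_eq_mul, smul_eq_mul]

theorem dot_force (M : TorusMetric) (x p ξ : ℝ × ℝ) :
    dot (force M x p) ξ = gder M x ξ (vel M x p) / 2 := by
  simp only [dot, force, gder]
  rw [clm_apply_eq (fderiv ℝ (gE M) x) ξ, clm_apply_eq (fderiv ℝ (gF M) x) ξ,
    clm_apply_eq (fderiv ℝ (gG M) x) ξ]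
  ring

theorem force_smul (M : TorusMetric) (x p : ℝ × ℝ) (a : ℝ) :
    force M x (a • p) = a ^ 2 • force M x p := by
  simp only [force, vel_smul, gder]
  ext <;> simp only [Prod.smul_fst, Prod.smul_snd, smul_eq_mul] <;> ring

/-- The Hamiltonian vector field. -/
def vf (M : TorusMetric) (z : Ph) : Ph := (vel M z.1 z.2, force M z.1 z.2)

/-- The Hamiltonian vector field, cut off at high energies. -/
def cvf (M : TorusMetric) (z : Ph) : Ph := Real.smoothTransition (2 - ham M z) • vf M z

theorem gdet_smooth (M : TorusMetric) : ContDiff ℝ (⊤ : ℕ∞) (gdet M) := by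
  have h1 := gE_smooth M
  have h2 := gF_smooth M
  have h3 := gG_smooth M
  unfold gdet
  fun_prop

theorem vel_smooth (M : TorusMetric) : ContDiff ℝ (⊤ : ℕ∞) (fun z : Ph => vel M z.1 z.2) := by
  have h1 := gE_smooth M
  have h2 := gF_smooth M
  have h3 := gG_smooth M
  have h4 : ContDiff ℝ (⊤ : ℕ∞) (fun x => (gdet M x)⁻¹) :=
    (gdet_smooth M).inv fun x => (gdet_pos M x).ne'
  unfold vel
  generalize gdet M = d at h4 ⊢
  have h5 : ContDiff ℝ (⊤ : ℕ∞) (fun z : Ph => (d z.1)⁻¹) := h4.comp contDiff_fst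
  exact (h5.mul (by fun_prop)).prodMk (h5.mul (by fun_prop))

theorem ham_smooth (M : TorusMetric) : ContDiff ℝ (⊤ : ℕ∞) (ham M) := by
  have h := vel_smooth M
  unfold ham dot
  generalize vel M = v at h ⊢
  exact ((contDiff_snd.fst.mul h.fst).add (contDiff_snd.snd.mul h.snd)).div_const 2

theorem gder_smooth (M : TorusMetric) (ξ : ℝ × ℝ) :
    ContDiff ℝ (⊤ : ℕ∞) (fun z : Ph => gder M z.1 ξ z.2) := by
  have h1 : ContDiff ℝ (⊤ : ℕ∞) (fun x => fderiv ℝ (gE M) x ξ) :=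
    ((gE_smooth M).fderiv_right (by norm_num)).clm_apply contDiff_const
  have h2 : ContDiff ℝ (⊤ : ℕ∞) (fun x => fderiv ℝ (gF M) x ξ) :=
    ((gF_smooth M).fderiv_right (by norm_num)).clm_apply contDiff_const
  have h3 : ContDiff ℝ (⊤ : ℕ∞) (fun x => fderiv ℝ (gG M) x ξ) :=
    ((gG_smooth M).fderiv_right (by norm_num)).clm_apply contDiff_const
  unfold gder
  fun_prop

theorem vf_smooth (M : TorusMetric) : ContDiff ℝ (⊤ : ℕ∞) (vf M) := by
  have h := vel_smooth M
  have h1 : ContDiff ℝ (⊤ : ℕ∞) (fun z : Ph => gder M z.1 (1, 0) (vel M z.1 z.2)) :=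
    (gder_smooth M (1, 0)).comp (contDiff_fst.prodMk h)
  have h2 : ContDiff ℝ (⊤ : ℕ∞) (fun z : Ph => gder M z.1 (0, 1) (vel M z.1 z.2)) :=
    (gder_smooth M (0, 1)).comp (contDiff_fst.prodMk h)
  unfold vf force
  fun_prop

theorem cvf_smooth (M : TorusMetric) : ContDiff ℝ (⊤ : ℕ∞) (cvf M) := by
  have h := vf_smooth M
  have h1 := ham_smooth M
  have h2 : ContDiff ℝ (⊤ : ℕ∞) (fun z => Real.smoothTransition (2 - ham M z)) :=
    Real.smoothTransition.contDiff.comp (contDiff_const.sub h1)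
  unfold cvf
  fun_prop

theorem vel_per (M : TorusMetric) (k : ℤ × ℤ) (x p : ℝ × ℝ) :
    vel M (x + lat k) p = vel M x p := by
  simp only [vel, gdet, gE_per, gF_per, gG_per]

theorem ham_per (M : TorusMetric) (k : ℤ × ℤ) (x p : ℝ × ℝ) :
    ham M (x + lat k, p) = ham M (x, p) := by
  simp only [ham, vel_per]

theorem cvf_per (M : TorusMetric) (k : ℤ × ℤ) (x p : ℝ × ℝ) :
    cvf M (x + lat k, p) = cvf M (x, p) := by
  simp only [cvf, vf, force, gder, vel_per, ham_per, fderiv_periodic (gE_per M),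
    fderiv_periodic (gF_per M), fderiv_periodic (gG_per M)]

theorem cvf_eq_vf (M : TorusMetric) {z : Ph} (hz : ham M z ≤ 1) : cvf M z = vf M z := by
  rw [cvf, Real.smoothTransition.one_of_one_le (by linarith), one_smul]

theorem ham_smul (M : TorusMetric) (x p : ℝ × ℝ) (a : ℝ) :
    ham M (x, a • p) = a ^ 2 * ham M (x, p) := by
  simp only [ham, vel_smul, dot_smul_left, dot_smul_right]; ring

/-- A quadratic lower bound extends from the unit sphere. -/
theorem quadratic_bound {Q : (ℝ × ℝ) → (ℝ × ℝ) → ℝ} (hc : Continuous fun z : Ph => Q z.1 z.2)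
    (hp : ∀ (k : ℤ × ℤ) x y, Q (x + lat k) y = Q x y) (hs : ∀ x (a : ℝ) v, Q x (a • v) = a ^ 2 * Q x v)
    (h0 : ∀ x v, v ≠ 0 → 0 < Q x v) : ∃ c, 0 < c ∧ ∀ x v, c * ‖v‖ ^ 2 ≤ Q x v := by
  obtain ⟨c, hc0, hc⟩ := periodic_pos hc hp (isCompact_sphere (0 : ℝ × ℝ) 1) (fun x y hy => by
    apply h0
    rintro rfl
    simp at hy)
  refine ⟨c, hc0, fun x v => ?_⟩
  by_cases hv : v = 0
  · have := hs x 0 v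
    simp only [hv] at this ⊢
    simp at this
    simp [this]
  · have hv' : 0 < ‖v‖ := norm_pos_iff.mpr hv
    have h1 := hc x (‖v‖⁻¹ • v) (by simp [norm_smul, hv'.ne'])
    have h2 := hs x ‖v‖ (‖v‖⁻¹ • v)
    rw [smul_smul, mul_inv_cancel₀ hv'.ne', one_smul] at h2
    rw [h2]
    nlinarith [sq_nonneg ‖v‖]

theorem vel_ne_zero (M : TorusMetric) {x p : ℝ × ℝ} (hp : p ≠ 0) : vel M x p ≠ 0 := by
  intro h
  apply hp
  rw [← mom_vel M x p, h]
  ext <;> simp [mom]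

theorem ham_lower (M : TorusMetric) : ∃ c, 0 < c ∧ ∀ x p, c * ‖p‖ ^ 2 ≤ ham M (x, p) := by
  refine quadratic_bound (Q := fun x p => ham M (x, p)) (ham_smooth M).continuous (ham_per M)
    (fun x a v => ham_smul M x v a) fun x v hv => ?_
  have h := g_vel M (x, v)
  have h2 := M.posdef x (vel M x v) (vel_ne_zero M hv)
  simp only at h
  linarith

theorem ham_nonneg (M : TorusMetric) (z : Ph) : 0 ≤ ham M z := by
  obtain ⟨c, hc, h⟩ := ham_lower M
  have := h z.1 z.2
  have h2 : 0 ≤ c * ‖z.2‖ ^ 2 := by positivity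
  exact h2.trans this

theorem g_lower (M : TorusMetric) : ∃ c, 0 < c ∧ ∀ x v, c * ‖v‖ ^ 2 ≤ M.g x v v := by
  refine quadratic_bound (Q := fun x v => M.g x v v) ?_ (fun k x y => M.periodic k x y y)
    (fun x a v => ?_) fun x v hv => M.posdef x v hv
  · exact M.smooth.continuous.comp (g := fun p : (ℝ × ℝ) × (ℝ × ℝ) × (ℝ × ℝ) => M.g p.1 p.2.1 p.2.2)
      (f := fun z : Ph => (z.1, z.2, z.2)) (by fun_prop)
  · rw [g_eq, g_eq]
    simp only [Prod.smul_fst, Prod.smul_snd, smul_eq_mul]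
    ring

theorem cvf_lipschitz (M : TorusMetric) :
    ∃ K : NNReal, LipschitzWith K (cvf M) ∧ ∀ z, ‖cvf M z‖ ≤ K := by
  obtain ⟨c, hc, h⟩ := ham_lower M
  refine lipschitz_of_periodic ((cvf_smooth M).of_le (by norm_num)) (cvf_per M)
    (R := 2 / c + 1) fun x p hp => ?_
  have h1 := h x p
  have h3 : 0 < 2 / c := by positivity
  have h2 : 2 ≤ ham M (x, p) := by
    have : 2 / c + 1 ≤ ‖p‖ ^ 2 := by nlinarith
    have h4 : c * (2 / c) = 2 := by field_simp
    nlinarith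
  rw [cvf, Real.smoothTransition.zero_of_nonpos (by linarith), zero_smul]

theorem ham_deriv_zero (M : TorusMetric) {z : ℝ → Ph} {t k : ℝ}
    (hz : HasDerivAt z (k • vf M (z t)) t) : HasDerivAt (fun t => ham M (z t)) 0 t := by
  have hx : HasDerivAt (fun t => (z t).1) (k • vel M (z t).1 (z t).2) t := hz.fst'
  have hp : HasDerivAt (fun t => (z t).2) (k • force M (z t).1 (z t).2) t := hz.snd'
  have hp1 : HasDerivAt (fun t => (z t).2.1) (k * (force M (z t).1 (z t).2).1) t := hp.fst'
  have hp2 : HasDerivAt (fun t => (z t).2.2) (k * (force M (z t).1 (z t).2).2) t := hp.snd'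
  obtain ⟨v', hv⟩ : ∃ v', HasDerivAt (fun t => vel M (z t).1 (z t).2) v' t :=
    ⟨_, (((vel_smooth M).differentiable (by norm_num)) (z t)).hasFDerivAt.comp_hasDerivAt t hz⟩
  have hv1 : HasDerivAt (fun t => (vel M (z t).1 (z t).2).1) v'.1 t :=
    hv.fst'
  have hv2 : HasDerivAt (fun t => (vel M (z t).1 (z t).2).2) v'.2 t :=
    hv.snd'
  have hd : ∀ {f : ℝ × ℝ → ℝ}, ContDiff ℝ (⊤ : ℕ∞) f → HasDerivAt (fun t => f (z t).1)
      (k * fderiv ℝ f (z t).1 (vel M (z t).1 (z t).2)) t := fun {f} hf => by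
    have := (((hf.differentiable (by norm_num)) (z t).1).hasFDerivAt.comp_hasDerivAt t hx)
    rw [map_smul] at this
    exact this
  have hE := hd (gE_smooth M)
  have hF := hd (gF_smooth M)
  have hG := hd (gG_smooth M)
  have i1 := ((hE.mul hv1).add (hF.mul hv2)).unique (hp1.congr_of_eventuallyEq
    (Eventually.of_forall fun s => congrArg Prod.fst (mom_vel M (z s).1 (z s).2)))
  have i2 := ((hF.mul hv1).add (hG.mul hv2)).unique (hp2.congr_of_eventuallyEq
    (Eventually.of_forall fun s => congrArg Prod.snd (mom_vel M (z s).1 (z s).2)))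
  have hh : HasDerivAt (fun t => ham M (z t)) _ t := ((hp1.mul hv1).add (hp2.mul hv2)).div_const 2
  convert hh using 1
  have e := dot_force M (z t).1 (z t).2 (vel M (z t).1 (z t).2)
  have m1 := congrArg Prod.fst (mom_vel M (z t).1 (z t).2)
  have m2 := congrArg Prod.snd (mom_vel M (z t).1 (z t).2)
  simp only [mom, dot, gder] at e m1 m2
  generalize vel M (z t).1 (z t).2 = v at *
  rw [← m1, ← m2]
  linear_combination (-k) * e + (-1 / 2) * v.1 * i1 + (-1 / 2) * v.2 * i2

/-! ### The geodesic flow in momentum coordinates -/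

/-- A bound and Lipschitz constant for the cut off Hamiltonian vector field. -/
def flowK (M : TorusMetric) : NNReal := (cvf_lipschitz M).choose

theorem cvf_lip (M : TorusMetric) : LipschitzWith (flowK M) (cvf M) :=
  (cvf_lipschitz M).choose_spec.1

theorem cvf_le (M : TorusMetric) (z : Ph) : ‖cvf M z‖ ≤ flowK M :=
  (cvf_lipschitz M).choose_spec.2 z

/-- The flow of the cut off Hamiltonian vector field. -/
def flow (M : TorusMetric) : ℝ → Ph → Ph := (exists_global_flow (cvf_lip M) (cvf_le M)).choose

theorem flow_zero (M : TorusMetric) (z : Ph) : flow M 0 z = z :=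
  ((exists_global_flow (cvf_lip M) (cvf_le M)).choose_spec z).1

theorem flow_deriv' (M : TorusMetric) (z : Ph) (t : ℝ) :
    HasDerivAt (fun t => flow M t z) (cvf M (flow M t z)) t :=
  ((exists_global_flow (cvf_lip M) (cvf_le M)).choose_spec z).2 t

theorem flow_unique (M : TorusMetric) {f : ℝ → Ph} (hf : ∀ t, HasDerivAt f (cvf M (f t)) t)
    {z : Ph} (h0 : f 0 = z) (t : ℝ) : f t = flow M t z := by
  have := ODE_solution_unique_univ (v := fun _ => cvf M) (s := fun _ => univ) (K := flowK M)
    (t₀ := 0) (f := f) (g := fun t => flow M t z) (fun t => (cvf_lip M).lipschitzOnWith)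
    (fun t => ⟨hf t, trivial⟩) (fun t => ⟨flow_deriv' M z t, trivial⟩)
    (by rw [flow_zero, h0])
  exact congrFun this t

theorem flow_add (M : TorusMetric) (s t : ℝ) (z : Ph) :
    flow M (s + t) z = flow M s (flow M t z) :=
  flow_unique M (f := fun s => flow M (s + t) z)
    (fun s => (flow_deriv' M z (s + t)).comp_add_const s t) (by simp) s

theorem flow_smooth (M : TorusMetric) (z : Ph) : ContDiff ℝ (⊤ : ℕ∞) (fun t => flow M t z) := by
  have hd : deriv (fun t => flow M t z) = fun t => cvf M (flow M t z) :=
    funext fun t => (flow_deriv' M z t).deriv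
  rw [contDiff_infty]
  intro n
  induction n with
  | zero =>
    exact contDiff_zero.mpr (continuous_iff_continuousAt.mpr
      fun t => (flow_deriv' M z t).continuousAt)
  | succ n ih =>
    push_cast
    rw [contDiff_succ_iff_deriv]
    refine ⟨fun t => (flow_deriv' M z t).differentiableAt, by simp, ?_⟩
    rw [hd]
    exact ((cvf_smooth M).of_le (by exact_mod_cast le_top)).comp ih

theorem flow_lip_pos (M : TorusMetric) (z w : Ph) {t : ℝ} (ht : 0 ≤ t) :
    ‖flow M t z - flow M t w‖ ≤ Real.exp (flowK M * t) * ‖z - w‖ := by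
  have := dist_le_of_trajectories_ODE (v := fun _ => cvf M) (K := flowK M)
    (f := fun t => flow M t z) (g := fun t => flow M t w) (a := 0) (b := t) (δ := ‖z - w‖)
    (fun t => (cvf_lip M))
    (fun s _ => (flow_deriv' M z s).continuousAt.continuousWithinAt)
    (fun s _ => (flow_deriv' M z s).hasDerivWithinAt)
    (fun s _ => (flow_deriv' M w s).continuousAt.continuousWithinAt)
    (fun s _ => (flow_deriv' M w s).hasDerivWithinAt)
    (by rw [flow_zero, flow_zero, dist_eq_norm]) t ⟨ht, le_rfl⟩
  rw [dist_eq_norm, sub_zero] at this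
  linarith

theorem flow_lip_neg (M : TorusMetric) (z w : Ph) {t : ℝ} (ht : 0 ≤ t) :
    ‖flow M (-t) z - flow M (-t) w‖ ≤ Real.exp (flowK M * t) * ‖z - w‖ := by
  have hd : ∀ z s, HasDerivAt (fun s => flow M (-s) z) (-cvf M (flow M (-s) z)) s := fun z s => by
    exact ((flow_deriv' M z (-s)).scomp s (hasDerivAt_neg s)).congr_deriv (by simp)
  have := dist_le_of_trajectories_ODE (v := fun _ z => -cvf M z) (K := flowK M)
    (f := fun t => flow M (-t) z) (g := fun t => flow M (-t) w) (a := 0) (b := t) (δ := ‖z - w‖)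
    (fun t => (cvf_lip M).neg)
    (fun s _ => (hd z s).continuousAt.continuousWithinAt)
    (fun s _ => (hd z s).hasDerivWithinAt)
    (fun s _ => (hd w s).continuousAt.continuousWithinAt)
    (fun s _ => (hd w s).hasDerivWithinAt)
    (by simp [flow_zero, dist_eq_norm]) t ⟨ht, le_rfl⟩
  rw [dist_eq_norm, sub_zero] at this
  linarith

theorem flow_lip (M : TorusMetric) (t : ℝ) (z w : Ph) :
    ‖flow M t z - flow M t w‖ ≤ Real.exp (flowK M * |t|) * ‖z - w‖ := by
  rcases le_total 0 t with ht | ht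
  · rw [abs_of_nonneg ht]; exact flow_lip_pos M z w ht
  · rw [abs_of_nonpos ht]
    simpa using flow_lip_neg M z w (t := -t) (by linarith)

theorem flow_time_lip (M : TorusMetric) (s t : ℝ) (z : Ph) :
    ‖flow M s z - flow M t z‖ ≤ flowK M * |s - t| := by
  have := (convex_univ).norm_image_sub_le_of_norm_hasDerivWithin_le
    (f := fun t => flow M t z) (C := flowK M)
    (fun s _ => (flow_deriv' M z s).hasDerivWithinAt) (fun s _ => cvf_le M _)
    (mem_univ t) (mem_univ s)
  simpa using this

theorem flow_continuous (M : TorusMetric) : Continuous fun q : ℝ × Ph => flow M q.1 q.2 := by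
  have h1 : ∀ z, Continuous fun t => flow M t z := fun z => (flow_smooth M z).continuous
  rw [Metric.continuous_iff']
  rintro ⟨t, z⟩ ε hε
  have hc : Continuous fun q : ℝ × Ph =>
      flowK M * |q.1 - t| + Real.exp (flowK M * |t|) * ‖q.2 - z‖ := by fun_prop
  have h := hc.tendsto (t, z)
  simp only [sub_self, abs_zero, norm_zero, mul_zero, add_zero] at h
  filter_upwards [h.eventually_lt_const hε] with q hq
  refine lt_of_le_of_lt ?_ hq
  rw [dist_eq_norm]
  calc ‖flow M q.1 q.2 - flow M t z‖
      ≤ ‖flow M q.1 q.2 - flow M t q.2‖ + ‖flow M t q.2 - flow M t z‖ := norm_sub_le_norm_sub_add_norm_sub _ _ _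
    _ ≤ _ := add_le_add (flow_time_lip M _ _ _) (flow_lip M _ _ _)

theorem ham_flow (M : TorusMetric) (t : ℝ) (z : Ph) : ham M (flow M t z) = ham M z := by
  have h : ∀ s, HasDerivAt (fun s => ham M (flow M s z)) 0 s := fun s =>
    ham_deriv_zero M (z := fun s => flow M s z) (flow_deriv' M z s)
  have := is_const_of_deriv_eq_zero (f := fun s => ham M (flow M s z))
    (fun s => (h s).differentiableAt) (fun s => (h s).deriv) t 0
  simpa [flow_zero] using this

theorem flow_deriv (M : TorusMetric) {z : Ph} (hz : ham M z ≤ 1) (t : ℝ) :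
    HasDerivAt (fun t => flow M t z) (vf M (flow M t z)) t := by
  have := flow_deriv' M z t
  rwa [cvf_eq_vf M (by rwa [ham_flow])] at this

/-- The position at time `t` of the flow orbit of `z`. -/
def pos (M : TorusMetric) (t : ℝ) (z : Ph) : ℝ × ℝ := (flow M t z).1

theorem pos_deriv (M : TorusMetric) {z : Ph} (hz : ham M z ≤ 1) (t : ℝ) :
    HasDerivAt (fun t => pos M t z) (vel M (flow M t z).1 (flow M t z).2) t :=
  (flow_deriv M hz t).fst'

theorem mom_deriv (M : TorusMetric) {z : Ph} (hz : ham M z ≤ 1) (t : ℝ) :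
    HasDerivAt (fun t => (flow M t z).2) (force M (flow M t z).1 (flow M t z).2) t :=
  (flow_deriv M hz t).snd'

theorem pos_continuous (M : TorusMetric) : Continuous fun q : ℝ × Ph => pos M q.1 q.2 :=
  (flow_continuous M).fst

theorem pos_smooth (M : TorusMetric) (z : Ph) : ContDiff ℝ (⊤ : ℕ∞) (fun t => pos M t z) :=
  (flow_smooth M z).fst

theorem pos_zero (M : TorusMetric) (z : Ph) : pos M 0 z = z.1 := by rw [pos, flow_zero]

theorem flow_per (M : TorusMetric) (t : ℝ) (z : Ph) (k : ℤ × ℤ) :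
    flow M t (z.1 + lat k, z.2) = ((flow M t z).1 + lat k, (flow M t z).2) := by
  symm
  refine flow_unique M (f := fun t => ((flow M t z).1 + lat k, (flow M t z).2)) (fun t => ?_) ?_ t
  · rw [cvf_per]
    have h := flow_deriv' M z t
    exact (h.fst'.add_const (lat k)).prodMk h.snd'
  · simp [flow_zero]

/-- Rescaling of the momentum. -/
def scal (a : ℝ) (z : Ph) : Ph := (z.1, a • z.2)

theorem ham_scal (M : TorusMetric) (a : ℝ) (z : Ph) : ham M (scal a z) = a ^ 2 * ham M z :=
  ham_smul M z.1 z.2 a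

theorem scal_scal (a b : ℝ) (z : Ph) : scal a (scal b z) = scal (a * b) z := by
  simp [scal, smul_smul]

theorem scal_one (z : Ph) : scal 1 z = z := by simp [scal]

theorem flow_scal (M : TorusMetric) {a : ℝ} {z : Ph} (hz : ham M z ≤ 1)
    (hz' : ham M (scal a z) ≤ 1) (t : ℝ) : flow M t (scal a z) = scal a (flow M (a * t) z) := by
  symm
  refine flow_unique M (f := fun t => scal a (flow M (a * t) z)) (fun t => ?_) ?_ t
  · have h : HasDerivAt (fun t => flow M (a * t) z) (a • vf M (flow M (a * t) z)) t := by
      exact ((flow_deriv M hz (a * t)).scomp t ((hasDerivAt_id t).const_mul a)).congr_deriv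
        (by simp)
    have h2 := h.fst'.prodMk (h.snd'.const_smul a)
    rw [cvf_eq_vf M (by rw [ham_scal, ham_flow, ← ham_scal]; exact hz')]
    refine h2.congr_deriv ?_
    simp only [vf, scal, vel_smul, force_smul, Prod.smul_fst, Prod.smul_snd, smul_smul, sq]
  · simp [flow_zero]

theorem pos_scal (M : TorusMetric) {a : ℝ} {z : Ph} (hz : ham M z ≤ 1)
    (hz' : ham M (scal a z) ≤ 1) (t : ℝ) : pos M t (scal a z) = pos M (a * t) z := by
  rw [pos, flow_scal M hz hz']
  rfl

/-! ### A local energy estimate around short geodesics -/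

theorem g_continuous (M : TorusMetric) {X : Type*} [TopologicalSpace X] {f v w : X → ℝ × ℝ}
    (hf : Continuous f) (hv : Continuous v) (hw : Continuous w) :
    Continuous fun t => M.g (f t) (v t) (w t) :=
  M.smooth.continuous.comp (g := fun p : (ℝ × ℝ) × (ℝ × ℝ) × (ℝ × ℝ) => M.g p.1 p.2.1 p.2.2)
      (f := fun t => (f t, v t, w t)) (by fun_prop)

theorem bilin_bound {A B D m : ℝ} (hA : |A| ≤ m) (hB : |B| ≤ m) (hD : |D| ≤ m) (v w : ℝ × ℝ) :
    |A * (v.1 * w.1) + B * (v.1 * w.2 + v.2 * w.1) + D * (v.2 * w.2)| ≤ 4 * m * (‖v‖ * ‖w‖) := by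
  have key : ∀ {a b A : ℝ}, |A| ≤ m → |a| ≤ ‖v‖ → |b| ≤ ‖w‖ → |A * (a * b)| ≤ m * (‖v‖ * ‖w‖) := by
    intro a b A h1 h2 h3
    rw [abs_mul, abs_mul]
    have := abs_nonneg A
    gcongr
    linarith
  have v1 : |v.1| ≤ ‖v‖ := norm_fst_le v
  have v2 : |v.2| ≤ ‖v‖ := norm_snd_le v
  have w1 : |w.1| ≤ ‖w‖ := norm_fst_le w
  have w2 : |w.2| ≤ ‖w‖ := norm_snd_le w
  have k1 := abs_le.mp (key hA v1 w1)
  have k2 := abs_le.mp (key hB v1 w2)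
  have k3 := abs_le.mp (key hB v2 w1)
  have k4 := abs_le.mp (key hD v2 w2)
  rw [abs_le]
  constructor <;> nlinarith

theorem dot_vel_le_bound (M : TorusMetric) : ∃ V, 0 < V ∧ ∀ z : Ph, ham M z ≤ 1 / 2 →
    ‖vel M z.1 z.2‖ ≤ V := by
  obtain ⟨c, hc, h⟩ := g_lower M
  refine ⟨1 / c + 1, by positivity, fun z hz => ?_⟩
  have h1 := h z.1 (vel M z.1 z.2)
  rw [g_vel] at h1
  by_contra! hn
  have h3 : 0 < 1 / c := by positivity
  have h4 : c * (1 / c) = 1 := by field_simp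
  have : 1 / c + 1 ≤ ‖vel M z.1 z.2‖ ^ 2 := by nlinarith
  nlinarith

theorem two_le_infty : (2 : WithTop ℕ∞) ≤ ((⊤ : ℕ∞) : WithTop ℕ∞) :=
  WithTop.coe_le_coe.mpr (by exact_mod_cast le_top)

theorem metric_lower (M : TorusMetric) : ∃ l C, 0 < l ∧ 0 < C ∧ ∀ (z : Ph) (ξ ν : ℝ × ℝ),
    ham M z ≤ 1 / 2 →
    2 * ham M z + gder M z.1 ξ (vel M z.1 z.2) + 2 * dot z.2 ν + l * ‖ν‖ ^ 2 - C * ‖ξ‖ ^ 2 ≤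
      M.g (z.1 + ξ) (vel M z.1 z.2 + ν) (vel M z.1 z.2 + ν) := by
  obtain ⟨c, hc, hlow⟩ := g_lower M
  obtain ⟨V, hV, hVb⟩ := dot_vel_le_bound M
  obtain ⟨C1, hC1, -, -, hE1, hE2⟩ := periodic_taylor ((gE_smooth M).of_le two_le_infty) (gE_per M)
  obtain ⟨C2, hC2, -, -, hF1, hF2⟩ := periodic_taylor ((gF_smooth M).of_le two_le_infty) (gF_per M)
  obtain ⟨C3, hC3, -, -, hG1, hG2⟩ := periodic_taylor ((gG_smooth M).of_le two_le_infty) (gG_per M)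
  set C := C1 + C2 + C3 with hC
  refine ⟨c / 2, 4 * C * V ^ 2 + 32 * C ^ 2 * V ^ 2 / c, by positivity, by positivity,
    fun z ξ ν hz => ?_⟩
  have hv := hVb z hz
  have e1 := g_vel M z
  have e2 := dot_mom M z.1 (vel M z.1 z.2) ν
  rw [mom_vel] at e2
  obtain ⟨x, p⟩ := z
  simp only at *
  set v := vel M x p
  have n0 := norm_nonneg ξ
  have n1 := norm_nonneg ν
  have n2 := norm_nonneg v
  have b1 := bilin_bound (m := C * ‖ξ‖ ^ 2) ((hE2 x ξ).trans (by rw [hC]; gcongr; linarith))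
    ((hF2 x ξ).trans (by rw [hC]; gcongr; linarith))
    ((hG2 x ξ).trans (by rw [hC]; gcongr; linarith)) v v
  have b2 := bilin_bound (m := C * ‖ξ‖) ((hE1 x ξ).trans (by rw [hC]; gcongr; linarith))
    ((hF1 x ξ).trans (by rw [hC]; gcongr; linarith))
    ((hG1 x ξ).trans (by rw [hC]; gcongr; linarith)) v ν
  have b3 := hlow (x + ξ) ν
  rw [g_eq] at e1 e2 b3 ⊢
  simp only [gder, Prod.fst_add, Prod.snd_add]
  have d1 := (abs_le.mp b1).1
  have d2 := (abs_le.mp b2).1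
  have d3 : 4 * (C * ‖ξ‖ ^ 2) * (‖v‖ * ‖v‖) ≤ 4 * C * V ^ 2 * ‖ξ‖ ^ 2 := by
    have : ‖v‖ * ‖v‖ ≤ V ^ 2 := by nlinarith
    have h0 : 0 ≤ 4 * (C * ‖ξ‖ ^ 2) := by positivity
    nlinarith
  have d4 : 2 * (4 * (C * ‖ξ‖) * (‖v‖ * ‖ν‖)) ≤ c / 2 * ‖ν‖ ^ 2 + 32 * C ^ 2 * V ^ 2 / c * ‖ξ‖ ^ 2 := by
    have h1 : 2 * (4 * (C * ‖ξ‖) * (‖v‖ * ‖ν‖)) ≤ 2 * (4 * (C * ‖ξ‖) * (V * ‖ν‖)) := by gcongr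
    have h2 : c / 2 * ‖ν‖ ^ 2 + 32 * C ^ 2 * V ^ 2 / c * ‖ξ‖ ^ 2 - 2 * (4 * (C * ‖ξ‖) * (V * ‖ν‖))
      = 1 / (2 * c) * (c * ‖ν‖ - 8 * C * V * ‖ξ‖) ^ 2 := by field_simp; ring
    have h3 : 0 ≤ 1 / (2 * c) * (c * ‖ν‖ - 8 * C * V * ‖ξ‖) ^ 2 := by positivity
    linarith
  nlinarith

theorem dot_hasDerivAt {p x : ℝ → ℝ × ℝ} {p' x' : ℝ × ℝ} {t : ℝ} (hp : HasDerivAt p p' t)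
    (hx : HasDerivAt x x' t) : HasDerivAt (fun t => dot (p t) (x t)) (dot p' (x t) + dot (p t) x') t := by
  refine ((hp.fst'.mul hx.fst').add (hp.snd'.mul hx.snd')).congr_deriv ?_
  simp only [dot]; ring

theorem dot_continuous {X : Type*} [TopologicalSpace X] {p v : X → ℝ × ℝ} (hp : Continuous p)
    (hv : Continuous v) : Continuous fun t => dot (p t) (v t) := by
  unfold dot; fun_prop

theorem norm_le_integral_deriv {ξ ξ' : ℝ → ℝ × ℝ} (hξ : ∀ t, HasDerivAt ξ (ξ' t) t)
    (hc : Continuous ξ') {a b t : ℝ} (ht : t ∈ Icc a b) (h0 : ξ a = 0 ∨ ξ b = 0) :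
    ‖ξ t‖ ≤ ∫ u in a..b, ‖ξ' u‖ := by
  have hi : ∀ a b, IntervalIntegrable (fun u => ‖ξ' u‖) MeasureTheory.volume a b :=
    fun a b => hc.norm.intervalIntegrable a b
  have hs : ∫ u in a..b, ‖ξ' u‖ = (∫ u in a..t, ‖ξ' u‖) + ∫ u in t..b, ‖ξ' u‖ :=
    (intervalIntegral.integral_add_adjacent_intervals (hi _ _) (hi _ _)).symm
  have p1 : 0 ≤ ∫ u in a..t, ‖ξ' u‖ :=
    intervalIntegral.integral_nonneg ht.1 fun _ _ => norm_nonneg _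
  have p2 : 0 ≤ ∫ u in t..b, ‖ξ' u‖ :=
    intervalIntegral.integral_nonneg ht.2 fun _ _ => norm_nonneg _
  have f1 := intervalIntegral.integral_eq_sub_of_hasDerivAt (a := a) (b := t) (fun u _ => hξ u)
    (hc.intervalIntegrable _ _)
  have f2 := intervalIntegral.integral_eq_sub_of_hasDerivAt (a := t) (b := b) (fun u _ => hξ u)
    (hc.intervalIntegrable _ _)
  have n1 := intervalIntegral.norm_integral_le_integral_norm (f := ξ') ht.1 (μ := MeasureTheory.volume)
  have n2 := intervalIntegral.norm_integral_le_integral_norm (f := ξ') ht.2 (μ := MeasureTheory.volume)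
  rcases h0 with h0 | h0
  · rw [f1, h0, sub_zero] at n1; linarith
  · rw [f2, h0, zero_sub, norm_neg] at n2; linarith

/-- Short geodesics minimize the weighted energy, quantitatively. -/
theorem energy_lower (M : TorusMetric) : ∃ τ c, 0 < τ ∧ 0 < c ∧ ∀ z : Ph, ham M z ≤ 1 / 2 →
    ∀ (η η' : ℝ → ℝ × ℝ) (s s' : ℝ → ℝ) (a b : ℝ), a ≤ b → (∀ t, HasDerivAt η (η' t) t) →
    Continuous η' → (∀ t, HasDerivAt s (s' t) t) → Continuous s' → (∀ t, 0 < s' t) →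
    s b - s a ≤ 2 * τ → (η a = pos M (s a) z ∨ η b = pos M (s b) z) → ∀ t ∈ Icc a b,
    2 * ham M z * (s b - s a) + 2 * (dot (flow M (s b) z).2 (η b - pos M (s b) z) -
      dot (flow M (s a) z).2 (η a - pos M (s a) z)) + c * ‖η t - pos M (s t) z‖ ^ 2 ≤
      ∫ t in a..b, M.g (η t) (η' t) (η' t) / s' t := by
  obtain ⟨l, C, hl, hC, hlow⟩ := metric_lower M
  refine ⟨min 1 (l / (8 * C)), l / 4, by positivity, by positivity, ?_⟩
  set τ := min 1 (l / (8 * C)) with hτ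
  have hτ0 : 0 < τ := by positivity
  have hτ1 : τ ≤ 1 := min_le_left _ _
  have hτ2 : 8 * C * τ ≤ l := by
    have : τ ≤ l / (8 * C) := min_le_right _ _
    calc 8 * C * τ ≤ 8 * C * (l / (8 * C)) := by gcongr
      _ = l := by field_simp
  clear_value τ
  intro z hz η η' s s' a b hab hη hη' hs hs' hpos hS hbd
  set S := s b - s a with hSd
  have hη_c : Continuous η := continuous_iff_continuousAt.mpr fun t => (hη t).continuousAt
  have hs_c : Continuous s := continuous_iff_continuousAt.mpr fun t => (hs t).continuousAt
  set Z : ℝ → Ph := fun t => flow M (s t) z with hZ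
  have hZ_c : Continuous Z := (flow_smooth M z).continuous.comp hs_c
  set v : ℝ → ℝ × ℝ := fun t => vel M (Z t).1 (Z t).2 with hv
  have hv_c : Continuous v := (vel_smooth M).continuous.comp hZ_c
  set f : ℝ → ℝ × ℝ := fun t => force M (Z t).1 (Z t).2 with hf
  have hf_c : Continuous f := ((vf_smooth M).continuous.comp hZ_c).snd
  set ξ : ℝ → ℝ × ℝ := fun t => η t - (Z t).1 with hξ
  set ξ' : ℝ → ℝ × ℝ := fun t => η' t - s' t • v t with hξ'
  have hξ'_c : Continuous ξ' := by fun_prop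
  have hx : ∀ t, HasDerivAt (fun t => (Z t).1) (s' t • v t) t := fun t =>
    (pos_deriv M (by linarith) (s t)).scomp t (hs t)
  have hp : ∀ t, HasDerivAt (fun t => (Z t).2) (s' t • f t) t := fun t =>
    (mom_deriv M (by linarith) (s t)).scomp t (hs t)
  have hξd : ∀ t, HasDerivAt ξ (ξ' t) t := fun t => (hη t).sub (hx t)
  have hξ_c : Continuous ξ := continuous_iff_continuousAt.mpr fun t => (hξd t).continuousAt
  have h0 : ξ a = 0 ∨ ξ b = 0 := by
    rcases hbd with h | h
    · left; simp only [hξ, h]; exact sub_self _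
    · right; simp only [hξ, h]; exact sub_self _
  obtain ⟨tm, htm, hmax⟩ := isCompact_Icc.exists_isMaxOn (nonempty_Icc.mpr hab)
    (hξ_c.norm.continuousOn (s := Icc a b))
  set m := ‖ξ tm‖ with hm
  have hm0 : 0 ≤ m := norm_nonneg _
  have hmax' : ∀ t ∈ Icc a b, ‖ξ t‖ ≤ m := fun t ht => hmax ht
  have h_int := norm_le_integral_deriv hξd hξ'_c htm h0
  set F : ℝ → ℝ := fun t => 2 * ham M z * s t + 2 * dot (Z t).2 (ξ t) with hF
  set F' : ℝ → ℝ := fun t => 2 * ham M z * s' t +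
    2 * (dot (s' t • f t) (ξ t) + dot (Z t).2 (ξ' t)) with hF'
  have hFd : ∀ t, HasDerivAt F (F' t) t := fun t =>
    ((hs t).const_mul _).add ((dot_hasDerivAt (hp t) (hξd t)).const_mul 2)
  have hF'_c : Continuous F' := by
    have h1 := dot_continuous (hs'.smul hf_c) hξ_c
    have h2 := dot_continuous hZ_c.snd hξ'_c
    fun_prop
  have main : ∀ κ : ℝ, 0 ≤ κ → F b - F a + 2 * l * κ * m - (l * κ ^ 2 + C * m ^ 2) * S ≤
      ∫ t in a..b, M.g (η t) (η' t) (η' t) / s' t := by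
    intro κ hκ
    have i1 : ∫ t in a..b, F' t = F b - F a :=
      intervalIntegral.integral_eq_sub_of_hasDerivAt (fun t _ => hFd t)
        (hF'_c.intervalIntegrable _ _)
    have i2 : ∫ t in a..b, s' t = S :=
      intervalIntegral.integral_eq_sub_of_hasDerivAt (fun t _ => hs t)
        (hs'.intervalIntegrable _ _)
    have i3 : ∫ t in a..b, (F' t + 2 * l * κ * ‖ξ' t‖ - (l * κ ^ 2 + C * m ^ 2) * s' t) =
        F b - F a + 2 * l * κ * (∫ t in a..b, ‖ξ' t‖) - (l * κ ^ 2 + C * m ^ 2) * S := by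
      have hc1 : Continuous fun t => F' t + 2 * l * κ * ‖ξ' t‖ := by fun_prop
      rw [intervalIntegral.integral_sub (hc1.intervalIntegrable _ _)
        ((hs'.const_mul _).intervalIntegrable _ _),
        intervalIntegral.integral_add (hF'_c.intervalIntegrable _ _)
          ((hξ'_c.norm.const_mul _).intervalIntegrable _ _),
        intervalIntegral.integral_const_mul, intervalIntegral.integral_const_mul, i1, i2]
    have i4 : ∫ t in a..b, (F' t + 2 * l * κ * ‖ξ' t‖ - (l * κ ^ 2 + C * m ^ 2) * s' t) ≤
        ∫ t in a..b, M.g (η t) (η' t) (η' t) / s' t := by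
      refine intervalIntegral.integral_mono_on hab
        (((hF'_c.add (hξ'_c.norm.const_mul _)).sub (hs'.const_mul _)).intervalIntegrable _ _)
        (((g_continuous M hη_c hη' hη').div hs' fun t => (hpos t).ne').intervalIntegrable _ _)
        fun t ht => ?_
      have hst := hpos t
      have k1 := hlow (Z t) (ξ t) ((s' t)⁻¹ • ξ' t) (by rw [hZ]; simp only; rwa [ham_flow])
      have e1 : (Z t).1 + ξ t = η t := by simp [hξ]
      have e2 : vel M (Z t).1 (Z t).2 + (s' t)⁻¹ • ξ' t = (s' t)⁻¹ • η' t := by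
        rw [hξ', hv]; simp only; rw [smul_sub, smul_smul, inv_mul_cancel₀ hst.ne', one_smul]
        abel
      have e3 : M.g (η t) ((s' t)⁻¹ • η' t) ((s' t)⁻¹ • η' t) =
          ((s' t)⁻¹) ^ 2 * M.g (η t) (η' t) (η' t) := by
        rw [g_eq, g_eq]; simp only [Prod.smul_fst, Prod.smul_snd, smul_eq_mul]; ring
      have e4 : ham M (Z t) = ham M z := ham_flow M _ _
      have e5 := dot_force M (Z t).1 (Z t).2 (ξ t)
      rw [e1, e2, e3, e4, dot_smul_right, norm_smul, Real.norm_eq_abs,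
        abs_of_pos (inv_pos.mpr hst)] at k1
      have k2 := mul_le_mul_of_nonneg_left k1 hst.le
      have e6 : s' t * ((s' t)⁻¹ ^ 2 * M.g (η t) (η' t) (η' t)) = M.g (η t) (η' t) (η' t) / s' t := by
        field_simp
      rw [e6] at k2
      refine le_trans ?_ k2
      have k3 := hmax' t ht
      have k4 : C * s' t * ‖ξ t‖ ^ 2 ≤ C * s' t * m ^ 2 := by gcongr
      have k5 : 2 * l * κ * ‖ξ' t‖ - l * κ ^ 2 * s' t ≤ s' t * (l * ((s' t)⁻¹ * ‖ξ' t‖) ^ 2) := by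
        have : s' t * (l * ((s' t)⁻¹ * ‖ξ' t‖) ^ 2) - (2 * l * κ * ‖ξ' t‖ - l * κ ^ 2 * s' t)
          = s' t * l * ((s' t)⁻¹ * ‖ξ' t‖ - κ) ^ 2 := by field_simp; ring
        have h9 : 0 ≤ s' t * l * ((s' t)⁻¹ * ‖ξ' t‖ - κ) ^ 2 := by positivity
        linarith
      have k6 : s' t * (2 * ((s' t)⁻¹ * dot (Z t).2 (ξ' t))) = 2 * dot (Z t).2 (ξ' t) := by
        field_simp
      simp only [hF']
      rw [dot_smul_left, hf]
      simp only
      rw [e5]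
      linarith
    have : 2 * l * κ * m ≤ 2 * l * κ * ∫ t in a..b, ‖ξ' t‖ := by gcongr
    linarith
  have hFF : F b - F a = 2 * ham M z * S + 2 * (dot (flow M (s b) z).2 (η b - pos M (s b) z) -
      dot (flow M (s a) z).2 (η a - pos M (s a) z)) := by
    simp only [hF, hξ, hZ, pos]; ring
  intro t ht
  rw [← hFF]
  have ht' : l / 4 * ‖η t - pos M (s t) z‖ ^ 2 ≤ l / 4 * m ^ 2 := by
    have := hmax' t ht
    gcongr
    exact this
  rcases hab.eq_or_lt with rfl | hab'
  · have hmz : m = 0 := by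
      have : tm = a := le_antisymm htm.2 htm.1
      rw [hm, this]; simpa using h0
    have := main 0 le_rfl
    rw [hmz] at this ht'
    simp at this ht' ⊢
    simpa using ht'
  · have hSpos : 0 < S := by
      have : StrictMono s := strictMono_of_deriv_pos fun t => by rw [(hs t).deriv]; exact hpos t
      exact sub_pos.mpr (this hab')
    have := main (m / S) (by positivity)
    have e : 2 * l * (m / S) * m - (l * (m / S) ^ 2 + C * m ^ 2) * S = (l - C * S ^ 2) * m ^ 2 / S := by
      field_simp; ring
    have e2 : l / 4 * m ^ 2 ≤ (l - C * S ^ 2) * m ^ 2 / S := by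
      rw [le_div_iff₀ hSpos]
      have h1 : C * S ^ 2 ≤ l / 2 := by
        have : S ^ 2 ≤ (2 * τ) ^ 2 := by gcongr
        calc C * S ^ 2 ≤ C * (2 * τ) ^ 2 := by gcongr
          _ = (8 * C * τ) * τ / 2 := by ring
          _ ≤ l * 1 / 2 := by gcongr
          _ = l / 2 := by ring
      have h2 : l / 4 * S ≤ l / 2 := by nlinarith
      nlinarith [sq_nonneg m]
    linarith

/-! ### Short geodesics between nearby points -/

theorem flow_accel (M : TorusMetric) : ∃ L : NNReal, ∃ W : Ph → (ℝ × ℝ), LipschitzWith L W ∧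
    ∀ z, ham M z ≤ 1 →
      ∀ t, HasDerivAt (fun t => vel M (flow M t z).1 (flow M t z).2) (W (flow M t z)) t := by
  set U : Ph → ℝ × ℝ := fun z => (cvf M z).1 with hU
  have hUs : ContDiff ℝ (⊤ : ℕ∞) U := (cvf_smooth M).fst
  set W : Ph → ℝ × ℝ := fun z => fderiv ℝ U z (cvf M z) with hW
  have hWs : ContDiff ℝ (⊤ : ℕ∞) W :=
    (hUs.fderiv_right (by norm_num)).clm_apply (cvf_smooth M)
  have hWp : ∀ (k : ℤ × ℤ) x p, W (x + lat k, p) = W (x, p) := by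
    intro k x y
    have := fderiv_comp_add_right (𝕜 := ℝ) (f := U) (x := (x, y)) (lat k, (0 : ℝ × ℝ))
    simp only [Prod.mk_add_mk, add_zero] at this
    simp only [hW]
    rw [cvf_per, ← this]
    congr 2
    funext z
    obtain ⟨z1, z2⟩ := z
    simp only [hU, Prod.mk_add_mk, add_zero, cvf_per]
  obtain ⟨c, hc, h⟩ := ham_lower M
  obtain ⟨L, hL, -⟩ := lipschitz_of_periodic (hWs.of_le (by norm_num)) hWp
    (R := 2 / c + 1) fun x p hp => by
      have h1 := h x p
      have h3 : 0 < 2 / c := by positivity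
      have h2 : 2 ≤ ham M (x, p) := by
        have : 2 / c + 1 ≤ ‖p‖ ^ 2 := by nlinarith
        have h4 : c * (2 / c) = 2 := by field_simp
        nlinarith
      simp only [hW]
      rw [cvf, Real.smoothTransition.zero_of_nonpos (by linarith), zero_smul, map_zero]
  refine ⟨L, W, hL, fun z hz t => ?_⟩
  have := ((hUs.differentiable (by norm_num)) (flow M t z)).hasFDerivAt.comp_hasDerivAt t
    (flow_deriv' M z t)
  refine this.congr_of_eventuallyEq (Eventually.of_forall fun s => ?_)
  simp only [hU, Function.comp]
  rw [cvf_eq_vf M (by rwa [ham_flow]), vf]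

theorem pos_expansion (M : TorusMetric) : ∃ C, 0 < C ∧ ∀ x p q, ham M (x, p) ≤ 1 →
    ham M (x, q) ≤ 1 → ∀ t, 0 ≤ t → t ≤ 1 →
    ‖pos M t (x, p) - pos M t (x, q) - t • vel M x (p - q)‖ ≤ C * t ^ 2 * ‖p - q‖ := by
  obtain ⟨L, W, hL, hW⟩ := flow_accel M
  set C := L * Real.exp (flowK M) + 1 with hC
  have hLe : 0 ≤ L * Real.exp (flowK M) := by positivity
  refine ⟨C, by positivity, fun x p q hp hq t ht ht1 => ?_⟩
  set A : ℝ → ℝ × ℝ := fun s => vel M (flow M s (x, p)).1 (flow M s (x, p)).2 -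
    vel M (flow M s (x, q)).1 (flow M s (x, q)).2 with hA
  have hn : ‖((x, p) : Ph) - (x, q)‖ = ‖p - q‖ := by
    simp [Prod.norm_def]
  have hA0 : A 0 = vel M x (p - q) := by simp [hA, flow_zero, vel_sub]
  have hAd : ∀ s, HasDerivAt A (W (flow M s (x, p)) - W (flow M s (x, q))) s :=
    fun s => (hW _ hp s).sub (hW _ hq s)
  have hb1 : ∀ s ∈ Icc (0 : ℝ) t, ‖W (flow M s (x, p)) - W (flow M s (x, q))‖ ≤ C * ‖p - q‖ := by
    intro s hs
    have h1 := hL.dist_le_mul (flow M s (x, p)) (flow M s (x, q))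
    rw [dist_eq_norm, dist_eq_norm] at h1
    have h2 := flow_lip_pos M (x, p) (x, q) hs.1
    rw [hn] at h2
    have h3 : Real.exp (flowK M * s) ≤ Real.exp (flowK M) := by
      apply Real.exp_le_exp.mpr
      have : (0 : ℝ) ≤ flowK M := NNReal.coe_nonneg _
      have := hs.2
      nlinarith
    calc _ ≤ _ := h1
      _ ≤ L * (Real.exp (flowK M) * ‖p - q‖) := by
        gcongr
        exact h2.trans (by gcongr)
      _ ≤ C * ‖p - q‖ := by rw [hC]; nlinarith [norm_nonneg (p - q)]
  have hb2 : ∀ s ∈ Icc (0 : ℝ) t, ‖A s - A 0‖ ≤ C * ‖p - q‖ * t := by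
    intro s hs
    have := (convex_Icc (0 : ℝ) t).norm_image_sub_le_of_norm_hasDerivWithin_le
      (fun u _ => (hAd u).hasDerivWithinAt) hb1 (left_mem_Icc.mpr ht) hs
    refine this.trans ?_
    rw [sub_zero, Real.norm_eq_abs, abs_of_nonneg hs.1]
    have := hs.2
    gcongr
  have hD : ∀ s, HasDerivAt (fun s => pos M s (x, p) - pos M s (x, q) - s • vel M x (p - q))
      (A s - A 0) s := by
    intro s
    refine (((pos_deriv M hp s).sub (pos_deriv M hq s)).sub
      ((hasDerivAt_id s).smul_const (vel M x (p - q)))).congr_deriv ?_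
    rw [hA0, one_smul]
  have := (convex_Icc (0 : ℝ) t).norm_image_sub_le_of_norm_hasDerivWithin_le
      (fun u _ => (hD u).hasDerivWithinAt) hb2 (left_mem_Icc.mpr ht) (right_mem_Icc.mpr ht)
  simp only [pos_zero, sub_self, zero_smul, sub_zero] at this
  rw [Real.norm_eq_abs, abs_of_nonneg ht] at this
  linarith

theorem mom_bound (M : TorusMetric) : ∃ G, 0 < G ∧ ∀ x v, ‖mom M x v‖ ≤ G * ‖v‖ := by
  obtain ⟨C1, hC1, h1⟩ := periodic_bounded' (gE_smooth M).continuous (gE_per M)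
  obtain ⟨C2, hC2, h2⟩ := periodic_bounded' (gF_smooth M).continuous (gF_per M)
  obtain ⟨C3, hC3, h3⟩ := periodic_bounded' (gG_smooth M).continuous (gG_per M)
  refine ⟨C1 + 2 * C2 + C3, by positivity, fun x v => ?_⟩
  have v1 := norm_fst_le v
  have v2 := norm_snd_le v
  have n := norm_nonneg v
  rw [Prod.norm_def, mom, max_le_iff]
  constructor
  · refine (norm_add_le _ _).trans ?_
    rw [norm_mul, norm_mul]
    have := mul_le_mul (h1 x) v1 (norm_nonneg _) hC1.le
    have := mul_le_mul (h2 x) v2 (norm_nonneg _) hC2.le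
    nlinarith [mul_nonneg hC2.le n, mul_nonneg hC3.le n]
  · refine (norm_add_le _ _).trans ?_
    rw [norm_mul, norm_mul]
    have := mul_le_mul (h2 x) v1 (norm_nonneg _) hC2.le
    have := mul_le_mul (h3 x) v2 (norm_nonneg _) hC3.le
    nlinarith [mul_nonneg hC2.le n, mul_nonneg hC1.le n]

theorem ham_upper (M : TorusMetric) : ∃ C, 0 < C ∧ ∀ x p, ham M (x, p) ≤ C * ‖p‖ ^ 2 := by
  obtain ⟨C, hC, h⟩ := periodic_bounded (ham_smooth M).continuous (ham_per M)
    (isCompact_closedBall (0 : ℝ × ℝ) 1)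
  refine ⟨C, hC, fun x p => ?_⟩
  by_cases hp : p = 0
  · simp [hp, ham, dot]
  · have hp' : 0 < ‖p‖ := norm_pos_iff.mpr hp
    have h1 := h x (‖p‖⁻¹ • p) (by simp [norm_smul, hp'.ne'])
    have h2 := ham_smul M x (‖p‖⁻¹ • p) ‖p‖
    rw [smul_smul, mul_inv_cancel₀ hp'.ne', one_smul] at h2
    have h3 := (le_abs_self _).trans h1
    rw [h2]
    nlinarith [sq_nonneg ‖p‖]

theorem flow_zero_mom (M : TorusMetric) (x : ℝ × ℝ) (t : ℝ) : flow M t (x, 0) = (x, 0) := by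
  symm
  refine flow_unique M (f := fun _ => (x, 0)) (fun t => ?_) rfl t
  have : cvf M (x, 0) = 0 := by
    simp [cvf, vf, force, gder, vel]
  rw [this]
  exact hasDerivAt_const _ _

/-- Nearby points are joined in time `τ` by an orbit of low energy. -/
theorem exists_short_orbit (M : TorusMetric) : ∃ τ₁, 0 < τ₁ ∧ ∀ τ, 0 < τ → τ ≤ τ₁ → ∀ r, 0 < r →
    ∃ r₁, 0 < r₁ ∧ ∀ x y : ℝ × ℝ, ‖x - y‖ ≤ r₁ → ∃ p, ham M (x, p) ≤ r ∧ pos M τ (x, p) = y := by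
  obtain ⟨C, hC, hexp⟩ := pos_expansion M
  obtain ⟨G, hG, hmom⟩ := mom_bound M
  obtain ⟨H, hH, hham⟩ := ham_upper M
  refine ⟨min 1 (1 / (2 * G * C)), by positivity, fun τ hτ hτ1 r hr => ?_⟩
  have hτ2 : τ ≤ 1 := hτ1.trans (min_le_left _ _)
  have hτ3 : G * C * τ ≤ 1 / 2 := by
    have : τ ≤ 1 / (2 * G * C) := hτ1.trans (min_le_right _ _)
    calc G * C * τ ≤ G * C * (1 / (2 * G * C)) := by gcongr
      _ = 1 / 2 := by field_simp
  set R := min 1 (min 1 r / H) with hR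
  have hR0 : 0 < R := by positivity
  have hR1 : H * R ^ 2 ≤ min 1 r := by
    have h1 : R ≤ 1 := min_le_left _ _
    have h2 : R ≤ min 1 r / H := min_le_right _ _
    have h3 : R ^ 2 ≤ R := by nlinarith
    calc H * R ^ 2 ≤ H * R := by gcongr
      _ ≤ H * (min 1 r / H) := by gcongr
      _ = min 1 r := by field_simp
  refine ⟨τ * R / (2 * G), by positivity, fun x y hxy => ?_⟩
  have hball : ∀ p ∈ Metric.closedBall (0 : ℝ × ℝ) R, ham M (x, p) ≤ min 1 r := by
    intro p hp
    rw [mem_closedBall_zero_iff] at hp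
    exact (hham x p).trans (le_trans (by gcongr) hR1)
  set T : ℝ × ℝ → ℝ × ℝ := fun p => p - τ⁻¹ • mom M x (pos M τ (x, p) - y) with hT
  have hdiff : ∀ p ∈ Metric.closedBall (0 : ℝ × ℝ) R, ∀ q ∈ Metric.closedBall (0 : ℝ × ℝ) R,
      ‖T p - T q‖ ≤ 1 / 2 * ‖p - q‖ := by
    intro p hp q hq
    have h1 := hexp x p q ((hball p hp).trans (min_le_left _ _))
      ((hball q hq).trans (min_le_left _ _)) τ hτ.le hτ2
    have e : T p - T q = -(τ⁻¹ • mom M x (pos M τ (x, p) - pos M τ (x, q) - τ • vel M x (p - q))) := by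
      rw [mom_sub, mom_smul, mom_vel, smul_sub, smul_smul, inv_mul_cancel₀ hτ.ne', one_smul]
      simp only [hT]
      rw [mom_sub, mom_sub, mom_sub, smul_sub, smul_sub, smul_sub]
      abel
    rw [e, norm_neg, norm_smul, Real.norm_eq_abs, abs_of_pos (inv_pos.mpr hτ)]
    calc _ ≤ τ⁻¹ * (G * (C * τ ^ 2 * ‖p - q‖)) := by
          gcongr
          exact (hmom _ _).trans (by gcongr)
      _ = G * C * τ * ‖p - q‖ := by field_simp
      _ ≤ _ := by gcongr
  have hT0 : ‖T 0‖ ≤ R / 2 := by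
    have e : T 0 = -(τ⁻¹ • mom M x (x - y)) := by
      simp only [hT, pos, flow_zero_mom]; simp
    rw [e, norm_neg, norm_smul, Real.norm_eq_abs, abs_of_pos (inv_pos.mpr hτ)]
    calc _ ≤ τ⁻¹ * (G * (τ * R / (2 * G))) := by
          gcongr
          exact (hmom _ _).trans (by gcongr)
      _ = R / 2 := by field_simp
  have hz : (0 : ℝ × ℝ) ∈ Metric.closedBall (0 : ℝ × ℝ) R := by simp [hR0.le]
  have hmaps : MapsTo T (Metric.closedBall 0 R) (Metric.closedBall 0 R) := by
    intro p hp
    have h1 := hdiff p hp 0 hz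
    rw [mem_closedBall_zero_iff] at hp ⊢
    rw [sub_zero] at h1
    calc ‖T p‖ = ‖(T p - T 0) + T 0‖ := by rw [sub_add_cancel]
      _ ≤ ‖T p - T 0‖ + ‖T 0‖ := norm_add_le _ _
      _ ≤ R := by linarith
  have hcon : ContractingWith (1 / 2) (hmaps.restrict T _ _) := by
    refine ⟨by rw [← NNReal.coe_lt_coe]; norm_num, LipschitzWith.of_dist_le_mul fun p q => ?_⟩
    have := hdiff p p.2 q q.2
    rw [Subtype.dist_eq, Subtype.dist_eq, dist_eq_norm, dist_eq_norm]
    simpa using this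
  obtain ⟨p, hp, hfix, -⟩ := hcon.exists_fixedPoint' Metric.isClosed_closedBall.isComplete hmaps
    hz (edist_ne_top _ _)
  refine ⟨p, (hball p hp).trans (min_le_right _ _), ?_⟩
  have h1 : p - τ⁻¹ • mom M x (pos M τ (x, p) - y) = p := hfix
  rw [sub_eq_self, smul_eq_zero] at h1
  rcases h1 with h1 | h1
  · exact absurd h1 (inv_pos.mpr hτ).ne'
  · have := vel_mom M x (pos M τ (x, p) - y)
    rw [h1] at this
    have h3 : vel M x 0 = 0 := by simp [vel]
    rw [h3] at this
    exact (sub_eq_zero.mp this.symm)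

/-! ### Uniqueness of short orbits and the corner cutting inequality -/

/-- The conclusion of `energy_lower` for given constants `τ` and `c`. -/
def EnergyBound (M : TorusMetric) (τ c : ℝ) : Prop :=
  0 < τ ∧ 0 < c ∧ ∀ z : Ph, ham M z ≤ 1 / 2 →
    ∀ (η η' : ℝ → ℝ × ℝ) (s s' : ℝ → ℝ) (a b : ℝ), a ≤ b → (∀ t, HasDerivAt η (η' t) t) →
      Continuous η' → (∀ t, HasDerivAt s (s' t) t) → Continuous s' → (∀ t, 0 < s' t) →
      s b - s a ≤ 2 * τ → (η a = pos M (s a) z ∨ η b = pos M (s b) z) → ∀ t ∈ Icc a b,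
      2 * ham M z * (s b - s a) + 2 * (dot (flow M (s b) z).2 (η b - pos M (s b) z) -
        dot (flow M (s a) z).2 (η a - pos M (s a) z)) + c * ‖η t - pos M (s t) z‖ ^ 2 ≤
      ∫ t in a..b, M.g (η t) (η' t) (η' t) / s' t

theorem EnergyBound.mono {M : TorusMetric} {τ τ' c : ℝ} (h : EnergyBound M τ c) (h0 : 0 < τ')
    (h1 : τ' ≤ τ) : EnergyBound M τ' c :=
  ⟨h0, h.2.1, fun z hz η η' s s' a b hab hη hη' hs hs' hpos hle =>
    h.2.2 z hz η η' s s' a b hab hη hη' hs hs' hpos (by linarith)⟩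

theorem dot_zero_right (p : ℝ × ℝ) : dot p 0 = 0 := by simp [dot]

theorem vel_flow_continuous (M : TorusMetric) (z : Ph) :
    Continuous fun t => vel M (flow M t z).1 (flow M t z).2 :=
  (vel_smooth M).continuous.comp (flow_smooth M z).continuous

theorem g_vel_flow (M : TorusMetric) (z : Ph) (t : ℝ) :
    M.g (pos M t z) (vel M (flow M t z).1 (flow M t z).2) (vel M (flow M t z).1 (flow M t z).2) =
      2 * ham M z := by
  rw [pos, g_vel, ham_flow]

theorem energy_orbit {M : TorusMetric} {τ c : ℝ} (h : EnergyBound M τ c) {y z : Ph}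
    (hz : ham M z ≤ 1 / 2) (hy : ham M y ≤ 1) {a b : ℝ} (hab : a ≤ b) (hba : b - a ≤ 2 * τ)
    (he : pos M a y = pos M a z ∨ pos M b y = pos M b z) {t : ℝ} (ht : t ∈ Icc a b) :
    2 * ham M z * (b - a) + 2 * (dot (flow M b z).2 (pos M b y - pos M b z) -
        dot (flow M a z).2 (pos M a y - pos M a z)) + c * ‖pos M t y - pos M t z‖ ^ 2 ≤
      2 * ham M y * (b - a) := by
  have := h.2.2 z hz (fun t => pos M t y) _ id (fun _ => 1) a b hab (fun t => pos_deriv M hy t)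
    (vel_flow_continuous M y) (fun t => hasDerivAt_id t) continuous_const (fun _ => one_pos)
    hba he t ht
  simp only [id, g_vel_flow, div_one, intervalIntegral.integral_const, smul_eq_mul] at this
  linarith

theorem flow_cancel (M : TorusMetric) {t : ℝ} {y z : Ph} (h : flow M t y = flow M t z) : y = z := by
  have := congrArg (flow M (-t)) h
  rwa [← flow_add, ← flow_add, neg_add_cancel, flow_zero, flow_zero] at this

theorem flow_eq_of_pos_eventuallyEq (M : TorusMetric) {y z : Ph} (hy : ham M y ≤ 1)
    (hz : ham M z ≤ 1) {s t : ℝ} (h : (fun u => pos M (s + u) y) =ᶠ[𝓝 0] fun u => pos M (t + u) z) :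
    flow M s y = flow M t z := by
  have hd : ∀ (w : Ph) (s : ℝ), ham M w ≤ 1 →
      HasDerivAt (fun u => pos M (s + u) w) (vel M (flow M s w).1 (flow M s w).2) 0 := by
    intro w s hw
    have h1 := pos_deriv M hw (s + 0)
    have h2 := h1.comp_const_add s 0
    simpa using h2
  have h1 := ((hd z t hz).congr_of_eventuallyEq h).unique (hd y s hy)
  have h0 : (flow M s y).1 = (flow M t z).1 := by simpa [pos] using h.self_of_nhds
  refine Prod.ext h0 ?_
  rw [← mom_vel M (flow M s y).1 (flow M s y).2, ← mom_vel M (flow M t z).1 (flow M t z).2, h1, h0]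

theorem eq_of_pos_eqOn (M : TorusMetric) {y z : Ph} (hy : ham M y ≤ 1) (hz : ham M z ≤ 1) {a b : ℝ}
    (hab : a < b) (h : ∀ t ∈ Icc a b, pos M t y = pos M t z) : y = z := by
  refine flow_cancel M (t := (a + b) / 2) (flow_eq_of_pos_eventuallyEq M hy hz ?_)
  have hc : ContinuousAt (fun u : ℝ => (a + b) / 2 + u) 0 := by fun_prop
  have : Icc a b ∈ 𝓝 ((a + b) / 2 + 0) := Icc_mem_nhds (by linarith) (by linarith)
  filter_upwards [hc this] with u hu using h _ hu

/-- Two orbits of small energy joining the same points in time `τ` coincide. -/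
theorem orbit_unique {M : TorusMetric} {τ c : ℝ} (h : EnergyBound M τ c) {y z : Ph}
    (hz : ham M z ≤ 1 / 2) (hy : ham M y ≤ 1 / 2) (h0 : y.1 = z.1) (h1 : pos M τ y = pos M τ z) :
    y = z := by
  refine eq_of_pos_eqOn M (by linarith) (by linarith) h.1 fun t ht => ?_
  have h0' : pos M 0 y = pos M 0 z := by rw [pos_zero, pos_zero, h0]
  have e1 := energy_orbit h hz (by linarith) h.1.le (by linarith [h.1]) (Or.inl h0') ht
  have e2 := energy_orbit h hy (by linarith) h.1.le (by linarith [h.1]) (Or.inl h0'.symm) ht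
  rw [h0', h1, sub_self, sub_self, dot_zero_right, dot_zero_right] at e1 e2
  rw [norm_sub_rev] at e2
  have : ‖pos M t y - pos M t z‖ ^ 2 = 0 := by
    have := h.2.1
    nlinarith [sq_nonneg ‖pos M t y - pos M t z‖]
  exact sub_eq_zero.mp (norm_eq_zero.mp (pow_eq_zero_iff (two_ne_zero) |>.mp this))

/-- Cutting the corner of a broken orbit does not increase the energy; a broken orbit that cannot
be shortened in this way is unbroken. -/
theorem corner_cut {M : TorusMetric} {τ c : ℝ} (h : EnergyBound M τ c) {z z' z'' : Ph}
    (hz : ham M z ≤ 1 / 2) (hz' : ham M z' ≤ 1 / 2) (hz'' : ham M z'' ≤ 1 / 2)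
    (h1 : pos M τ z = z'.1) (h2 : z''.1 = z.1) (h3 : pos M τ z'' = pos M τ z')
    : ham M z'' / 2 ≤ ham M z + ham M z' ∧
      (ham M z + ham M z' ≤ ham M z'' / 2 → z' = flow M τ z) := by
  set y := scal (1 / 2) z'' with hy_def
  have hy : ham M y = ham M z'' / 4 := by rw [hy_def, ham_scal]; ring
  have hy' : ham M y ≤ 1 / 2 := by linarith [ham_nonneg M z'']
  have hp : ∀ t, pos M t y = pos M (1 / 2 * t) z'' := fun t =>
    pos_scal M (by linarith) (by linarith) t
  have hw : ∀ t, pos M t (flow M (-τ) z') = pos M (t - τ) z' := fun t => by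
    rw [pos, ← flow_add, ← sub_eq_add_neg, pos]
  have hτ := h.1
  have hc := h.2.1
  have E1 : ∀ t ∈ Icc 0 τ, _ := fun t ht => energy_orbit h (y := z) (z := y) hy' (by linarith)
    hτ.le (by linarith) (Or.inl (by rw [pos_zero, pos_zero, ← h2]; rfl)) ht
  have E2 : ∀ t ∈ Icc τ (2 * τ), _ := fun t ht => energy_orbit h (y := flow M (-τ) z') (z := y) hy'
    (by rw [ham_flow]; linarith) (by linarith) (by linarith)
    (Or.inr (by rw [hw, hp, two_mul, add_sub_cancel_right, ← h3]; congr 1; ring)) ht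
  have k0 : pos M 0 z - pos M 0 y = 0 := by
    rw [pos_zero, pos_zero, sub_eq_zero, ← h2]; rfl
  have k1 : pos M (2 * τ) (flow M (-τ) z') - pos M (2 * τ) y = 0 := by
    rw [hw, hp, sub_eq_zero, two_mul, add_sub_cancel_right, ← h3]; congr 1; ring
  have k2 : pos M τ (flow M (-τ) z') = pos M τ z := by rw [hw, sub_self, pos_zero, h1]
  simp only [k0, k1, k2, dot_zero_right, ham_flow, hy] at E1 E2
  have hτm : τ ∈ Icc 0 τ := ⟨hτ.le, le_rfl⟩
  have hτm' : τ ∈ Icc τ (2 * τ) := ⟨le_rfl, by linarith⟩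
  refine ⟨?_, fun hle => ?_⟩
  · have e1 := E1 τ hτm
    have e2 := E2 τ hτm'
    rw [k2] at e2
    have : ham M z'' / 2 * τ ≤ (ham M z + ham M z') * τ := by
      nlinarith [sq_nonneg ‖pos M τ z - pos M τ y‖]
    exact le_of_mul_le_mul_right this hτ
  have hle' : (ham M z + ham M z') * τ ≤ ham M z'' / 2 * τ := by gcongr
  have Z1 : z = y := eq_of_pos_eqOn M (by linarith) (by linarith) hτ fun t ht => by
    have e1 := E1 t ht
    have e2 := E2 τ hτm'
    have : ‖pos M t z - pos M t y‖ ^ 2 = 0 := by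
      nlinarith [sq_nonneg ‖pos M t z - pos M t y‖, sq_nonneg ‖pos M τ z - pos M τ y‖]
    exact sub_eq_zero.mp (norm_eq_zero.mp (pow_eq_zero_iff (two_ne_zero) |>.mp this))
  have Z2 : flow M (-τ) z' = y := by
    refine eq_of_pos_eqOn M (by rw [ham_flow]; linarith) (by linarith)
      (by linarith : τ < 2 * τ) fun t ht => ?_
    have e1 := E1 τ hτm
    have e2 := E2 t ht
    have : ‖pos M t (flow M (-τ) z') - pos M t y‖ ^ 2 = 0 := by
      nlinarith [sq_nonneg ‖pos M t (flow M (-τ) z') - pos M t y‖,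
        sq_nonneg ‖pos M τ z - pos M τ y‖]
    exact sub_eq_zero.mp (norm_eq_zero.mp (pow_eq_zero_iff (two_ne_zero) |>.mp this))
  rw [Z1, ← Z2, ← flow_add, add_neg_cancel, flow_zero]

/-! ### Geodesics and flow orbits -/

theorem length_eq_of_speed (M : TorusMetric) {η : ℝ → ℝ × ℝ} {k a b : ℝ}
    (h : ∀ t, M.g (η t) (deriv η t) (deriv η t) = k) :
    M.length η a b = (b - a) * Real.sqrt k := by
  simp [TorusMetric.length, h]

theorem length_nonneg (M : TorusMetric) (η : ℝ → ℝ × ℝ) {a b : ℝ} (hab : a ≤ b) :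
    0 ≤ M.length η a b :=
  intervalIntegral.integral_nonneg hab fun _ _ => Real.sqrt_nonneg _

theorem dist_le_length (M : TorusMetric) {η : ℝ → ℝ × ℝ} (h : ContDiff ℝ 1 η) :
    M.dist (η 0) (η 1) ≤ M.length η 0 1 := by
  refine csInf_le ⟨0, ?_⟩ ⟨η, h, rfl, rfl, rfl⟩
  rintro L ⟨c, -, -, -, rfl⟩
  exact length_nonneg M c zero_le_one

/-- Distance bound by the length of an orbit segment. -/
theorem dist_orbit_le (M : TorusMetric) {z : Ph} (hz : ham M z ≤ 1) (a : ℝ) {d : ℝ} (hd : 0 ≤ d) :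
    M.dist (pos M a z) (pos M (a + d) z) ≤ d * Real.sqrt (2 * ham M z) := by
  set η : ℝ → ℝ × ℝ := fun t => pos M (a + d * t) z with hη
  have hs : ContDiff ℝ 1 η :=
    ((pos_smooth M z).of_le (by norm_num)).comp (contDiff_const.add (contDiff_const.mul contDiff_id))
  have hder : ∀ t, HasDerivAt η
      (d • vel M (flow M (a + d * t) z).1 (flow M (a + d * t) z).2) t := fun t => by
    have hin : HasDerivAt (fun t => a + d * t) d t :=
      (((hasDerivAt_id t).const_mul d).const_add a).congr_deriv (by simp)
    exact (pos_deriv M hz (a + d * t)).scomp t hin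
  have hg : ∀ t, M.g (η t) (deriv η t) (deriv η t) = d ^ 2 * (2 * ham M z) := fun t => by
    rw [(hder t).deriv, ← g_vel_flow M z (a + d * t), g_eq, g_eq]
    simp only [Prod.smul_fst, Prod.smul_snd, smul_eq_mul, hη]; ring
  have h1 := dist_le_length M hs
  rw [length_eq_of_speed M hg, Real.sqrt_mul (sq_nonneg d), Real.sqrt_sq hd] at h1
  simpa [hη] using h1

theorem speed_sq_le_of_length {M : TorusMetric} {τ c : ℝ} (h : EnergyBound M τ c) {z : Ph}
    (hz : ham M z = 1 / 2) {a D : ℝ} (hD : 0 < D) (hDτ : D ≤ 2 * τ) {η : ℝ → ℝ × ℝ}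
    (hη : ContDiff ℝ 1 η) (h0 : η 0 = pos M a z) (h1 : η 1 = pos M (a + D) z) :
    D ≤ M.length η 0 1 := by
  set L := M.length η 0 1 with hL
  have hL0 : 0 ≤ L := length_nonneg M η zero_le_one
  have hηd : ∀ t, HasDerivAt η (deriv η t) t := fun t =>
    (hη.differentiable (by norm_num) t).hasDerivAt
  have hηc : Continuous (deriv η) := hη.continuous_deriv (by norm_num)
  set v : ℝ → ℝ := fun t => Real.sqrt (M.g (η t) (deriv η t) (deriv η t)) with hv
  have hgc := g_continuous M hη.continuous hηc hηc
  have hvc : Continuous v := hgc.sqrt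
  have hv0 : ∀ t, 0 ≤ v t := fun t => Real.sqrt_nonneg _
  have hg0 : ∀ t, 0 ≤ M.g (η t) (deriv η t) (deriv η t) := fun t => by
    obtain ⟨c, hc, hg⟩ := g_lower M
    exact le_trans (by positivity) (hg _ _)
  have hvs : ∀ t, M.g (η t) (deriv η t) (deriv η t) = v t ^ 2 := fun t =>
    (Real.sq_sqrt (hg0 t)).symm
  have key : ∀ e, 0 < e → D ^ 2 ≤ L * (L + e) := by
    intro e he
    have hLe : 0 < L + e := by linarith
    set s' : ℝ → ℝ := fun t => D * (v t + e) / (L + e) with hs'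
    set s : ℝ → ℝ := fun t => a + ∫ u in (0 : ℝ)..t, s' u with hs
    have hs'c : Continuous s' := by fun_prop
    have hs'0 : ∀ t, 0 < s' t := fun t => by have := hv0 t; positivity
    have hsd : ∀ t, HasDerivAt s (s' t) t := fun t =>
      (intervalIntegral.integral_hasDerivAt_right (hs'c.intervalIntegrable _ _)
        (hs'c.stronglyMeasurableAtFilter _ _) hs'c.continuousAt).const_add a
    have hs0 : s 0 = a := by simp [hs]
    have hs1 : s 1 = a + D := by
      have e1 : ∫ u in (0 : ℝ)..1, s' u = D := by
        have : s' = fun t => D / (L + e) * (v t + e) := by funext t; simp only [hs']; ring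
        rw [this, intervalIntegral.integral_const_mul,
          intervalIntegral.integral_add (hvc.intervalIntegrable _ _)
            (continuous_const.intervalIntegrable _ _)]
        have : ∫ t in (0 : ℝ)..1, v t = L := rfl
        rw [this]; simp; field_simp
      simp only [hs, e1]
    have := h.2.2 z hz.le η (deriv η) s s' 0 1 zero_le_one hηd hηc hsd hs'c hs'0
      (by rw [hs0, hs1]; linarith) (Or.inl (by rw [hs0, h0])) 0 ⟨le_rfl, zero_le_one⟩
    rw [hs0, hs1, h0, h1, hz, sub_self, sub_self, dot_zero_right, dot_zero_right] at this
    have i1 : ∫ t in (0 : ℝ)..1, M.g (η t) (deriv η t) (deriv η t) / s' t ≤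
        ∫ t in (0 : ℝ)..1, (L + e) / D * v t := by
      refine intervalIntegral.integral_mono_on zero_le_one
        ((hgc.div hs'c fun t => (hs'0 t).ne').intervalIntegrable _ _)
        ((hvc.const_mul _).intervalIntegrable _ _) fun t _ => ?_
      have := hv0 t
      rw [hvs, hs', div_le_iff₀ (hs'0 t)]
      have : (L + e) / D * v t * (D * (v t + e) / (L + e)) = v t * (v t + e) := by field_simp
      rw [this]; nlinarith
    rw [intervalIntegral.integral_const_mul] at i1
    have i2 : ∫ t in (0 : ℝ)..1, v t = L := rfl
    rw [i2] at i1
    have i3 : D ≤ (L + e) / D * L := by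
      refine le_trans ?_ i1
      refine le_trans ?_ this
      simp
    calc D ^ 2 = D * D := sq D
      _ ≤ D * ((L + e) / D * L) := by gcongr
      _ = L * (L + e) := by field_simp
  by_contra! hlt
  have hDL : 0 < D ^ 2 - L ^ 2 := by nlinarith
  have := key ((D ^ 2 - L ^ 2) / (2 * (L + 1))) (by positivity)
  have e : L * (L + (D ^ 2 - L ^ 2) / (2 * (L + 1))) = L ^ 2 + (D ^ 2 - L ^ 2) / 2 * (L / (L + 1)) := by
    field_simp
  have h2 : L / (L + 1) ≤ 1 := by rw [div_le_one (by linarith)]; linarith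
  nlinarith

theorem isGeodesic_orbit (M : TorusMetric) {z : Ph} (hz : ham M z = 1 / 2) :
    M.IsGeodesic (fun t => pos M t z) := by
  obtain ⟨τ, c, hτ, hc, hE⟩ := energy_lower M
  have h : EnergyBound M τ c := ⟨hτ, hc, hE⟩
  have hd : ∀ t, deriv (fun t => pos M t z) t = vel M (flow M t z).1 (flow M t z).2 := fun t =>
    (pos_deriv M (by linarith) t).deriv
  have hsp : ∀ t, M.g (pos M t z) (deriv (fun t => pos M t z) t) (deriv (fun t => pos M t z) t) = 1 :=
    fun t => by rw [hd, g_vel_flow, hz]; norm_num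
  refine ⟨pos_smooth M z, hsp, fun t => ⟨τ, hτ, fun s₁ s₂ h1 h12 h2 => ?_⟩⟩
  rw [length_eq_of_speed M hsp, Real.sqrt_one, mul_one]
  obtain ⟨D, rfl⟩ : ∃ D, s₂ = s₁ + D := ⟨s₂ - s₁, by ring⟩
  have hD : 0 ≤ D := by linarith
  rw [add_sub_cancel_left]
  apply le_antisymm
  · have := dist_orbit_le M (by linarith : ham M z ≤ 1) s₁ hD
    rw [hz] at this
    simpa using this
  · refine le_csInf ⟨_, fun t => pos M (s₁ + D * t) z, ?_, ?_, ?_, rfl⟩ ?_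
    · exact ((pos_smooth M z).of_le (by norm_num)).comp
        (contDiff_const.add (contDiff_const.mul contDiff_id))
    · simp
    · simp
    · rintro L ⟨η, hη, h0, h1', rfl⟩
      rcases hD.eq_or_lt with rfl | hD'
      · exact length_nonneg M η zero_le_one
      · exact speed_sq_le_of_length h hz hD' (by linarith) hη h0 h1'

theorem geodesic_isOrbit (M : TorusMetric) {c : ℝ → ℝ × ℝ} (hc : M.IsGeodesic c) :
    ∃ z, ham M z = 1 / 2 ∧ ∀ t, c t = pos M t z := by
  obtain ⟨hcs, hsp, hmin⟩ := hc
  obtain ⟨τ₀, e, hτ₀, he, hE⟩ := energy_lower M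
  obtain ⟨τ₁, hτ₁, hshort⟩ := exists_short_orbit M
  set τ := min τ₀ τ₁ with hτdef
  have h : EnergyBound M τ e := EnergyBound.mono ⟨hτ₀, he, hE⟩ (by positivity) (min_le_left _ _)
  have hτ := h.1
  obtain ⟨r₁, hr₁, hbvp⟩ := hshort τ hτ (min_le_right _ _) (1 / 2) (by norm_num)
  have hcd : ∀ t, HasDerivAt c (deriv c t) t := fun t =>
    (hcs.differentiable (by simp) t).hasDerivAt
  have hcc : Continuous (deriv c) := hcs.continuous_deriv (by simp)
  set Z : ℝ → Ph := fun t => (c t, mom M (c t) (deriv c t)) with hZ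
  have hham : ∀ t, ham M (Z t) = 1 / 2 := fun t => by rw [hZ, ham_mom, hsp]
  have hZd : ∀ t, HasDerivAt Z (cvf M (Z t)) t := by
    intro t₀
    obtain ⟨ε, hε, hm⟩ := hmin t₀
    obtain ⟨δ, hδ, hδc⟩ : ∃ δ > 0, ∀ t, |t - t₀| ≤ δ → ‖c t - c t₀‖ ≤ r₁ / 2 := by
      have := Metric.continuousAt_iff.mp (hcs.continuous.continuousAt (x := t₀)) (r₁ / 2) (by linarith)
      obtain ⟨δ, hδ, hh⟩ := this
      refine ⟨δ / 2, by linarith, fun t ht => ?_⟩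
      have := hh (show dist t t₀ < δ by rw [Real.dist_eq]; linarith)
      rw [dist_eq_norm] at this
      exact this.le
    set d := min ε δ with hd
    have hd0 : 0 < d := by positivity
    have hdε : d ≤ ε := min_le_left _ _
    have hdδ : d ≤ δ := min_le_right _ _
    have hclose : ‖c (t₀ - d) - c (t₀ + d)‖ ≤ r₁ := by
      have h1 := hδc (t₀ - d) (by rw [sub_sub_cancel_left, abs_neg, abs_of_pos hd0]; exact hdδ)
      have h2 := hδc (t₀ + d) (by rw [add_sub_cancel_left, abs_of_pos hd0]; exact hdδ)
      calc _ = ‖(c (t₀ - d) - c t₀) - (c (t₀ + d) - c t₀)‖ := by congr 1; abel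
        _ ≤ _ := norm_sub_le _ _
        _ ≤ r₁ := by linarith
    obtain ⟨p, hp, hpe⟩ := hbvp _ _ hclose
    set y : Ph := (c (t₀ - d), p) with hy
    have hlen : 2 * d ≤ τ * Real.sqrt (2 * ham M y) := by
      have h1 := hm (t₀ - d) (t₀ + d) (by linarith) (by linarith) (by linarith)
      rw [length_eq_of_speed M hsp, Real.sqrt_one, mul_one] at h1
      have h2 := dist_orbit_le M (by linarith : ham M y ≤ 1) 0 hτ.le
      rw [zero_add, pos_zero, hpe, h1] at h2
      linarith
    have hlen2 : 4 * d ^ 2 ≤ τ ^ 2 * (2 * ham M y) := by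
      have h0 : 0 ≤ 2 * ham M y := by linarith [ham_nonneg M y]
      have := pow_le_pow_left₀ (by positivity) hlen 2
      rw [mul_pow, mul_pow, Real.sq_sqrt h0] at this
      linarith
    set a := τ / (2 * d) with ha
    have ha0 : 0 < a := by positivity
    have hen : ∀ t ∈ Icc (t₀ - d) (t₀ + d),
        2 * ham M y * τ + e * ‖c t - pos M (a * (t - (t₀ - d))) y‖ ^ 2 ≤ 4 * d ^ 2 / τ := by
      intro t ht
      have hsb : a * (t₀ + d - (t₀ - d)) = τ := by rw [ha]; field_simp; ring
      have := h.2.2 y hp c (deriv c) (fun t => a * (t - (t₀ - d))) (fun _ => a) (t₀ - d) (t₀ + d)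
        (by linarith) hcd hcc
        (fun t => (((hasDerivAt_id t).sub_const _).const_mul a).congr_deriv (by simp))
        continuous_const (fun _ => ha0) (by simp only [sub_self, mul_zero, hsb]; linarith)
        (Or.inl (by simp [pos_zero, hy])) t ht
      simp only [hsb, hsp, sub_self, mul_zero, sub_zero, pos_zero, hpe] at this
      have e1 : c (t₀ - d) - y.1 = 0 := by simp [hy]
      rw [e1, dot_zero_right, dot_zero_right] at this
      simp only [intervalIntegral.integral_const, smul_eq_mul] at this
      have e2 : (t₀ + d - (t₀ - d)) * (1 / a) = 4 * d ^ 2 / τ := by rw [ha]; field_simp; ring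
      rw [e2] at this
      linarith
    have hup : 4 * d ^ 2 / τ ≤ 2 * ham M y * τ := by rw [div_le_iff₀ hτ]; linarith
    have hceq : ∀ t ∈ Icc (t₀ - d) (t₀ + d), c t = pos M (a * (t - (t₀ - d))) y := by
      intro t ht
      have := hen t ht
      have h0 : ‖c t - pos M (a * (t - (t₀ - d))) y‖ ^ 2 = 0 := by
        nlinarith [sq_nonneg ‖c t - pos M (a * (t - (t₀ - d))) y‖]
      exact sub_eq_zero.mp (norm_eq_zero.mp (pow_eq_zero_iff (two_ne_zero) |>.mp h0))
    have hya : ham M (scal a y) ≤ 1 := by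
      rw [ham_scal]
      have h1 := hen t₀ ⟨by linarith, by linarith⟩
      have h2 : 2 * ham M y * τ ≤ 4 * d ^ 2 / τ :=
        le_trans (le_add_of_nonneg_right (by positivity)) h1
      rw [le_div_iff₀ hτ] at h2
      have : a ^ 2 * ham M y = τ ^ 2 * ham M y / (4 * d ^ 2) := by rw [ha]; field_simp; ring
      rw [this, div_le_one (by positivity)]
      nlinarith [ham_nonneg M y, sq_nonneg d]
    set w := scal a y with hw
    have hcw : ∀ t ∈ Icc (t₀ - d) (t₀ + d), c t = pos M (t - (t₀ - d)) w := fun t ht => by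
      rw [hceq t ht, hw, pos_scal M (by linarith) hya]
    have hcd' : ∀ t ∈ Ioo (t₀ - d) (t₀ + d), Z t = flow M (t - (t₀ - d)) w := by
      intro t ht
      have h1 : HasDerivAt (fun t => pos M (t - (t₀ - d)) w)
          (vel M (flow M (t - (t₀ - d)) w).1 (flow M (t - (t₀ - d)) w).2) t :=
        (pos_deriv M hya (t - (t₀ - d))).comp_sub_const t (t₀ - d)
      have h2 : c =ᶠ[𝓝 t] fun t => pos M (t - (t₀ - d)) w := by
        filter_upwards [Icc_mem_nhds ht.1 ht.2] with u hu using hcw u hu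
      have h3 := (hcd t).unique (h1.congr_of_eventuallyEq h2)
      have h4 := hcw t ⟨ht.1.le, ht.2.le⟩
      rw [hZ]
      refine Prod.ext h4 ?_
      simp only
      rw [h3, h4, pos, mom_vel]
    have ht₀ : t₀ ∈ Ioo (t₀ - d) (t₀ + d) := ⟨by linarith, by linarith⟩
    rw [hcd' t₀ ht₀]
    refine HasDerivAt.congr_of_eventuallyEq
      ((flow_deriv' M w (t₀ - (t₀ - d))).comp_sub_const t₀ (t₀ - d)) ?_
    filter_upwards [Ioo_mem_nhds ht₀.1 ht₀.2] with u hu using hcd' u hu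
  refine ⟨Z 0, hham 0, fun t => ?_⟩
  rw [pos, ← flow_unique M hZd rfl t]

/-! ### A bounded complete orbit -/

theorem exists_bounded_orbit (M : TorusMetric) {c : ℝ → ℝ × ℝ} (hc : M.IsGeodesic c)
    (hb : Bornology.IsBounded (c '' Set.Ici 0)) :
    ∃ ζ, ham M ζ = 1 / 2 ∧ ∃ R : ℝ, ∀ s, ‖pos M s ζ‖ ≤ R := by
  obtain ⟨z, hz, hcz⟩ := geodesic_isOrbit M hc
  obtain ⟨R, hR⟩ := hb.exists_norm_le
  have hR' : ∀ t, 0 ≤ t → ‖pos M t z‖ ≤ R := fun t ht => by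
    rw [← hcz]; exact hR _ ⟨t, ht, rfl⟩
  obtain ⟨k, hk, hkl⟩ := ham_lower M
  have hmem : ∀ n : ℕ, flow M n z ∈ Metric.closedBall (0 : Ph) (max R (1 / k + 1)) := by
    intro n
    rw [mem_closedBall_zero_iff, Prod.norm_def]
    refine max_le_max (hR' n (Nat.cast_nonneg n)) ?_
    have h1 := hkl (flow M n z).1 (flow M n z).2
    rw [Prod.mk.eta, ham_flow, hz] at h1
    by_contra! hn
    have h3 : 0 < 1 / k := by positivity
    have h4 : k * (1 / k) = 1 := by field_simp
    have : 1 / k + 1 ≤ ‖(flow M n z).2‖ ^ 2 := by nlinarith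
    nlinarith
  obtain ⟨ζ, -, φ, hφ, hlim⟩ := (isCompact_closedBall (0 : Ph) _).tendsto_subseq hmem
  refine ⟨ζ, ?_, R, fun s => ?_⟩
  · have h1 := ((ham_smooth M).continuous.tendsto ζ).comp hlim
    refine tendsto_nhds_unique h1 (tendsto_const_nhds.congr fun n => ?_)
    simp [ham_flow, hz]
  · have h1 : Tendsto (fun n => pos M s (flow M (φ n) z)) atTop (𝓝 (pos M s ζ)) :=
      (((pos_continuous M).comp (Continuous.prodMk_right s)).tendsto ζ).comp hlim
    refine le_of_tendsto h1.norm ?_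
    have h2 : Tendsto (fun n => (φ n : ℝ)) atTop atTop :=
      tendsto_natCast_atTop_atTop.comp hφ.tendsto_atTop
    filter_upwards [h2.eventually_ge_atTop (-s)] with n hn
    rw [pos, ← flow_add]
    exact hR' _ (by linarith)

/-! ### Velocity estimates -/

theorem vel_flow_eq (M : TorusMetric) {z : Ph} (hz : ham M z ≤ 1) (t : ℝ) :
    vel M (flow M t z).1 (flow M t z).2 = (cvf M (flow M t z)).1 := by
  rw [cvf_eq_vf M (by rwa [ham_flow])]; rfl

theorem vel_flow_lip (M : TorusMetric) {z : Ph} (hz : ham M z ≤ 1) (t : ℝ) :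
    ‖vel M (flow M t z).1 (flow M t z).2 - vel M z.1 z.2‖ ≤ flowK M ^ 2 * |t| := by
  have h0 := vel_flow_eq M hz 0
  rw [flow_zero] at h0
  rw [h0, vel_flow_eq M hz, ← Prod.fst_sub]
  refine (norm_fst_le _).trans ?_
  have h1 := (cvf_lip M).dist_le_mul (flow M t z) z
  rw [dist_eq_norm, dist_eq_norm] at h1
  have h2 := flow_time_lip M t 0 z
  rw [flow_zero, sub_zero] at h2
  calc _ ≤ _ := h1
    _ ≤ flowK M * (flowK M * |t|) := by gcongr
    _ = _ := by ring

theorem vel_lower (M : TorusMetric) : ∃ β, 0 < β ∧ ∀ z, ham M z = 1 / 2 → β ≤ ‖vel M z.1 z.2‖ := by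
  obtain ⟨G, hG, hmom⟩ := mom_bound M
  obtain ⟨H, hH, hham⟩ := ham_upper M
  refine ⟨min 1 (1 / (2 * H * G ^ 2)), by positivity, fun z hz => ?_⟩
  by_contra! hlt
  have h1 := hham z.1 z.2
  rw [Prod.mk.eta, hz] at h1
  have h2 := hmom z.1 (vel M z.1 z.2)
  rw [mom_vel] at h2
  set v := ‖vel M z.1 z.2‖ with hv
  have hv0 : 0 ≤ v := norm_nonneg _
  have h3 : v < 1 := hlt.trans_le (min_le_left _ _)
  have h4 : v < 1 / (2 * H * G ^ 2) := hlt.trans_le (min_le_right _ _)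
  have h5 : v ^ 2 ≤ v := by nlinarith
  have h6 : ‖z.2‖ ^ 2 ≤ G ^ 2 * v ^ 2 := by
    rw [← mul_pow]; exact pow_le_pow_left₀ (norm_nonneg _) h2 2
  have : H * ‖z.2‖ ^ 2 < 1 / 2 := by
    calc H * ‖z.2‖ ^ 2 ≤ H * (G ^ 2 * v) := by gcongr; exact h6.trans (by gcongr)
      _ < H * (G ^ 2 * (1 / (2 * H * G ^ 2))) := by gcongr
      _ = 1 / 2 := by field_simp
  linarith

theorem exists_speed_bound (M : TorusMetric) {v : ℝ} (hv : 0 < v) :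
    ∃ r, 0 < r ∧ ∀ z, ham M z ≤ r → ‖vel M z.1 z.2‖ ≤ v := by
  obtain ⟨c, hc, h⟩ := g_lower M
  refine ⟨c * v ^ 2 / 2, by positivity, fun z hz => ?_⟩
  have h1 := h z.1 (vel M z.1 z.2)
  rw [g_vel] at h1
  have : ‖vel M z.1 z.2‖ ^ 2 ≤ v ^ 2 := le_of_mul_le_mul_left (by linarith) hc
  exact (abs_le_of_sq_le_sq' this hv.le).2

theorem pos_lip (M : TorusMetric) {v : ℝ} {z : Ph} (hz : ham M z ≤ 1)
    (hv : ∀ t, ‖vel M (flow M t z).1 (flow M t z).2‖ ≤ v) (s t : ℝ) :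
    ‖pos M s z - pos M t z‖ ≤ v * |s - t| := by
  have := (convex_univ).norm_image_sub_le_of_norm_hasDerivWithin_le
    (f := fun t => pos M t z) (C := v)
    (fun s _ => (pos_deriv M hz s).hasDerivWithinAt) (fun s _ => hv s)
    (mem_univ t) (mem_univ s)
  simpa using this

/-! ### Complex coordinates -/

/-- The identification of the plane with the complex numbers. -/
def toC : ℝ × ℝ →L[ℝ] ℂ := (Complex.equivRealProdCLM.symm : ℝ × ℝ →L[ℝ] ℂ)

theorem toC_re (v : ℝ × ℝ) : (toC v).re = v.1 := by simp [toC]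
theorem toC_im (v : ℝ × ℝ) : (toC v).im = v.2 := by simp [toC]

theorem toC_inj {v w : ℝ × ℝ} (h : toC v = toC w) : v = w := by
  refine Prod.ext ?_ ?_
  · rw [← toC_re, ← toC_re, h]
  · rw [← toC_im, ← toC_im, h]

theorem le_norm_toC (v : ℝ × ℝ) : ‖v‖ ≤ ‖toC v‖ := by
  rw [Prod.norm_def]
  refine max_le ?_ ?_
  · rw [← toC_re]; exact Complex.abs_re_le_norm _
  · rw [← toC_im]; exact Complex.abs_im_le_norm _

theorem norm_toC_le (v : ℝ × ℝ) : ‖toC v‖ ≤ 2 * ‖v‖ := by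
  refine (Complex.norm_le_abs_re_add_abs_im _).trans ?_
  rw [toC_re, toC_im, two_mul]
  exact add_le_add (norm_fst_le v) (norm_snd_le v)

/-- A curve through the origin with horizontal tangent is locally a graph. -/
theorem exists_graph {w w' : ℝ → ℂ} {a C : ℝ} (ha : 0 < a) (hC : 0 ≤ C) (hCa : C * a ≤ 1 / 2)
    (h0 : w 0 = 0) (hw : ∀ t, HasDerivAt w (w' t) t) (hw' : ∀ t, ‖w' t - 1‖ ≤ C * |t|) :
    ∃ h : ℝ → ℝ, ContinuousOn h (Icc (-(a / 2)) (a / 2)) ∧ h 0 = 0 ∧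
      ∀ ξ ∈ Icc (-(a / 2)) (a / 2), |h ξ| ≤ 4 * C * ξ ^ 2 ∧
        ∃ t, |t| ≤ a ∧ w t = ξ + h ξ * Complex.I := by
  have hd : ∀ t, HasDerivAt (fun t : ℝ => w t - t) (w' t - 1) t := fun t =>
    (hw t).sub (HasDerivAt.ofReal_comp (hasDerivAt_id t))
  have hlip : ∀ s ∈ Icc (-a) a, ∀ t ∈ Icc (-a) a,
      ‖(w s - s) - (w t - t)‖ ≤ 1 / 2 * |s - t| := by
    intro s hs t ht
    refine (convex_Icc (-a) a).norm_image_sub_le_of_norm_hasDerivWithin_le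
      (f := fun t : ℝ => w t - t) (C := 1 / 2)
      (fun u _ => (hd u).hasDerivWithinAt) (fun u hu => ?_) ht hs
    refine (hw' u).trans (le_trans ?_ hCa)
    gcongr
    exact abs_le.mpr hu
  have hquad : ∀ t ∈ Icc (-a) a, ‖w t - t‖ ≤ C * |t| ^ 2 := by
    intro t ht
    have := (convex_Icc (-|t|) |t|).norm_image_sub_le_of_norm_hasDerivWithin_le
      (f := fun t : ℝ => w t - t) (C := C * |t|) (x := 0) (y := t)
      (fun u _ => (hd u).hasDerivWithinAt) (fun u hu => (hw' u).trans
        (mul_le_mul_of_nonneg_left (abs_le.mpr hu) hC)) ⟨by simp, by simp⟩ ⟨neg_abs_le t, le_abs_self t⟩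
    simpa [h0, mul_assoc, sq] using this
  have hre : ∀ s ∈ Icc (-a) a, ∀ t ∈ Icc (-a) a, |s - t| ≤ 2 * |(w s).re - (w t).re| := by
    intro s hs t ht
    have h1 := (Complex.abs_re_le_norm _).trans (hlip s hs t ht)
    simp only [Complex.sub_re, Complex.ofReal_re] at h1
    have h2 : s - t = ((w s).re - (w t).re) - ((w s).re - s - ((w t).re - t)) := by ring
    have h3 : |s - t| ≤ |(w s).re - (w t).re| + |(w s).re - s - ((w t).re - t)| := by
      conv_lhs => rw [h2]
      exact abs_sub _ _
    linarith
  have him : ∀ s ∈ Icc (-a) a, ∀ t ∈ Icc (-a) a,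
      |(w s).im - (w t).im| ≤ |(w s).re - (w t).re| := by
    intro s hs t ht
    have h1 := (Complex.abs_im_le_norm _).trans (hlip s hs t ht)
    simp only [Complex.sub_im, Complex.ofReal_im, sub_zero] at h1
    linarith [hre s hs t ht]
  have hz0 : (0 : ℝ) ∈ Icc (-a) a := ⟨by linarith, by linarith⟩
  have hex : ∀ ξ ∈ Icc (-(a / 2)) (a / 2), ∃ t ∈ Icc (-a) a, (w t).re = ξ := by
    intro ξ hξ
    have hcont : ContinuousOn (fun t => (w t).re) (Icc (-a) a) := fun t _ =>
      (Complex.continuous_re.continuousAt.comp (hw t).continuousAt).continuousWithinAt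
    have hb : ∀ t ∈ Icc (-a) a, |(w t).re - t| ≤ 1 / 2 * |t| := fun t ht => by
      have := (Complex.abs_re_le_norm _).trans (hlip t ht 0 hz0)
      simpa [h0] using this
    have h1 := abs_le.mp (hb a ⟨by linarith, le_rfl⟩)
    have h2 := abs_le.mp (hb (-a) ⟨le_rfl, by linarith⟩)
    rw [abs_neg, abs_of_pos ha] at h2
    rw [abs_of_pos ha] at h1
    exact intermediate_value_Icc (by linarith) hcont ⟨by linarith [hξ.1], by linarith [hξ.2]⟩
  choose! T hT hTe using hex
  have h0m : (0 : ℝ) ∈ Icc (-(a / 2)) (a / 2) := ⟨by linarith, by linarith⟩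
  have hT0 : T 0 = 0 := by
    have := hre _ (hT 0 h0m) 0 hz0
    rw [hTe 0 h0m, h0] at this
    simpa using this
  refine ⟨fun ξ => (w (T ξ)).im, ?_, by simp [hT0, h0], fun ξ hξ => ⟨?_, T ξ, abs_le.mpr (hT ξ hξ), ?_⟩⟩
  · have : LipschitzOnWith 1 (fun ξ => (w (T ξ)).im) (Icc (-(a / 2)) (a / 2)) := by
      refine LipschitzOnWith.of_dist_le_mul fun x hx y hy => ?_
      have := him _ (hT x hx) _ (hT y hy)
      rw [hTe x hx, hTe y hy] at this
      simpa [Real.dist_eq] using this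
    exact this.continuousOn
  · have h1 := (Complex.abs_im_le_norm _).trans (hquad _ (hT ξ hξ))
    have h2 := hre _ (hT ξ hξ) 0 hz0
    rw [hTe ξ hξ, h0] at h2
    simp only [Complex.sub_im, Complex.ofReal_im, sub_zero, Complex.zero_re] at h1 h2
    calc _ ≤ _ := h1
      _ ≤ C * (2 * |ξ|) ^ 2 := by gcongr
      _ = 4 * C * ξ ^ 2 := by rw [mul_pow, sq_abs]; ring
  · apply Complex.ext <;> simp [hTe ξ hξ]

/-- The complex coordinate at the base point of `ζ` adapted to the orbit of `ζ`. -/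
def cco (M : TorusMetric) (ζ : Ph) (x : ℝ × ℝ) : ℂ := toC (x - ζ.1) / toC (vel M ζ.1 ζ.2)

theorem exists_side (M : TorusMetric) {τ : ℝ} (hτ : 0 < τ) : ∃ ρ C, 0 < ρ ∧ 0 ≤ C ∧
    ∀ ζ, ham M ζ = 1 / 2 → ∃ h : ℝ → ℝ, ContinuousOn h (Icc (-ρ) ρ) ∧ h 0 = 0 ∧
      ∀ ξ ∈ Icc (-ρ) ρ, |h ξ| ≤ C * ξ ^ 2 ∧
        ∃ s, |s| ≤ τ / 2 ∧ cco M ζ (pos M s ζ) = ξ + h ξ * Complex.I := by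
  obtain ⟨β, hβ, hvel⟩ := vel_lower M
  set C := 2 * (flowK M : ℝ) ^ 2 / β + 1 with hC
  have hC0 : 0 < C := by positivity
  set a := min (τ / 2) (1 / (2 * C)) with ha
  have ha0 : 0 < a := by positivity
  refine ⟨a / 2, 4 * C, by positivity, by positivity, fun ζ hζ => ?_⟩
  have hb := (hvel ζ hζ).trans (le_norm_toC _)
  have hne : toC (vel M ζ.1 ζ.2) ≠ 0 := by
    rw [← norm_pos_iff]; linarith
  obtain ⟨h, h1, h2, h3⟩ := exists_graph (w := fun s => cco M ζ (pos M s ζ))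
    (w' := fun s => toC (vel M (flow M s ζ).1 (flow M s ζ).2) / toC (vel M ζ.1 ζ.2))
    (a := a) (C := C) ha0 hC0.le
    (by
      have : a ≤ 1 / (2 * C) := min_le_right _ _
      calc C * a ≤ C * (1 / (2 * C)) := by gcongr
        _ = 1 / 2 := by field_simp)
    (by simp [cco, pos_zero])
    (fun t => (toC.hasFDerivAt.comp_hasDerivAt t
      ((pos_deriv M (by linarith : ham M ζ ≤ 1) t).sub_const ζ.1)).div_const _)
    (fun t => by
      rw [div_sub_one hne, ← map_sub, norm_div, div_le_iff₀ (by linarith)]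
      refine (norm_toC_le _).trans ?_
      have := vel_flow_lip M (by linarith : ham M ζ ≤ 1) t
      calc _ ≤ 2 * (flowK M ^ 2 * |t|) := by gcongr
        _ = (2 * (flowK M : ℝ) ^ 2 / β) * |t| * β := by field_simp
        _ ≤ C * |t| * ‖toC (vel M ζ.1 ζ.2)‖ := by
          gcongr
          rw [hC]; linarith)
  refine ⟨h, h1, h2, fun ξ hξ => ⟨(h3 ξ hξ).1, ?_⟩⟩
  obtain ⟨s, hs, hse⟩ := (h3 ξ hξ).2
  exact ⟨s, hs.trans (min_le_left _ _), hse⟩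

/-! ### Short triangles and obstacles -/

theorem cco_inj (M : TorusMetric) {ζ : Ph} (hne : toC (vel M ζ.1 ζ.2) ≠ 0) {x y : ℝ × ℝ}
    (h : cco M ζ x = cco M ζ y) : x = y := by
  have := toC_inj ((div_left_inj' hne).mp h)
  simpa using this

theorem cco_continuous (M : TorusMetric) (ζ : Ph) : Continuous (cco M ζ) := by
  unfold cco; fun_prop

/-- An orbit tangent to a multiple of a state of `ζ` stays on the orbit of `ζ`. -/
theorem mem_orbit_of_tangent (M : TorusMetric) {z ζ : Ph} (hz : ham M z ≤ 1) (hζ : ham M ζ ≤ 1)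
    {t s μ : ℝ} (h : flow M t z = scal μ (flow M s ζ)) : ∃ u, z.1 = pos M u ζ := by
  refine ⟨-(μ * t) + s, ?_⟩
  have h1 : z.1 = pos M (-t) (flow M t z) := by
    rw [pos, ← flow_add, neg_add_cancel, flow_zero]
  rw [h1, h, pos_scal M (by rwa [ham_flow]) (by rw [← h]; rwa [ham_flow]), pos, ← flow_add, pos]
  congr 2; ring_nf

theorem mem_orbit_of_two_intersections {M : TorusMetric} {τ c : ℝ} (hE : EnergyBound M τ c)
    {z ζ : Ph} (hz : ham M z ≤ 1 / 2) (hζ : ham M ζ = 1 / 2) {t₁ t₂ s₁ s₂ : ℝ} (ht : t₁ < t₂)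
    (htτ : t₂ - t₁ ≤ τ) (hs : |s₂ - s₁| ≤ τ) (h1 : pos M t₁ z = pos M s₁ ζ)
    (h2 : pos M t₂ z = pos M s₂ ζ) : ∃ u, z.1 = pos M u ζ := by
  have hτ := hE.1
  set α := (t₂ - t₁) / τ with hα
  set κ := (s₂ - s₁) / τ with hκ
  have hα0 : 0 < α := div_pos (by linarith) hτ
  have hα1 : α ≤ 1 := (div_le_one hτ).mpr htτ
  have hκ1 : |κ| ≤ 1 := by rw [hκ, abs_div, abs_of_pos hτ]; exact (div_le_one hτ).mpr hs
  have hy1 : ham M (scal α (flow M t₁ z)) ≤ 1 / 2 := by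
    rw [ham_scal, ham_flow]
    have := ham_nonneg M z
    nlinarith
  have hy2 : ham M (scal κ (flow M s₁ ζ)) ≤ 1 / 2 := by
    rw [ham_scal, ham_flow, hζ]
    have := (sq_le_one_iff_abs_le_one κ).mpr hκ1
    linarith
  have e : scal α (flow M t₁ z) = scal κ (flow M s₁ ζ) := by
    refine orbit_unique hE hy2 hy1 h1 ?_
    rw [pos_scal M (by rw [ham_flow]; linarith) (by linarith),
      pos_scal M (by rw [ham_flow]; linarith) (by linarith)]
    rw [pos, pos, ← flow_add, ← flow_add]
    have e1 : α * τ + t₁ = t₂ := by rw [hα]; field_simp; ring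
    have e2 : κ * τ + s₁ = s₂ := by rw [hκ]; field_simp; ring
    rw [e1, e2]; exact h2
  refine mem_orbit_of_tangent M (t := t₁) (s := s₁) (μ := α⁻¹ * κ) (by linarith) (by linarith) ?_
  rw [← scal_scal, ← e, scal_scal, inv_mul_cancel₀ hα0.ne', scal_one]

/-- The signed height above the graph of `h`. -/
def sideFn (M : TorusMetric) (ζ : Ph) (h : ℝ → ℝ) (x : ℝ × ℝ) : ℝ :=
  (cco M ζ x).im - h (cco M ζ x).re

theorem mem_orbit_of_hit {M : TorusMetric} {τ c : ℝ} (hE : EnergyBound M τ c)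
    {z ζ : Ph} (hz : ham M z ≤ 1 / 2) (hζ : ham M ζ = 1 / 2) {ρ C : ℝ} {h : ℝ → ℝ}
    (hne : toC (vel M ζ.1 ζ.2) ≠ 0)
    (hc : ContinuousOn h (Icc (-ρ) ρ)) (hh0 : h 0 = 0)
    (hh : ∀ ξ ∈ Icc (-ρ) ρ, |h ξ| ≤ C * ξ ^ 2 ∧
        ∃ s, |s| ≤ τ / 2 ∧ cco M ζ (pos M s ζ) = ξ + h ξ * Complex.I)
    (hbox : ∀ t ∈ Icc 0 τ, (cco M ζ (pos M t z)).re ∈ Icc (-ρ) ρ)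
    (hsame : 0 < sideFn M ζ h (pos M 0 z) * sideFn M ζ h (pos M τ z))
    {t₀ : ℝ} (ht₀ : t₀ ∈ Icc 0 τ) (hhit : pos M t₀ z = ζ.1) : ∃ u, z.1 = pos M u ζ := by
  have hτ := hE.1
  have hpc : Continuous fun t => cco M ζ (pos M t z) :=
    (cco_continuous M ζ).comp (pos_smooth M z).continuous
  have hfc : ContinuousOn (fun t => sideFn M ζ h (pos M t z)) (Icc 0 τ) := by
    unfold sideFn
    exact (Complex.continuous_im.comp hpc).continuousOn.sub
      (hc.comp (Complex.continuous_re.comp hpc).continuousOn hbox)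
  obtain ⟨e, he, he0, heτ⟩ : ∃ e : ℝ, (e = 1 ∨ e = -1) ∧ 0 < e * sideFn M ζ h (pos M 0 z) ∧
      0 < e * sideFn M ζ h (pos M τ z) := by
    rcases pos_and_pos_or_neg_and_neg_of_mul_pos hsame with ⟨h1, h2⟩ | ⟨h1, h2⟩
    · exact ⟨1, Or.inl rfl, by linarith, by linarith⟩
    · exact ⟨-1, Or.inr rfl, by linarith, by linarith⟩
  have hee : e ≠ 0 := by rcases he with rfl | rfl <;> norm_num
  set f : ℝ → ℝ := fun t => e * sideFn M ζ h (pos M t z) with hf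
  have hfc' : ContinuousOn f (Icc 0 τ) := continuousOn_const.mul hfc
  have hft₀ : f t₀ = 0 := by simp [hf, sideFn, hhit, cco, hh0]
  have hzero : ∀ t ∈ Icc 0 τ, f t = 0 → ∃ s, |s| ≤ τ / 2 ∧ pos M t z = pos M s ζ := by
    intro t ht h0
    have h1 : sideFn M ζ h (pos M t z) = 0 := by simpa [hf, hee] using h0
    obtain ⟨s, hs, hse⟩ := (hh _ (hbox t ht)).2
    refine ⟨s, hs, cco_inj M hne ?_⟩
    rw [hse]
    unfold sideFn at h1
    apply Complex.ext
    · simp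
    · simp; linarith
  have htwo : ∀ t₁ ∈ Icc 0 τ, ∀ t₂ ∈ Icc 0 τ, t₁ < t₂ → f t₁ = 0 → f t₂ = 0 →
      ∃ u, z.1 = pos M u ζ := by
    intro t₁ h1 t₂ h2 h12 f1 f2
    obtain ⟨s₁, hs1, e1⟩ := hzero t₁ h1 f1
    obtain ⟨s₂, hs2, e2⟩ := hzero t₂ h2 f2
    refine mem_orbit_of_two_intersections hE hz hζ h12 (by linarith [h1.1, h2.2]) ?_ e1 e2
    exact (abs_sub _ _).trans (by linarith)
  have ht0ne : t₀ ≠ 0 := by rintro rfl; exact he0.ne' hft₀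
  have htτne : t₀ ≠ τ := by rintro rfl; exact heτ.ne' hft₀
  have ht0 : 0 < t₀ := lt_of_le_of_ne ht₀.1 ht0ne.symm
  have htτ : t₀ < τ := lt_of_le_of_ne ht₀.2 htτne
  by_cases hneg : ∃ t₁ ∈ Icc 0 τ, f t₁ < 0
  · obtain ⟨t₁, h1, hn⟩ := hneg
    rcases lt_trichotomy t₁ t₀ with hlt | rfl | hgt
    · have := intermediate_value_Icc' h1.1 (hfc'.mono (Icc_subset_Icc_right h1.2))
      obtain ⟨t₂, h2, f2⟩ := this ⟨hn.le, he0.le⟩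
      exact htwo t₂ ⟨h2.1, h2.2.trans h1.2⟩ t₀ ht₀ (h2.2.trans_lt hlt) f2 hft₀
    · exact absurd hft₀ hn.ne
    · have := intermediate_value_Icc h1.2 (hfc'.mono (Icc_subset_Icc_left h1.1))
      obtain ⟨t₂, h2, f2⟩ := this ⟨hn.le, heτ.le⟩
      exact htwo t₀ ht₀ t₂ ⟨h1.1.trans h2.1, h2.2⟩ (hgt.trans_le h2.1) hft₀ f2
  · push Not at hneg
    set W' := toC (vel M (flow M t₀ z).1 (flow M t₀ z).2) / toC (vel M ζ.1 ζ.2) with hW'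
    have hWd : HasDerivAt (fun t => cco M ζ (pos M t z)) W' t₀ :=
      (toC.hasFDerivAt.comp_hasDerivAt t₀
        ((pos_deriv M (by linarith : ham M z ≤ 1) t₀).sub_const ζ.1)).div_const _
    have hre : HasDerivAt (fun t => (cco M ζ (pos M t z)).re) W'.re t₀ :=
      Complex.reCLM.hasFDerivAt.comp_hasDerivAt t₀ hWd
    have him : HasDerivAt (fun t => (cco M ζ (pos M t z)).im) W'.im t₀ :=
      Complex.imCLM.hasFDerivAt.comp_hasDerivAt t₀ hWd
    have hW0 : cco M ζ (pos M t₀ z) = 0 := by simp [cco, hhit]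
    set G : ℝ → ℝ := fun t => e * (cco M ζ (pos M t z)).im + C * (cco M ζ (pos M t z)).re ^ 2
      with hG
    have hGd := (him.const_mul e).add ((hre.pow 2).const_mul C)
    have hmin : IsLocalMin G t₀ := by
      filter_upwards [Icc_mem_nhds ht0 htτ] with t ht
      have h0 : G t₀ = 0 := by simp [hG, hW0]
      rw [h0]
      have h1 := hneg t ht
      have h2 := abs_le.mp (hh _ (hbox t ht)).1
      simp only [hf, sideFn] at h1
      simp only [hG]
      rcases he with rfl | rfl <;> linarith [h2.1, h2.2]
    have hz0 := hmin.hasDerivAt_eq_zero hGd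
    simp only [hW0, Complex.zero_re] at hz0
    have him0 : W'.im = 0 := by simpa [hee] using hz0
    have hvv : vel M (flow M t₀ z).1 (flow M t₀ z).2 = W'.re • vel M ζ.1 ζ.2 := by
      apply toC_inj
      have : W' = (W'.re : ℂ) := by apply Complex.ext <;> simp [him0]
      rw [map_smul]
      rw [hW', div_eq_iff hne, ← hW'] at this
      rw [this, Complex.real_smul]
    refine mem_orbit_of_tangent M (t := t₀) (s := 0) (μ := W'.re) (by linarith) (by linarith) ?_
    rw [flow_zero]
    refine Prod.ext hhit ?_
    have h5 : (flow M t₀ z).1 = ζ.1 := hhit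
    rw [← mom_vel M (flow M t₀ z).1 (flow M t₀ z).2, hvv, mom_smul, h5, mom_vel]
    rfl

/-- The orbit segment of `z` over `[0,τ]` avoids the complete orbit of `ζ`. -/
def Avoids (M : TorusMetric) (τ : ℝ) (z ζ : Ph) : Prop :=
  ∀ t ∈ Icc 0 τ, ∀ s, pos M t z ≠ pos M s ζ

/-- The orbit segment of `z` is contained in a slit plane with respect to `p`. -/
def InSlit (M : TorusMetric) (τ : ℝ) (p : ℝ × ℝ) (u : ℂ) (z : Ph) : Prop :=
  ∀ t ∈ Icc 0 τ, toC (pos M t z - p) * u ∈ Complex.slitPlane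

/-- The three orbit segments form a triangle. -/
structure IsTriangle (M : TorusMetric) (τ : ℝ) (z z' z'' : Ph) : Prop where
  h1 : pos M τ z = z'.1
  h2 : z''.1 = z.1
  h3 : pos M τ z'' = pos M τ z'

theorem sign_const {f : ℝ → ℝ} {τ : ℝ} (hf : ContinuousOn f (Icc 0 τ)) (h : ∀ t ∈ Icc 0 τ, f t ≠ 0)
    {s t : ℝ} (hs : s ∈ Icc 0 τ) (ht : t ∈ Icc 0 τ) : 0 < f s * f t := by
  by_contra! hle
  have hle' : f s * f t < 0 := lt_of_le_of_ne hle (mul_ne_zero (h s hs) (h t ht))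
  have hmem : (0 : ℝ) ∈ f '' Icc 0 τ := by
    have hconn := (isPreconnected_Icc (a := (0 : ℝ)) (b := τ)).image f hf
    rcases mul_neg_iff.mp hle' with ⟨h1, h2⟩ | ⟨h1, h2⟩
    · exact hconn.Icc_subset ⟨t, ht, rfl⟩ ⟨s, hs, rfl⟩ ⟨h2.le, h1.le⟩
    · exact hconn.Icc_subset ⟨s, hs, rfl⟩ ⟨t, ht, rfl⟩ ⟨h1.le, h2.le⟩
  obtain ⟨u, hu, hu0⟩ := hmem
  exact h u hu hu0

theorem avoids_flow {M : TorusMetric} {τ : ℝ} {z ζ : Ph} (h : Avoids M τ z ζ) (s : ℝ) :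
    Avoids M τ z (flow M s ζ) := fun t ht u => by
  rw [pos, pos, ← flow_add]; exact h t ht _

theorem triangle_obstacle {M : TorusMetric} {τ c : ℝ} (hE : EnergyBound M τ c) : ∃ r, 0 < r ∧
    ∀ ζ z z' z'', ham M ζ = 1 / 2 → ham M z ≤ r → ham M z' ≤ r → ham M z'' ≤ r →
      IsTriangle M τ z z' z'' → Avoids M τ z ζ → Avoids M τ z' ζ →
      Avoids M τ z'' ζ ∧ ∃ u : ℂ, u ≠ 0 ∧ InSlit M τ ζ.1 u z ∧ InSlit M τ ζ.1 u z' ∧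
        InSlit M τ ζ.1 u z'' := by
  have hτ := hE.1
  obtain ⟨ρ, C, hρ, hC, hside⟩ := exists_side M hτ
  obtain ⟨β, hβ, hvel⟩ := vel_lower M
  set v := ρ * β / (12 * τ) with hv
  have hv0 : 0 < v := by positivity
  obtain ⟨r₀, hr₀, hspeed⟩ := exists_speed_bound M hv0
  refine ⟨min r₀ (1 / 2), by positivity, ?_⟩
  intro ζ z z' z'' hζ hz hz' hz'' htri hav hav'
  have hzh := hz.trans (min_le_right _ _)
  have hzh' := hz'.trans (min_le_right _ _)
  have hzh'' := hz''.trans (min_le_right _ _)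
  set d := v * τ with hd
  have hd0 : 0 < d := by positivity
  have hlip : ∀ y, ham M y ≤ min r₀ (1 / 2) → ∀ s ∈ Icc 0 τ, ∀ t ∈ Icc 0 τ,
      ‖pos M s y - pos M t y‖ ≤ d := by
    intro y hy s hs t ht
    refine (pos_lip M ((hy.trans (min_le_right _ _)).trans (by norm_num))
      (fun t => hspeed _ (by rw [ham_flow]; exact hy.trans (min_le_left _ _))) s t).trans ?_
    rw [hd]
    gcongr
    rw [abs_le]; constructor <;> linarith [hs.1, hs.2, ht.1, ht.2]
  have m0 : (0 : ℝ) ∈ Icc 0 τ := ⟨le_rfl, hτ.le⟩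
  have mτ : τ ∈ Icc 0 τ := ⟨hτ.le, le_rfl⟩
  have dz : ∀ t ∈ Icc 0 τ, ‖pos M t z - z.1‖ ≤ d := fun t ht => by
    have := hlip z hz t ht 0 m0
    rwa [pos_zero] at this
  have dz'' : ∀ t ∈ Icc 0 τ, ‖pos M t z'' - z.1‖ ≤ d := fun t ht => by
    have := hlip z'' hz'' t ht 0 m0
    rwa [pos_zero, htri.h2] at this
  have dz' : ∀ t ∈ Icc 0 τ, ‖pos M t z' - z.1‖ ≤ 2 * d := fun t ht => by
    have h1 := hlip z' hz' t ht 0 m0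
    have h2 := dz τ mτ
    rw [pos_zero, ← htri.h1] at h1
    calc _ = ‖(pos M t z' - pos M τ z) + (pos M τ z - z.1)‖ := by congr 1; abel
      _ ≤ _ := norm_add_le _ _
      _ ≤ _ := by linarith
  have hne : ∀ ζ, ham M ζ = 1 / 2 → toC (vel M ζ.1 ζ.2) ≠ 0 := fun ζ hζ => by
    have hb := (hvel ζ hζ).trans (le_norm_toC _)
    rw [← norm_pos_iff]; linarith
  have hbox : ∀ ζ, ham M ζ = 1 / 2 → ‖z.1 - ζ.1‖ ≤ 4 * d → ∀ x, ‖x - z.1‖ ≤ 2 * d →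
      (cco M ζ x).re ∈ Icc (-ρ) ρ := by
    intro ζ hζ hn x hx
    have hb := (hvel ζ hζ).trans (le_norm_toC _)
    refine abs_le.mp ((Complex.abs_re_le_norm _).trans ?_)
    rw [cco, norm_div, div_le_iff₀ (by linarith)]
    have h1 : ‖x - ζ.1‖ ≤ 6 * d := by
      calc _ = ‖(x - z.1) + (z.1 - ζ.1)‖ := by congr 1; abel
        _ ≤ _ := norm_add_le _ _
        _ ≤ _ := by linarith
    calc _ ≤ 2 * ‖x - ζ.1‖ := norm_toC_le _
      _ ≤ 2 * (6 * d) := by gcongr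
      _ = ρ * β := by rw [hd, hv]; field_simp; ring
      _ ≤ _ := by gcongr
  have hsgn : ∀ ζ h, ham M ζ = 1 / 2 → ‖z.1 - ζ.1‖ ≤ 4 * d →
      ContinuousOn h (Icc (-ρ) ρ) →
      (∀ ξ ∈ Icc (-ρ) ρ, |h ξ| ≤ C * ξ ^ 2 ∧
        ∃ s, |s| ≤ τ / 2 ∧ cco M ζ (pos M s ζ) = ξ + h ξ * Complex.I) →
      ∀ y, (∀ t ∈ Icc 0 τ, ‖pos M t y - z.1‖ ≤ 2 * d) → Avoids M τ y ζ →
      ∀ s ∈ Icc 0 τ, ∀ t ∈ Icc 0 τ, 0 < sideFn M ζ h (pos M s y) * sideFn M ζ h (pos M t y) := by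
    intro ζ h hζ hn hc hh y hy hay s hs t ht
    have hpc : Continuous fun t => cco M ζ (pos M t y) :=
      (cco_continuous M ζ).comp (pos_smooth M y).continuous
    refine sign_const (f := fun t => sideFn M ζ h (pos M t y)) ?_ (fun t ht h0 => ?_) hs ht
    · unfold sideFn
      exact (Complex.continuous_im.comp hpc).continuousOn.sub
        (hc.comp (Complex.continuous_re.comp hpc).continuousOn fun t ht => hbox ζ hζ hn _ (hy t ht))
    · obtain ⟨s, hs, hse⟩ := (hh _ (hbox ζ hζ hn _ (hy t ht))).2
      refine hay t ht s (cco_inj M (hne ζ hζ) ?_)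
      rw [hse]
      unfold sideFn at h0
      apply Complex.ext
      · simp
      · simp; linarith
  have dz2 : ∀ t ∈ Icc 0 τ, ‖pos M t z - z.1‖ ≤ 2 * d := fun t ht => (dz t ht).trans (by linarith)
  have dz2'' : ∀ t ∈ Icc 0 τ, ‖pos M t z'' - z.1‖ ≤ 2 * d := fun t ht =>
    (dz'' t ht).trans (by linarith)
  have hmulpos : ∀ a b c : ℝ, 0 < a * b → 0 < b * c → 0 < a * c := by
    intro a b c h1 h2
    rcases pos_and_pos_or_neg_and_neg_of_mul_pos h1 with ⟨h3, h4⟩ | ⟨h3, h4⟩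
    · exact mul_pos h3 ((mul_pos_iff_of_pos_left h4).mp h2)
    · exact mul_pos_of_neg_of_neg h3 (by by_contra! h5; nlinarith)
  have hav'' : Avoids M τ z'' ζ := by
    intro t ht s he
    have hζ' : ham M (flow M s ζ) = 1 / 2 := by rwa [ham_flow]
    have hnear : ‖z.1 - (flow M s ζ).1‖ ≤ 4 * d := by
      have h1 := dz'' t ht
      rw [he, norm_sub_rev] at h1
      exact h1.trans (by linarith)
    obtain ⟨h, hhc, hh0, hh⟩ := hside _ hζ'
    have s1 := hsgn _ h hζ' hnear hhc hh z dz2 (avoids_flow hav s) 0 m0 τ mτ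
    have s2 := hsgn _ h hζ' hnear hhc hh z' dz' (avoids_flow hav' s) 0 m0 τ mτ
    rw [pos_zero, htri.h1] at s1
    rw [pos_zero] at s2
    obtain ⟨u, hu⟩ := mem_orbit_of_hit hE hzh'' hζ' (hne _ hζ') hhc hh0 hh
      (fun t ht => hbox _ hζ' hnear _ (dz2'' t ht))
      (by rw [pos_zero, htri.h2, htri.h3]; exact hmulpos _ _ _ s1 s2) ht he
    refine avoids_flow hav s 0 m0 u ?_
    rw [pos_zero, ← htri.h2, hu]
  refine ⟨hav'', ?_⟩
  by_cases hnear : ‖z.1 - ζ.1‖ ≤ 4 * d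
  · obtain ⟨h, hhc, hh0, hh⟩ := hside _ hζ
    have s1 := hsgn _ h hζ hnear hhc hh z dz2 hav
    have s2 := hsgn _ h hζ hnear hhc hh z' dz' hav'
    have s3 := hsgn _ h hζ hnear hhc hh z'' dz2'' hav''
    set σ₀ := sideFn M ζ h z.1 with hσ₀
    have t1 : ∀ t ∈ Icc 0 τ, 0 < σ₀ * sideFn M ζ h (pos M t z) := fun t ht => by
      have := s1 0 m0 t ht
      rwa [pos_zero] at this
    have t3 : ∀ t ∈ Icc 0 τ, 0 < σ₀ * sideFn M ζ h (pos M t z'') := fun t ht => by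
      have := s3 0 m0 t ht
      rwa [pos_zero, htri.h2] at this
    have t2 : ∀ t ∈ Icc 0 τ, 0 < σ₀ * sideFn M ζ h (pos M t z') := fun t ht => by
      have h1 := s2 0 m0 t ht
      have h2 := t1 τ mτ
      rw [htri.h1] at h2
      rw [pos_zero] at h1
      exact hmulpos _ _ _ h2 h1
    have hu0 : -(σ₀ : ℂ) * Complex.I / toC (vel M ζ.1 ζ.2) ≠ 0 := by
      have : σ₀ ≠ 0 := by
        intro h0
        have := t1 0 m0
        rw [h0, zero_mul] at this
        exact this.false
      refine div_ne_zero (mul_ne_zero (neg_ne_zero.mpr (by exact_mod_cast this))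
        Complex.I_ne_zero) (hne ζ hζ)
    have hslit : ∀ x, 0 < σ₀ * sideFn M ζ h x →
        toC (x - ζ.1) * (-(σ₀ : ℂ) * Complex.I / toC (vel M ζ.1 ζ.2)) ∈ Complex.slitPlane := by
      intro x hx
      have e1 : toC (x - ζ.1) * (-(σ₀ : ℂ) * Complex.I / toC (vel M ζ.1 ζ.2)) =
          cco M ζ x * (-(σ₀ : ℂ) * Complex.I) := by rw [cco]; ring
      rw [e1, Complex.mem_slitPlane_iff]
      by_cases hr : (cco M ζ x).re = 0
      · left
        rw [sideFn, hr, hh0, sub_zero] at hx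
        simp; linarith
      · right
        have : σ₀ ≠ 0 := by
          rintro h0
          rw [h0, zero_mul] at hx
          exact hx.false
        simp [hr, this]
    exact ⟨_, hu0, fun t ht => hslit _ (t1 t ht), fun t ht => hslit _ (t2 t ht),
      fun t ht => hslit _ (t3 t ht)⟩
  · push Not at hnear
    have hw : 4 * d < ‖toC (z.1 - ζ.1)‖ := hnear.trans_le (le_norm_toC _)
    have hw0 : toC (z.1 - ζ.1) ≠ 0 := by rw [← norm_pos_iff]; linarith
    have hslit : ∀ x, ‖x - z.1‖ ≤ 2 * d →
        toC (x - ζ.1) * (toC (z.1 - ζ.1))⁻¹ ∈ Complex.slitPlane := by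
      intro x hx
      have e1 : toC (x - ζ.1) * (toC (z.1 - ζ.1))⁻¹ = 1 + toC (x - z.1) / toC (z.1 - ζ.1) := by
        have : toC (x - ζ.1) = toC (z.1 - ζ.1) + toC (x - z.1) := by
          rw [← map_add]; congr 1; abel
        rw [this, add_mul, mul_inv_cancel₀ hw0, div_eq_mul_inv]
      rw [e1]
      refine Complex.mem_slitPlane_of_norm_lt_one ?_
      rw [norm_div, div_lt_one (by linarith)]
      refine ((norm_toC_le _).trans ?_).trans_lt hw
      linarith
    exact ⟨_, inv_ne_zero hw0, fun t ht => hslit _ (dz2 t ht), fun t ht => hslit _ (dz' t ht),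
      fun t ht => hslit _ (dz2'' t ht)⟩

/-! ### The winding integral of an orbit segment -/

/-- The complex winding integral of the orbit segment of `z` over `[0,τ]` about `p`. -/
def wind (M : TorusMetric) (τ : ℝ) (p : ℝ × ℝ) (z : Ph) : ℂ :=
  ∫ t in (0 : ℝ)..τ, toC (vel M (flow M t z).1 (flow M t z).2) / toC (pos M t z - p)

theorem wind_of_slit (M : TorusMetric) {τ : ℝ} (hτ : 0 ≤ τ) {p : ℝ × ℝ} {u : ℂ} (hu : u ≠ 0) {z : Ph}
    (hz : ham M z ≤ 1) (h : InSlit M τ p u z) :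
    wind M τ p z = Complex.log (toC (pos M τ z - p) * u) - Complex.log (toC (z.1 - p) * u) := by
  have hd : ∀ t, HasDerivAt (fun t => toC (pos M t z - p) * u)
      (toC (vel M (flow M t z).1 (flow M t z).2) * u) t := fun t =>
    (toC.hasFDerivAt.comp_hasDerivAt t ((pos_deriv M hz t).sub_const p)).mul_const u
  have hne : ∀ t ∈ Icc 0 τ, toC (pos M t z - p) ≠ 0 := fun t ht h0 => by
    have := h t ht
    rw [h0, zero_mul] at this
    exact Complex.zero_notMem_slitPlane this
  have hc1 : Continuous fun t => toC (vel M (flow M t z).1 (flow M t z).2) :=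
    toC.continuous.comp (vel_flow_continuous M z)
  have hc2 : Continuous fun t => toC (pos M t z - p) :=
    toC.continuous.comp ((pos_smooth M z).continuous.sub continuous_const)
  have := intervalIntegral.integral_eq_sub_of_hasDerivAt (a := 0) (b := τ)
    (f := fun t => Complex.log (toC (pos M t z - p) * u))
    (f' := fun t => toC (vel M (flow M t z).1 (flow M t z).2) / toC (pos M t z - p))
    (fun t ht => by
      rw [uIcc_of_le hτ] at ht
      refine ((hd t).clog_real (h t ht)).congr_deriv ?_
      rw [mul_div_mul_right _ _ hu])
    (ContinuousOn.intervalIntegrable (by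
      rw [uIcc_of_le hτ]
      exact hc1.continuousOn.div hc2.continuousOn hne))
  rw [wind, this, pos_zero]

theorem wind_triangle (M : TorusMetric) {τ : ℝ} (hτ : 0 ≤ τ) {p : ℝ × ℝ} {u : ℂ} (hu : u ≠ 0)
    {z z' z'' : Ph} (hz : ham M z ≤ 1) (hz' : ham M z' ≤ 1) (hz'' : ham M z'' ≤ 1)
    (htri : IsTriangle M τ z z' z'') (h : InSlit M τ p u z) (h' : InSlit M τ p u z')
    (h'' : InSlit M τ p u z'') : wind M τ p z + wind M τ p z' = wind M τ p z'' := by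
  rw [wind_of_slit M hτ hu hz h, wind_of_slit M hτ hu hz' h', wind_of_slit M hτ hu hz'' h'',
    htri.h1, htri.h2, htri.h3]
  ring

/-- Replacing a short broken orbit by an unbroken one preserves avoidance of obstacles and the
winding integrals. -/
theorem corner_replace {M : TorusMetric} {τ c : ℝ} (hE : EnergyBound M τ c) : ∃ r, 0 < r ∧ r ≤ 1 / 8 ∧
    ∀ ζ z z' z'', ham M ζ = 1 / 2 → ham M z ≤ r → ham M z' ≤ r → ham M z'' ≤ r →
      IsTriangle M τ z z' z'' → Avoids M τ z ζ → Avoids M τ z' ζ →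
      Avoids M τ (scal (1 / 2) z'') ζ ∧ Avoids M τ (flow M τ (scal (1 / 2) z'')) ζ ∧
      wind M τ ζ.1 z + wind M τ ζ.1 z' =
        wind M τ ζ.1 (scal (1 / 2) z'') + wind M τ ζ.1 (flow M τ (scal (1 / 2) z'')) := by
  have hτ := hE.1
  obtain ⟨r, hr, hobs⟩ := triangle_obstacle hE
  refine ⟨min r (1 / 8), by positivity, min_le_right _ _, ?_⟩
  intro ζ z z' z'' hζ hz hz' hz'' htri hav hav'
  have l1 : ∀ y, ham M y ≤ min r (1 / 8) → ham M y ≤ r := fun y hy => hy.trans (min_le_left _ _)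
  have l2 : ∀ y, ham M y ≤ min r (1 / 8) → ham M y ≤ 1 := fun y hy =>
    (hy.trans (min_le_right _ _)).trans (by norm_num)
  obtain ⟨hav'', u, hu, s1, s2, s3⟩ := hobs ζ z z' z'' hζ (l1 _ hz) (l1 _ hz') (l1 _ hz'') htri
    hav hav'
  set y := scal (1 / 2) z'' with hy_def
  have hyh : ham M y ≤ min r (1 / 8) := by
    rw [hy_def, ham_scal]
    linarith [ham_nonneg M z'']
  have hyh' : ham M (flow M τ y) ≤ min r (1 / 8) := by rwa [ham_flow]
  have hp : ∀ t, pos M t y = pos M (1 / 2 * t) z'' := fun t =>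
    pos_scal M (l2 _ hz'') (l2 _ hyh) t
  have hp' : ∀ t, pos M t (flow M τ y) = pos M (1 / 2 * (t + τ)) z'' := fun t => by
    rw [← hp, pos, pos, ← flow_add]
  have hy : Avoids M τ y ζ := fun t ht s => by
    rw [hp]
    exact hav'' _ ⟨by linarith [ht.1], by linarith [ht.2]⟩ s
  have hy' : Avoids M τ (flow M τ y) ζ := fun t ht s => by
    rw [hp']
    exact hav'' _ ⟨by linarith [ht.1], by linarith [ht.2]⟩ s
  have htri' : IsTriangle M τ y (flow M τ y) z'' := ⟨rfl, rfl, by rw [hp']; congr 1; ring⟩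
  obtain ⟨-, u', hu', t1, t2, t3⟩ := hobs ζ y (flow M τ y) z'' hζ (l1 _ hyh) (l1 _ hyh')
    (l1 _ hz'') htri' hy hy'
  refine ⟨hy, hy', ?_⟩
  rw [wind_triangle M hτ.le hu (l2 _ hz) (l2 _ hz') (l2 _ hz'') htri s1 s2 s3,
    wind_triangle M hτ.le hu' (l2 _ hyh) (l2 _ hyh') (l2 _ hz'') htri' t1 t2 t3]

/-! ### Minimizing broken orbits in a winding class -/

/-- A broken orbit with `K` pieces, each of energy at most `r`, from `A` to `B` avoiding the
obstacles `ob`. -/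
structure IsBroken {ι : Type} (M : TorusMetric) (τ r : ℝ) (ob : ι → Ph) (A B : ℝ × ℝ) (K : ℕ)
    (P : ℕ → Ph) : Prop where
  start : (P 0).1 = A
  finish : ∀ i, i + 1 = K → pos M τ (P i) = B
  link : ∀ i, i + 1 < K → pos M τ (P i) = (P (i + 1)).1
  energy : ∀ i < K, ham M (P i) ≤ r
  avoid : ∀ i < K, ∀ k, Avoids M τ (P i) (ob k)

theorem sum_range_two_change {α : Type*} [AddCommGroup α] {f g : ℕ → α} {i K : ℕ} (hi : i + 1 < K)
    (h : ∀ j, j ≠ i → j ≠ i + 1 → f j = g j) :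
    ∑ j ∈ Finset.range K, f j - ∑ j ∈ Finset.range K, g j =
      (f i + f (i + 1)) - (g i + g (i + 1)) := by
  rw [← Finset.sum_sub_distrib]
  have hsub : ({i, i + 1} : Finset ℕ) ⊆ Finset.range K := by
    intro j hj
    simp only [Finset.mem_insert, Finset.mem_singleton] at hj
    rw [Finset.mem_range]; omega
  rw [← Finset.sum_subset hsub (fun j _ hj => by
    simp only [Finset.mem_insert, Finset.mem_singleton, not_or] at hj
    rw [h j hj.1 hj.2, sub_self]), Finset.sum_pair (by omega)]
  abel

/-- `r` is an energy bound below which corners of broken orbits can be cut. -/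
def CutsCorners (M : TorusMetric) (τ r : ℝ) : Prop :=
  0 < r ∧ r ≤ 1 / 8 ∧
    ∀ (ι : Type) (ob : ι → Ph), (∀ k, ham M (ob k) = 1 / 2) → ∀ (A B : ℝ × ℝ) (K : ℕ)
      (P : ℕ → Ph), IsBroken M τ r ob A B K P → ∀ i, i + 1 < K →
      ∃ (z'' : Ph) (P' : ℕ → Ph), ham M z'' ≤ 1 / 8 ∧ IsTriangle M τ (P i) (P (i + 1)) z'' ∧
        IsBroken M τ r ob A B K P' ∧
        (∀ k, ∑ j ∈ Finset.range K, wind M τ (ob k).1 (P' j) =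
          ∑ j ∈ Finset.range K, wind M τ (ob k).1 (P j)) ∧
        ∑ j ∈ Finset.range K, ham M (P' j) = ∑ j ∈ Finset.range K, ham M (P j) +
          ham M z'' / 2 - (ham M (P i) + ham M (P (i + 1)))

theorem exists_corner_cut {M : TorusMetric} {τ c : ℝ} (hE : EnergyBound M τ c)
    (hshort : ∀ r, 0 < r → ∃ r₁, 0 < r₁ ∧ ∀ x y : ℝ × ℝ, ‖x - y‖ ≤ r₁ →
      ∃ p, ham M (x, p) ≤ r ∧ pos M τ (x, p) = y) : ∃ r, CutsCorners M τ r := by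
  have hτ := hE.1
  obtain ⟨r₀, hr₀, hr₀8, hrep⟩ := corner_replace hE
  obtain ⟨r₁, hr₁, hbvp⟩ := hshort r₀ hr₀
  obtain ⟨r₂, hr₂, hspeed⟩ := exists_speed_bound M (v := r₁ / (2 * τ)) (by positivity)
  refine ⟨min r₀ r₂, by positivity, (min_le_left _ _).trans hr₀8, ?_⟩
  intro ι ob hob A B K P hP i hi
  have hPi := hP.energy i (by omega)
  have hPi' := hP.energy (i + 1) hi
  have hmove : ∀ y, ham M y ≤ min r₀ r₂ → ‖y.1 - pos M τ y‖ ≤ r₁ / 2 := by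
    intro y hy
    have := pos_lip M (z := y) (v := r₁ / (2 * τ))
      ((hy.trans (min_le_left _ _)).trans (hr₀8.trans (by norm_num)))
      (fun t => hspeed _ (by rw [ham_flow]; exact hy.trans (min_le_right _ _))) 0 τ
    rw [pos_zero, zero_sub, abs_neg, abs_of_pos hτ] at this
    refine this.trans (le_of_eq ?_)
    field_simp
  obtain ⟨p, hp, hpe⟩ := hbvp (P i).1 (pos M τ (P (i + 1))) (by
    have h1 := hmove _ hPi
    have h2 := hmove _ hPi'
    rw [hP.link i hi] at h1
    calc _ = ‖((P i).1 - (P (i + 1)).1) + ((P (i + 1)).1 - pos M τ (P (i + 1)))‖ := by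
          congr 1; abel
      _ ≤ _ := norm_add_le _ _
      _ ≤ r₁ := by linarith)
  set z'' : Ph := ((P i).1, p) with hz''
  have htri : IsTriangle M τ (P i) (P (i + 1)) z'' := ⟨hP.link i hi, rfl, hpe⟩
  have h8 : ∀ y, ham M y ≤ min r₀ r₂ → ham M y ≤ 1 / 2 := fun y hy =>
    (hy.trans (min_le_left _ _)).trans (hr₀8.trans (by norm_num))
  have hcut := (corner_cut hE (h8 _ hPi) (h8 _ hPi') (by linarith : ham M z'' ≤ 1 / 2)
    htri.h1 htri.h2 htri.h3).1
  set y := scal (1 / 2) z'' with hy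
  have hyh : ham M y = ham M z'' / 4 := by rw [hy, ham_scal]; ring
  have hyle : ham M y ≤ min r₀ r₂ := by linarith
  set P' : ℕ → Ph := fun j => if j = i then y else if j = i + 1 then flow M τ y else P j with hP'
  have e1 : P' i = y := by simp [hP']
  have e2 : P' (i + 1) = flow M τ y := by simp [hP']
  have e3 : ∀ j, j ≠ i → j ≠ i + 1 → P' j = P j := fun j h1 h2 => by simp [hP', h1, h2]
  have hrep' := fun k => hrep (ob k) (P i) (P (i + 1)) z'' (hob k) (hPi.trans (min_le_left _ _))
    (hPi'.trans (min_le_left _ _)) hp htri (hP.avoid i (by omega) k) (hP.avoid (i + 1) hi k)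
  have epos0 : ∀ j, (P' j).1 = (P j).1 ∨ j = i + 1 := fun j => by
    by_cases h1 : j = i
    · left; rw [h1, e1]; rfl
    · by_cases h2 : j = i + 1
      · exact Or.inr h2
      · left; rw [e3 j h1 h2]
  have epos1 : ∀ j, pos M τ (P' j) = pos M τ (P j) ∨ j = i := fun j => by
    by_cases h1 : j = i
    · exact Or.inr h1
    · by_cases h2 : j = i + 1
      · left
        rw [h2, e2, ← htri.h3, pos, ← flow_add, ← pos, pos_scal M (by linarith) (by
          rw [← hy]; linarith [h8 _ hyle])]
        congr 1; ring
      · left; rw [e3 j h1 h2]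
  refine ⟨z'', P', hp.trans hr₀8, htri, ⟨?_, ?_, ?_, ?_, ?_⟩, fun k => ?_, ?_⟩
  · rcases epos0 0 with h | h
    · rw [h, hP.start]
    · omega
  · intro j hj
    rcases epos1 j with h | h
    · rw [h, hP.finish j hj]
    · omega
  · intro j hj
    by_cases h1 : j = i
    · rw [h1, e1, e2]; rfl
    · rcases epos1 j with h | h
      · rcases epos0 (j + 1) with h' | h'
        · rw [h, h', hP.link j hj]
        · omega
      · exact absurd h h1
  · intro j hj
    by_cases h1 : j = i
    · rw [h1, e1]; exact hyle
    · by_cases h2 : j = i + 1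
      · rw [h2, e2, ham_flow]; exact hyle
      · rw [e3 j h1 h2]; exact hP.energy j hj
  · intro j hj k
    by_cases h1 : j = i
    · rw [h1, e1]; exact (hrep' k).1
    · by_cases h2 : j = i + 1
      · rw [h2, e2]; exact (hrep' k).2.1
      · rw [e3 j h1 h2]; exact hP.avoid j hj k
  · have := sum_range_two_change (f := fun j => wind M τ (ob k).1 (P' j))
      (g := fun j => wind M τ (ob k).1 (P j)) hi (fun j h1 h2 => by rw [e3 j h1 h2])
    simp only [e1, e2] at this
    rw [(hrep' k).2.2, sub_self] at this
    exact sub_eq_zero.mp this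
  · have := sum_range_two_change (f := fun j => ham M (P' j))
      (g := fun j => ham M (P j)) hi (fun j h1 h2 => by rw [e3 j h1 h2])
    simp only [e1, e2, ham_flow, hyh] at this
    linarith

/-! ### Limits of minimizing broken orbits -/

theorem IsBroken.norm_fst_le {ι : Type} {M : TorusMetric} {τ r : ℝ} {ob : ι → Ph} {A B : ℝ × ℝ} {K : ℕ}
    {P : ℕ → Ph} (hτ : 0 ≤ τ) (hP : IsBroken M τ r ob A B K P) (i : ℕ) (hi : i < K) :
    ‖(P i).1‖ ≤ ‖A‖ + i * (flowK M * τ) := by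
  induction i with
  | zero => simp [hP.start]
  | succ i ih =>
    have h1 := ih (by omega)
    rw [← hP.link i hi]
    have h2 := flow_time_lip M τ 0 (P i)
    rw [flow_zero, sub_zero, abs_of_nonneg hτ] at h2
    have h3 : ‖pos M τ (P i) - (P i).1‖ ≤ flowK M * τ := (_root_.norm_fst_le _).trans h2
    have h4 := norm_le_norm_add_norm_sub' (pos M τ (P i)) (P i).1
    push_cast
    linarith

theorem exists_norm_snd_le (M : TorusMetric) : ∃ R : ℝ, ∀ z, ham M z ≤ 1 → ‖z.2‖ ≤ R := by
  obtain ⟨c, hc, h⟩ := ham_lower M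
  refine ⟨1 + c⁻¹, fun z hz => ?_⟩
  have h1 : c * ‖z.2‖ ^ 2 ≤ 1 := (h z.1 z.2).trans hz
  have h2 : ‖z.2‖ ^ 2 ≤ c⁻¹ := by
    rw [← one_div, le_div_iff₀ hc]; linarith
  nlinarith [sq_nonneg (‖z.2‖ - 1), inv_pos.mpr hc]

theorem ham_continuous (M : TorusMetric) : Continuous (ham M) := (ham_smooth M).continuous

theorem exists_limit_orbit {M : TorusMetric} {τ c r : ℝ} (hE : EnergyBound M τ c)
    (hr : CutsCorners M τ r) {ι : Type} {ob : ι → Ph} (hob : ∀ k, ham M (ob k) = 1 / 2)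
    {A B : ℝ × ℝ} {K : ℕ} (hK : 0 < K) {P₀ : ℕ → Ph} (hP₀ : IsBroken M τ r ob A B K P₀) :
    ∃ z : Ph, ham M z ≤ r ∧ z.1 = A ∧ pos M (K * τ) z = B ∧ ∀ ε, 0 < ε →
      ∃ P, IsBroken M τ r ob A B K P ∧
        (∀ k, ∑ j ∈ Finset.range K, wind M τ (ob k).1 (P j) =
          ∑ j ∈ Finset.range K, wind M τ (ob k).1 (P₀ j)) ∧
        ∀ i < K, ‖P i - flow M (i * τ) z‖ ≤ ε := by
  obtain ⟨hr0, hr8, hcut⟩ := hr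
  have hτ := hE.1
  obtain ⟨R₂, hR₂⟩ := exists_norm_snd_le M
  set S : Set (ℕ → Ph) := {P | IsBroken M τ r ob A B K P ∧
    ∀ k, ∑ j ∈ Finset.range K, wind M τ (ob k).1 (P j) =
      ∑ j ∈ Finset.range K, wind M τ (ob k).1 (P₀ j)} with hS
  set E : (ℕ → Ph) → ℝ := fun P => ∑ j ∈ Finset.range K, ham M (P j) with hEdef
  have hbdd : BddBelow (E '' S) :=
    ⟨0, by rintro _ ⟨P, -, rfl⟩; exact Finset.sum_nonneg fun j _ => ham_nonneg M _⟩
  set m := sInf (E '' S) with hm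
  have hmle : ∀ P ∈ S, m ≤ E P := fun P hP => csInf_le hbdd ⟨P, hP, rfl⟩
  have hex : ∀ n : ℕ, ∃ P ∈ S, E P < m + 1 / ((n : ℝ) + 1) := fun n => by
    obtain ⟨_, ⟨P, hP, rfl⟩, h⟩ := exists_lt_of_csInf_lt (s := E '' S)
      ⟨_, P₀, ⟨hP₀, fun k => rfl⟩, rfl⟩ (lt_add_of_pos_right m (Nat.one_div_pos_of_nat (α := ℝ) (n := n)))
    exact ⟨P, hP, h⟩
  choose Pn hPnS hPnE using hex
  set R := max (‖A‖ + K * (flowK M * τ)) R₂ with hR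
  have hbound : ∀ P ∈ S, ∀ j < K, ‖(P j).1‖ ≤ R := fun P hP j hj => by
    refine (hP.1.norm_fst_le hτ.le j hj).trans (le_trans ?_ (le_max_left _ _))
    have : (j : ℝ) ≤ K := by exact_mod_cast hj.le
    have h2 : 0 ≤ flowK M * τ := by positivity
    nlinarith
  have hcomp : IsCompact (univ.pi fun _ : ℕ => Metric.closedBall (0 : Ph) R) :=
    isCompact_univ_pi fun _ => isCompact_closedBall 0 R
  have hR0 : 0 ≤ R := (norm_nonneg _).trans (hbound _ (hPnS 0) 0 hK)
  obtain ⟨Q, -, φ, hφ, hlim⟩ := hcomp.tendsto_subseq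
    (x := fun n j => if j < K then Pn n j else 0) (fun n j _ => by
      by_cases hj : j < K
      · simp only [hj, if_true, mem_closedBall_zero_iff]
        refine max_le (hbound _ (hPnS n) j hj) ((hR₂ _ ?_).trans (le_max_right _ _))
        exact ((hPnS n).1.energy j hj).trans (by linarith)
      · simpa [hj] using hR0)
  set P : ℕ → ℕ → Ph := fun n => Pn (φ n) with hPdef
  have hPS : ∀ n, P n ∈ S := fun n => hPnS _
  have hPQ : ∀ j < K, Tendsto (fun n => P n j) atTop (𝓝 (Q j)) := fun j hj => by
    have := (tendsto_pi_nhds.mp hlim) j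
    simpa [Function.comp_def, hj] using this
  have hEm : Tendsto (fun n => E (P n)) atTop (𝓝 m) := by
    refine tendsto_of_tendsto_of_tendsto_of_le_of_le tendsto_const_nhds ?_
      (fun n => hmle _ (hPS n)) (fun n => (hPnE (φ n)).le)
    have := (tendsto_one_div_add_atTop_nhds_zero_nat (𝕜 := ℝ)).comp hφ.tendsto_atTop
    simpa [Function.comp_def] using tendsto_const_nhds.add this (a := m)
  have hposτ : Continuous fun z : Ph => pos M τ z := continuous_fst.comp
    ((flow_continuous M).comp (by fun_prop : Continuous fun z : Ph => (τ, z)))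
  have hQham : ∀ j < K, ham M (Q j) ≤ r := fun j hj =>
    le_of_tendsto (((ham_continuous M).tendsto _).comp (hPQ j hj))
      (Eventually.of_forall fun n => (hPS n).1.energy j hj)
  have hQstep : ∀ j, j + 1 < K → Q (j + 1) = flow M τ (Q j) := by
    intro j hj
    have hex : ∀ n, ∃ z'' : Ph, ham M z'' ≤ 1 / 8 ∧ IsTriangle M τ (P n j) (P n (j + 1)) z'' ∧
        m ≤ E (P n) + ham M z'' / 2 - (ham M (P n j) + ham M (P n (j + 1))) := fun n => by
      obtain ⟨z'', P', h1, h2, h3, h4, h5⟩ := hcut ι ob hob A B K (P n) (hPS n).1 j hj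
      refine ⟨z'', h1, h2, ?_⟩
      have := hmle P' ⟨h3, fun k => (h4 k).trans ((hPS n).2 k)⟩
      linarith [h5]
    choose w hw8 hwtri hwE using hex
    obtain ⟨w₀, -, ψ, hψ, hwlim⟩ := (isCompact_closedBall (0 : Ph) R).tendsto_subseq (x := w)
      (fun n => by
        rw [mem_closedBall_zero_iff]
        refine max_le ?_ ((hR₂ _ ((hw8 n).trans (by norm_num))).trans (le_max_right _ _))
        rw [(hwtri n).h2]
        exact hbound _ (hPS n) j (by omega))
    have l1 := (hPQ j (by omega)).comp hψ.tendsto_atTop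
    have l2 := (hPQ (j + 1) hj).comp hψ.tendsto_atTop
    have hH := ham_continuous M
    have k1 : ham M w₀ ≤ 1 / 8 := le_of_tendsto ((hH.tendsto _).comp hwlim)
      (Eventually.of_forall fun n => hw8 _)
    have k2 : m ≤ m + ham M w₀ / 2 - (ham M (Q j) + ham M (Q (j + 1))) :=
      ge_of_tendsto (((hEm.comp hψ.tendsto_atTop).add (((hH.tendsto _).comp hwlim).div_const 2)).sub
        (((hH.tendsto _).comp l1).add ((hH.tendsto _).comp l2)))
        (Eventually.of_forall fun n => hwE _)
    have t1 : pos M τ (Q j) = (Q (j + 1)).1 :=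
      tendsto_nhds_unique ((hposτ.tendsto _).comp l1)
        (((continuous_fst.tendsto _).comp l2).congr fun n => ((hwtri _).h1).symm)
    have t2 : w₀.1 = (Q j).1 :=
      tendsto_nhds_unique ((continuous_fst.tendsto _).comp hwlim)
        (((continuous_fst.tendsto _).comp l1).congr fun n => ((hwtri _).h2).symm)
    have t3 : pos M τ w₀ = pos M τ (Q (j + 1)) :=
      tendsto_nhds_unique ((hposτ.tendsto _).comp hwlim)
        (((hposτ.tendsto _).comp l2).congr fun n => ((hwtri _).h3).symm)
    have q1 := hQham j (by omega)
    have q2 := hQham (j + 1) hj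
    exact (corner_cut hE (by linarith) (by linarith) (by linarith) t1 t2 t3).2 (by linarith)
  have hQ : ∀ j < K, Q j = flow M (j * τ) (Q 0) := by
    intro j
    induction j with
    | zero => intro _; simp [flow_zero]
    | succ j ih =>
      intro hj
      rw [hQstep j hj, ih (by omega), ← flow_add]
      congr 1; push_cast; ring
  refine ⟨Q 0, hQham 0 hK, ?_, ?_, ?_⟩
  · exact tendsto_nhds_unique ((continuous_fst.tendsto _).comp (hPQ 0 hK))
      (tendsto_const_nhds.congr fun n => ((hPS n).1.start).symm)
  · obtain ⟨K', rfl⟩ : ∃ K', K = K' + 1 := ⟨K - 1, by omega⟩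
    have h1 : pos M τ (Q K') = B :=
      tendsto_nhds_unique ((hposτ.tendsto _).comp (hPQ K' (by omega)))
        (tendsto_const_nhds.congr fun n => ((hPS n).1.finish K' rfl).symm)
    rw [← h1, hQ K' (by omega), pos, pos, ← flow_add]
    congr 2; push_cast; ring
  · intro ε hε
    have hev : ∀ᶠ n in atTop, ∀ i ∈ Finset.range K, ‖P n i - Q i‖ ≤ ε := by
      rw [eventually_all_finset]
      intro i hi
      have := (hPQ i (Finset.mem_range.mp hi))
      filter_upwards [(Metric.tendsto_nhds.mp this) ε hε] with n hn
      rw [dist_eq_norm] at hn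
      exact hn.le
    obtain ⟨n, hn⟩ := hev.exists
    refine ⟨P n, (hPS n).1, (hPS n).2, fun i hi => ?_⟩
    rw [← hQ i hi]
    exact hn i (Finset.mem_range.mpr hi)

/-! ### Reference paths -/

/-- Horizontal coordinate of the reference path, in units of the mesh. -/
def refX (m j : ℕ) : ℕ := m * (j / (3 * m)) + min (j % (3 * m) - m) m

/-- Vertical coordinate of the reference path coded by `σ`, in units of the mesh. -/
def refY (m : ℕ) (σ : ℕ → Bool) (j : ℕ) : ℕ :=
  if σ (j / (3 * m)) then min (j % (3 * m)) (min m (3 * m - j % (3 * m))) else 0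

theorem exists_block {m : ℕ} (hm : 0 < m) (j : ℕ) : ∃ b q, q < 3 * m ∧ j = 3 * m * b + q :=
  ⟨j / (3 * m), j % (3 * m), Nat.mod_lt _ (by omega), (Nat.div_add_mod j (3 * m)).symm⟩

theorem refX_block {m b q : ℕ} (hq : q < 3 * m) :
    refX m (3 * m * b + q) = m * b + min (q - m) m := by
  rw [refX, Nat.mul_add_mod, Nat.mod_eq_of_lt hq, Nat.mul_add_div (by omega),
    Nat.div_eq_of_lt hq, add_zero]

theorem refY_block {m b q : ℕ} (σ : ℕ → Bool) (hq : q < 3 * m) :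
    refY m σ (3 * m * b + q) = if σ b then min q (min m (3 * m - q)) else 0 := by
  rw [refY, Nat.mul_add_mod, Nat.mod_eq_of_lt hq, Nat.mul_add_div (by omega),
    Nat.div_eq_of_lt hq, add_zero]

theorem refX_start {m : ℕ} (hm : 0 < m) (b : ℕ) : refX m (3 * m * b) = m * b := by
  have := refX_block (m := m) (b := b) (q := 0) (by omega)
  simpa using this

theorem refY_start {m : ℕ} (hm : 0 < m) (σ : ℕ → Bool) (b : ℕ) : refY m σ (3 * m * b) = 0 := by
  have := refY_block (m := m) (b := b) (q := 0) σ (by omega)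
  simpa using this

theorem ref_succ {m : ℕ} (hm : 0 < m) (σ : ℕ → Bool) (j : ℕ) :
    refX m j ≤ refX m (j + 1) ∧ refX m (j + 1) ≤ refX m j + 1 ∧
      refY m σ (j + 1) ≤ refY m σ j + 1 ∧ refY m σ j ≤ refY m σ (j + 1) + 1 := by
  obtain ⟨b, q, hq, rfl⟩ := exists_block hm j
  by_cases h : q + 1 < 3 * m
  · rw [add_assoc, refX_block hq, refX_block h, refY_block σ hq, refY_block σ h]
    refine ⟨by omega, by omega, ?_, ?_⟩ <;> split_ifs <;> omega
  · have e : 3 * m * b + q + 1 = 3 * m * (b + 1) := by rw [mul_add]; omega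
    rw [e, refX_start hm, refY_start hm, refX_block hq, refY_block σ hq, mul_add]
    refine ⟨by omega, by omega, by omega, ?_⟩
    split_ifs <;> omega

theorem refX_mono {m : ℕ} (hm : 0 < m) : Monotone (refX m) :=
  monotone_nat_of_le_succ fun j => (ref_succ hm (fun _ => true) j).1

theorem ref_corridor {m : ℕ} (hm : 0 < m) (σ : ℕ → Bool) (j : ℕ) :
    m ∣ refX m j ∨ m ∣ refY m σ j := by
  obtain ⟨b, q, hq, rfl⟩ := exists_block hm j
  rw [refX_block hq, refY_block σ hq]
  by_cases h1 : q ≤ m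
  · left; rw [show min (q - m) m = 0 by omega]; simp
  · by_cases h2 : 2 * m ≤ q
    · left; rw [show min (q - m) m = m by omega, ← mul_add_one]; simp
    · right
      split_ifs
      · rw [show min q (min m (3 * m - q)) = m by omega]
      · simp

theorem ref_true {m : ℕ} {σ : ℕ → Bool} {b j : ℕ} (hσ : σ b = true)
    (h1 : 3 * m * b ≤ j) (h2 : j < 3 * m * (b + 1)) :
    refX m j ≤ m * b ∨ m * (b + 1) ≤ refX m j ∨ refY m σ j = m := by
  obtain ⟨q, rfl⟩ := Nat.exists_eq_add_of_le h1
  have hq : q < 3 * m := by rw [mul_add] at h2; omega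
  rw [refX_block hq, refY_block σ hq, mul_add, if_pos hσ]
  omega

theorem ref_false {m : ℕ} {σ : ℕ → Bool} {b j : ℕ} (hσ : σ b = false)
    (h1 : 3 * m * b ≤ j) (h2 : j < 3 * m * (b + 1)) : refY m σ j = 0 := by
  obtain ⟨q, rfl⟩ := Nat.exists_eq_add_of_le h1
  have hq : q < 3 * m := by rw [mul_add] at h2; omega
  rw [refY_block σ hq, hσ]
  simp

/-- The vertices of the reference path coded by `σ`. -/
def refV (N μ m : ℕ) (p : ℝ × ℝ) (σ : ℕ → Bool) (j : ℕ) : ℝ × ℝ :=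
  (p.1 - N / 2 + N / μ * refX m j, p.2 - N / 2 + N / μ * refY m σ j)

/-- A chain of short orbit segments through the vertices `V`, each staying `d`-close to its
initial vertex. -/
structure OrbitChain (M : TorusMetric) (τ r d : ℝ) (V : ℕ → ℝ × ℝ) (P : ℕ → Ph) : Prop where
  energy : ∀ j, ham M (P j) ≤ r
  start : ∀ j, (P j).1 = V j
  finish : ∀ j, pos M τ (P j) = V (j + 1)
  near : ∀ j, ∀ t ∈ Icc 0 τ, ‖pos M t (P j) - V j‖ ≤ d

theorem exists_chain {M : TorusMetric} {τ r d : ℝ} (hτ : 0 < τ) (hr : 0 < r) (hr1 : r ≤ 1)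
    (hd : 0 < d) (hshort : ∀ r, 0 < r → ∃ r₁, 0 < r₁ ∧ ∀ x y : ℝ × ℝ, ‖x - y‖ ≤ r₁ →
      ∃ p, ham M (x, p) ≤ r ∧ pos M τ (x, p) = y) :
    ∃ r₁, 0 < r₁ ∧ ∀ V : ℕ → ℝ × ℝ, (∀ j, ‖V j - V (j + 1)‖ ≤ r₁) → ∃ P, OrbitChain M τ r d V P := by
  obtain ⟨r₂, hr₂, hspeed⟩ := exists_speed_bound M (v := d / τ) (by positivity)
  obtain ⟨r₁, hr₁, h⟩ := hshort (min r r₂) (by positivity)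
  refine ⟨r₁, hr₁, fun V hV => ?_⟩
  choose p hp hpos using fun j => h _ _ (hV j)
  refine ⟨fun j => (V j, p j), fun j => (hp j).trans (min_le_left _ _), fun j => rfl, hpos,
    fun j t ht => ?_⟩
  have := pos_lip M (z := (V j, p j)) (v := d / τ)
    (((hp j).trans (min_le_left _ _)).trans hr1)
    (fun t => hspeed _ (by rw [ham_flow]; exact (hp j).trans (min_le_right _ _))) t 0
  rw [pos_zero, sub_zero, abs_of_nonneg ht.1] at this
  refine this.trans ?_
  calc d / τ * t ≤ d / τ * τ := mul_le_mul_of_nonneg_left ht.2 (by positivity)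
    _ = d := by field_simp

theorem refV_step {N μ m : ℕ} (hm : 0 < m) (p : ℝ × ℝ) (σ : ℕ → Bool) (j : ℕ) :
    ‖refV N μ m p σ j - refV N μ m p σ (j + 1)‖ ≤ N / μ := by
  obtain ⟨h1, h2, h3, h4⟩ := ref_succ hm σ j
  have h1' : (refX m j : ℝ) ≤ refX m (j + 1) := by exact_mod_cast h1
  have h2' : (refX m (j + 1) : ℝ) ≤ refX m j + 1 := by exact_mod_cast h2
  have h3' : (refY m σ (j + 1) : ℝ) ≤ refY m σ j + 1 := by exact_mod_cast h3
  have h4' : (refY m σ j : ℝ) ≤ refY m σ (j + 1) + 1 := by exact_mod_cast h4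
  have hs : (0 : ℝ) ≤ N / μ := by positivity
  have key : ∀ a b : ℝ, |a - b| ≤ 1 → |(N / μ : ℝ) * (a - b)| ≤ N / μ := fun a b hab => by
    rw [abs_mul, abs_of_nonneg hs]; nlinarith
  rw [Prod.norm_def]
  refine max_le ?_ ?_
  · have := key (refX m j) (refX m (j + 1)) (abs_le.mpr ⟨by linarith, by linarith⟩)
    rw [Real.norm_eq_abs]
    refine le_of_eq_of_le (congrArg abs ?_) this
    simp only [refV, Prod.fst_sub]; ring
  · have := key (refY m σ j) (refY m σ (j + 1)) (abs_le.mpr ⟨by linarith, by linarith⟩)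
    rw [Real.norm_eq_abs]
    refine le_of_eq_of_le (congrArg abs ?_) this
    simp only [refV, Prod.snd_sub]; ring

/-- The translates of the bounded orbit used as obstacles. -/
def obst (N : ℕ) (ζ : Ph) (k : ℤ × ℤ) : Ph := (ζ.1 + lat ((N : ℤ) • k), ζ.2)

theorem ham_obst (M : TorusMetric) (N : ℕ) (ζ : Ph) (k : ℤ × ℤ) : ham M (obst N ζ k) = ham M ζ :=
  ham_per M _ _ _

theorem pos_obst (M : TorusMetric) (N : ℕ) (ζ : Ph) (k : ℤ × ℤ) (s : ℝ) :
    pos M s (obst N ζ k) = pos M s ζ + lat ((N : ℤ) • k) := by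
  rw [obst, pos, flow_per]; rfl

theorem half_le_abs_sub {N : ℝ} (hN : 0 ≤ N) (k l : ℤ) : N / 2 ≤ |-(N / 2) + N * k - N * l| := by
  have : -(N / 2) + N * k - N * l = N * ((k - l : ℤ) - 1 / 2) := by push_cast; ring
  rw [this, abs_mul, abs_of_nonneg hN]
  have : (1 : ℝ) / 2 ≤ |((k - l : ℤ) : ℝ) - 1 / 2| := by
    rcases le_or_gt (k - l) 0 with h | h
    · have : ((k - l : ℤ) : ℝ) ≤ 0 := by exact_mod_cast h
      rw [abs_of_neg (by linarith)]; linarith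
    · have : (1 : ℝ) ≤ ((k - l : ℤ) : ℝ) := by exact_mod_cast h
      rw [abs_of_pos (by linarith)]; linarith
  nlinarith

theorem refV_far {N μ L : ℕ} (hμ : 0 < μ) (hL : 0 < L) (p : ℝ × ℝ) (σ : ℕ → Bool) (j : ℕ)
    (k : ℤ × ℤ) : (N : ℝ) / 2 ≤ ‖refV N μ (μ * L) p σ j - (p + lat ((N : ℤ) • k))‖ := by
  have hμ' : (μ : ℝ) ≠ 0 := by positivity
  rcases ref_corridor (Nat.mul_pos hμ hL) σ j with ⟨a, ha⟩ | ⟨a, ha⟩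
  · refine le_trans ?_ (_root_.norm_fst_le _)
    refine (half_le_abs_sub (by positivity) (L * a : ℤ) k.1).trans (le_of_eq ?_)
    rw [Real.norm_eq_abs]
    congr 1
    simp only [refV, ha, lat, Prod.fst_sub, Prod.fst_add, Prod.smul_fst, smul_eq_mul]
    push_cast; field_simp; ring
  · refine le_trans ?_ (_root_.norm_snd_le _)
    refine (half_le_abs_sub (by positivity) (L * a : ℤ) k.2).trans (le_of_eq ?_)
    rw [Real.norm_eq_abs]
    congr 1
    simp only [refV, ha, lat, Prod.snd_sub, Prod.snd_add, Prod.smul_snd, smul_eq_mul]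
    push_cast; field_simp; ring

theorem OrbitChain.isBroken {M : TorusMetric} {τ r : ℝ} {N μ L : ℕ} (hN : 0 < N) (hμ : 0 < μ)
    (hL : 0 < L) {ζ : Ph} (hζ : ∀ s, ‖pos M s ζ - ζ.1‖ ≤ (N : ℝ) / 8) {σ : ℕ → Bool} {P : ℕ → Ph}
    (h : OrbitChain M τ r ((N : ℝ) / 8) (refV N μ (μ * L) ζ.1 σ) P) (K : ℕ) :
    IsBroken M τ r (obst N ζ) (refV N μ (μ * L) ζ.1 σ 0) (refV N μ (μ * L) ζ.1 σ K) K P where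
  start := h.start 0
  finish i hi := by rw [h.finish, hi]
  link i _ := by rw [h.finish, h.start]
  energy i _ := h.energy i
  avoid i _ k t ht s heq := by
    have hN' : (0 : ℝ) < N := by exact_mod_cast hN
    rw [pos_obst] at heq
    have h1 := refV_far (N := N) hμ hL ζ.1 σ i k
    have h2 := h.near i t ht
    have h3 := hζ s
    rw [heq] at h2
    have : refV N μ (μ * L) ζ.1 σ i - (ζ.1 + lat ((N : ℤ) • k)) =
        -(pos M s ζ + lat ((N : ℤ) • k) - refV N μ (μ * L) ζ.1 σ i) + (pos M s ζ - ζ.1) := by abel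
    rw [this] at h1
    have h4 := norm_add_le (-(pos M s ζ + lat ((N : ℤ) • k) - refV N μ (μ * L) ζ.1 σ i))
      (pos M s ζ - ζ.1)
    rw [norm_neg] at h4
    linarith

theorem OrbitChain.sum_wind {M : TorusMetric} {τ r d : ℝ} (hτ : 0 ≤ τ) (hr : r ≤ 1) {V : ℕ → ℝ × ℝ}
    {P : ℕ → Ph} (h : OrbitChain M τ r d V P) {p : ℝ × ℝ} {u : ℂ} (hu : u ≠ 0) {a b : ℕ} (hab : a ≤ b)
    (hs : ∀ j, a ≤ j → j < b → InSlit M τ p u (P j)) :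
    ∑ j ∈ Finset.Ico a b, wind M τ p (P j) =
      Complex.log (toC (V b - p) * u) - Complex.log (toC (V a - p) * u) := by
  induction b, hab using Nat.le_induction with
  | base => simp
  | succ b hab ih =>
    rw [Finset.sum_Ico_succ_top hab, ih (fun j h1 h2 => hs j h1 (by omega)),
      wind_of_slit M hτ hu ((h.energy b).trans hr) (hs b hab (by omega)), h.finish, h.start]
    ring

/-- The complex position of the corner of block `b` relative to the obstacle with index `k`. -/
def cornerC (N L b : ℕ) (k : ℤ × ℤ) : ℂ := ⟨N * ((L : ℝ) * b - k.1 - 1 / 2), -N * (k.2 + 1 / 2)⟩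

theorem toC_refV_start {N μ L : ℕ} (hμ : 0 < μ) (hL : 0 < L) (p : ℝ × ℝ) (σ : ℕ → Bool) (b : ℕ)
    (k : ℤ × ℤ) : toC (refV N μ (μ * L) p σ (3 * (μ * L) * b) - (p + lat ((N : ℤ) • k))) =
      cornerC N L b k := by
  have hμ' : (μ : ℝ) ≠ 0 := by positivity
  have hm := Nat.mul_pos hμ hL
  apply Complex.ext
  · rw [toC_re]
    simp only [refV, refX_start hm, lat, cornerC, Prod.fst_sub, Prod.fst_add, Prod.smul_fst,
      smul_eq_mul]
    push_cast; field_simp; ring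
  · rw [toC_im]
    simp only [refV, refY_start hm, lat, cornerC, Prod.snd_sub, Prod.snd_add, Prod.smul_snd,
      smul_eq_mul]
    push_cast; ring

/-- Coordinates of a point of a chain along a reference path relative to an obstacle. -/
theorem OrbitChain.coords {M : TorusMetric} {τ r : ℝ} {N μ L : ℕ} (hN : 0 < N) (hμ : 0 < μ)
    {p : ℝ × ℝ} {σ : ℕ → Bool} {P : ℕ → Ph}
    (h : OrbitChain M τ r ((N : ℝ) / 8) (refV N μ (μ * L) p σ) P) (k : ℤ × ℤ) (j : ℕ) {t : ℝ}
    (ht : t ∈ Icc 0 τ) (a : ℕ) :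
    (refX (μ * L) j ≤ μ * L * a → (L : ℤ) * a ≤ k.1 →
      (toC (pos M t (P j) - (p + lat ((N : ℤ) • k)))).re < 0) ∧
    (μ * L * a ≤ refX (μ * L) j → k.1 < (L : ℤ) * a →
      0 < (toC (pos M t (P j) - (p + lat ((N : ℤ) • k)))).re) ∧
    (refY (μ * L) σ j = 0 → 0 ≤ k.2 →
      (toC (pos M t (P j) - (p + lat ((N : ℤ) • k)))).im < 0) ∧
    (refY (μ * L) σ j = μ * L → k.2 < L →
      0 < (toC (pos M t (P j) - (p + lat ((N : ℤ) • k)))).im) := by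
  have hμ' : (0 : ℝ) < μ := by exact_mod_cast hμ
  have hN' : (0 : ℝ) < N := by exact_mod_cast hN
  have hn := h.near j t ht
  have h1 := (_root_.norm_fst_le _).trans hn
  have h2 := (_root_.norm_snd_le _).trans hn
  rw [Real.norm_eq_abs] at h1 h2
  simp only [refV, Prod.fst_sub, Prod.snd_sub] at h1 h2
  have h1 := abs_le.mp h1
  have h2 := abs_le.mp h2
  simp only [toC_re, toC_im, lat, Prod.fst_sub, Prod.fst_add, Prod.smul_fst, Prod.snd_sub,
    Prod.snd_add, Prod.smul_snd, smul_eq_mul]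
  push_cast
  refine ⟨fun hx hk => ?_, fun hx hk => ?_, fun hy hk => ?_, fun hy hk => ?_⟩
  · have hx' : (refX (μ * L) j : ℝ) ≤ μ * L * a := by exact_mod_cast hx
    have hk' : (L : ℝ) * a ≤ k.1 := by exact_mod_cast hk
    have : (N : ℝ) / μ * refX (μ * L) j ≤ N * k.1 := by
      rw [div_mul_eq_mul_div, div_le_iff₀ hμ', mul_assoc]
      exact mul_le_mul_of_nonneg_left (by nlinarith) hN'.le
    linarith
  · have hx' : (μ * L * a : ℝ) ≤ refX (μ * L) j := by exact_mod_cast hx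
    have hk' : (k.1 : ℝ) + 1 ≤ (L : ℝ) * a := by exact_mod_cast hk
    have : (N : ℝ) * (k.1 + 1) ≤ N / μ * refX (μ * L) j := by
      rw [div_mul_eq_mul_div, le_div_iff₀ hμ', mul_assoc]
      exact mul_le_mul_of_nonneg_left (by nlinarith) hN'.le
    linarith
  · have hk' : (0 : ℝ) ≤ k.2 := by exact_mod_cast hk
    rw [hy] at h2
    simp only [Nat.cast_zero, mul_zero] at h2
    nlinarith
  · have hk' : (k.2 : ℝ) + 1 ≤ L := by exact_mod_cast hk
    rw [hy] at h2
    push_cast at h2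
    have e : (N : ℝ) / μ * (μ * L) = N * L := by field_simp
    rw [e] at h2
    nlinarith

theorem OrbitChain.total_wind {M : TorusMetric} {τ r : ℝ} (hτ : 0 ≤ τ) (hr : r ≤ 1) {N μ L : ℕ}
    (hN : 0 < N) (hμ : 0 < μ) (hL : 0 < L) {p : ℝ × ℝ} {σ : ℕ → Bool} {P : ℕ → Ph}
    (h : OrbitChain M τ r ((N : ℝ) / 8) (refV N μ (μ * L) p σ) P) {b n : ℕ} (hb : b < n) {k : ℤ × ℤ}
    (hk1 : (L : ℤ) * b ≤ k.1) (hk2 : k.1 < (L : ℤ) * (b + 1)) (hk3 : 0 ≤ k.2) (hk4 : k.2 < L)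
    {u : ℂ} (hu : (σ b = true ∧ u = -Complex.I) ∨ (σ b = false ∧ u = Complex.I)) :
    ∑ j ∈ Finset.range (3 * (μ * L) * n), wind M τ (p + lat ((N : ℤ) • k)) (P j) =
      (Complex.log (cornerC N L b k * (-1)) - Complex.log (cornerC N L 0 k * (-1))) +
      (Complex.log (cornerC N L (b + 1) k * u) - Complex.log (cornerC N L b k * u)) +
      (Complex.log (cornerC N L n k * 1) - Complex.log (cornerC N L (b + 1) k * 1)) := by
  have hm := Nat.mul_pos hμ hL
  have l1 : 3 * (μ * L) * b ≤ 3 * (μ * L) * (b + 1) := Nat.mul_le_mul_left _ (by omega)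
  have l2 : 3 * (μ * L) * (b + 1) ≤ 3 * (μ * L) * n := Nat.mul_le_mul_left _ (by omega)
  have hu0 : u ≠ 0 := by rcases hu with ⟨-, rfl⟩ | ⟨-, rfl⟩ <;> simp
  rw [Finset.range_eq_Ico, ← Finset.sum_Ico_consecutive _ (Nat.zero_le _) (l1.trans l2),
    ← Finset.sum_Ico_consecutive _ l1 l2, ← add_assoc]
  rw [h.sum_wind hτ hr (u := -1) (by simp) (Nat.zero_le _), h.sum_wind hτ hr hu0 l1,
    h.sum_wind hτ hr (u := 1) (by simp) l2]
  · have e0 := toC_refV_start (N := N) hμ hL p σ 0 k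
    rw [mul_zero] at e0
    rw [toC_refV_start hμ hL, toC_refV_start hμ hL, toC_refV_start hμ hL, e0]
  · intro j hj1 hj2 t ht
    have := (h.coords hN hμ k j ht (b + 1)).2.1 ((refX_start hm _).symm.le.trans
      (refX_mono hm hj1)) (by exact_mod_cast hk2)
    rw [mul_one]
    exact Or.inl this
  · intro j hj1 hj2 t ht
    rcases hu with ⟨hσ, rfl⟩ | ⟨hσ, rfl⟩
    · rcases ref_true hσ hj1 hj2 with hx | hx | hy
      · have := (h.coords hN hμ k j ht b).1 hx hk1
        exact Or.inr (by simpa [-map_sub, -map_add] using this.ne)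
      · have := (h.coords hN hμ k j ht (b + 1)).2.1 hx (by exact_mod_cast hk2)
        exact Or.inr (by simpa [-map_sub, -map_add] using this.ne')
      · have := (h.coords hN hμ k j ht b).2.2.2 hy hk4
        exact Or.inl (by simpa using this)
    · have := (h.coords hN hμ k j ht b).2.2.1 (ref_false hσ hj1 hj2) hk3
      exact Or.inl (by simpa using this)
  · intro j hj1 hj2 t ht
    have := (h.coords hN hμ k j ht b).1 ((refX_mono hm hj2.le).trans (refX_start hm _).le) hk1
    exact Or.inl (by simpa using this)

theorem log_turn_ne {w₁ w₂ : ℂ} (h1 : w₁.re < 0) (h1' : w₁.im < 0) (h2 : 0 < w₂.re)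
    (h2' : w₂.im < 0) : Complex.log (w₂ * -Complex.I) - Complex.log (w₁ * -Complex.I) ≠
      Complex.log (w₂ * Complex.I) - Complex.log (w₁ * Complex.I) := by
  intro h
  have h' := congrArg Complex.im h
  simp only [Complex.sub_im, Complex.log_im] at h'
  have a1 : Complex.arg (w₂ * -Complex.I) < -(Real.pi / 2) := by
    by_contra hcon
    rcases Complex.neg_pi_div_two_le_arg_iff.mp (not_lt.mp hcon) with hh | hh
    · simp at hh; linarith
    · simp at hh; linarith
  have a2 : Real.pi / 2 < Complex.arg (w₁ * -Complex.I) := by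
    by_contra hcon
    rcases Complex.arg_le_pi_div_two_iff.mp (not_lt.mp hcon) with hh | hh
    · simp at hh; linarith
    · simp at hh; linarith
  have a3 := Complex.abs_arg_lt_pi_div_two_iff.mpr (Or.inl (by simpa using h2') :
    0 < (w₂ * Complex.I).re ∨ w₂ * Complex.I = 0)
  have a4 := Complex.abs_arg_lt_pi_div_two_iff.mpr (Or.inl (by simpa using h1') :
    0 < (w₁ * Complex.I).re ∨ w₁ * Complex.I = 0)
  have a3 := abs_lt.mp a3
  have a4 := abs_lt.mp a4
  linarith

theorem wind_ref_ne {M : TorusMetric} {τ r : ℝ} (hτ : 0 ≤ τ) (hr : r ≤ 1) {N μ L : ℕ}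
    (hN : 0 < N) (hμ : 0 < μ) (hL : 0 < L) {p : ℝ × ℝ} {σ σ' : ℕ → Bool} {P P' : ℕ → Ph}
    (h : OrbitChain M τ r ((N : ℝ) / 8) (refV N μ (μ * L) p σ) P)
    (h' : OrbitChain M τ r ((N : ℝ) / 8) (refV N μ (μ * L) p σ') P') {b n : ℕ} (hb : b < n)
    (hσ : σ b ≠ σ' b) {k : ℤ × ℤ}
    (hk1 : (L : ℤ) * b ≤ k.1) (hk2 : k.1 < (L : ℤ) * (b + 1)) (hk3 : 0 ≤ k.2) (hk4 : k.2 < L) :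
    ∑ j ∈ Finset.range (3 * (μ * L) * n), wind M τ (p + lat ((N : ℤ) • k)) (P j) ≠
    ∑ j ∈ Finset.range (3 * (μ * L) * n), wind M τ (p + lat ((N : ℤ) • k)) (P' j) := by
  have hN' : (0 : ℝ) < N := by exact_mod_cast hN
  have hk1' : (L : ℝ) * b ≤ k.1 := by exact_mod_cast hk1
  have hk2' : (k.1 : ℝ) + 1 ≤ L * (b + 1) := by exact_mod_cast hk2
  have hk3' : (0 : ℝ) ≤ k.2 := by exact_mod_cast hk3
  have hne := log_turn_ne (w₁ := cornerC N L b k) (w₂ := cornerC N L (b + 1) k)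
    (by simp only [cornerC]; nlinarith) (by simp only [cornerC]; nlinarith)
    (by simp only [cornerC]; push_cast; nlinarith) (by simp only [cornerC]; nlinarith)
  intro heq
  cases hs : σ b <;> cases hs' : σ' b
  · simp [hs, hs'] at hσ
  · rw [h.total_wind hτ hr hN hμ hL hb hk1 hk2 hk3 hk4 (Or.inr ⟨hs, rfl⟩),
      h'.total_wind hτ hr hN hμ hL hb hk1 hk2 hk3 hk4 (Or.inl ⟨hs', rfl⟩)] at heq
    exact hne (add_left_cancel (add_right_cancel heq)).symm
  · rw [h.total_wind hτ hr hN hμ hL hb hk1 hk2 hk3 hk4 (Or.inl ⟨hs, rfl⟩),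
      h'.total_wind hτ hr hN hμ hL hb hk1 hk2 hk3 hk4 (Or.inr ⟨hs', rfl⟩)] at heq
    exact hne (add_left_cancel (add_right_cancel heq))
  · simp [hs, hs'] at hσ

/-! ### Close broken orbits have equal windings -/

theorem wind_sub_of_close (M : TorusMetric) {τ : ℝ} (hτ : 0 ≤ τ) {p : ℝ × ℝ} {z z' : Ph}
    (hz : ham M z ≤ 1) (hz' : ham M z' ≤ 1)
    (h : ∀ t ∈ Icc 0 τ, ‖toC (pos M t z' - pos M t z)‖ < ‖toC (pos M t z - p)‖) :
    wind M τ p z' - wind M τ p z =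
      Complex.log (toC (pos M τ z' - p) / toC (pos M τ z - p)) -
        Complex.log (toC (z'.1 - p) / toC (z.1 - p)) := by
  have hd : ∀ z, ham M z ≤ 1 → ∀ t, HasDerivAt (fun t => toC (pos M t z - p))
      (toC (vel M (flow M t z).1 (flow M t z).2)) t := fun z hz t =>
    toC.hasFDerivAt.comp_hasDerivAt t ((pos_deriv M hz t).sub_const p)
  have hc : ∀ z, Continuous fun t => toC (vel M (flow M t z).1 (flow M t z).2) := fun z =>
    toC.continuous.comp (vel_flow_continuous M z)
  have hc' : ∀ z, Continuous fun t => toC (pos M t z - p) := fun z =>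
    toC.continuous.comp ((pos_smooth M z).continuous.sub continuous_const)
  have hne : ∀ t ∈ Icc 0 τ, toC (pos M t z - p) ≠ 0 := fun t ht h0 => by
    have := h t ht
    rw [h0, norm_zero] at this
    exact absurd this (norm_nonneg _).not_gt
  have hsplit : ∀ t, toC (pos M t z' - p) = toC (pos M t z' - pos M t z) + toC (pos M t z - p) :=
    fun t => by rw [← map_add]; congr 1; abel
  have hne' : ∀ t ∈ Icc 0 τ, toC (pos M t z' - p) ≠ 0 := fun t ht h0 => by
    have := h t ht
    rw [hsplit, add_eq_zero_iff_eq_neg] at h0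
    rw [h0, norm_neg] at this
    exact lt_irrefl _ this
  have hslit : ∀ t ∈ Icc 0 τ, toC (pos M t z' - p) / toC (pos M t z - p) ∈ Complex.slitPlane := by
    intro t ht
    rw [hsplit, add_div, div_self (hne t ht), add_comm]
    apply Complex.mem_slitPlane_of_norm_lt_one
    rw [norm_div, div_lt_one (norm_pos_iff.mpr (hne t ht))]
    exact h t ht
  have h_int : ∀ z, (∀ t ∈ Icc 0 τ, toC (pos M t z - p) ≠ 0) → IntervalIntegrable
      (fun t => toC (vel M (flow M t z).1 (flow M t z).2) / toC (pos M t z - p))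
      MeasureTheory.volume 0 τ := fun z hz => ContinuousOn.intervalIntegrable (by
      rw [uIcc_of_le hτ]
      exact (hc z).continuousOn.div (hc' z).continuousOn hz)
  rw [wind, wind, ← intervalIntegral.integral_sub (h_int z' hne') (h_int z hne)]
  have := intervalIntegral.integral_eq_sub_of_hasDerivAt (a := 0) (b := τ)
    (f := fun t => Complex.log (toC (pos M t z' - p) / toC (pos M t z - p)))
    (f' := fun t => toC (vel M (flow M t z').1 (flow M t z').2) / toC (pos M t z' - p) -
      toC (vel M (flow M t z).1 (flow M t z).2) / toC (pos M t z - p))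
    (fun t ht => by
      rw [uIcc_of_le hτ] at ht
      have h1 := hne t ht
      have h2 := hne' t ht
      have h3 := ((hd z' hz' t).fun_div (hd z hz t) h1).clog_real (hslit t ht)
      refine h3.congr_deriv ?_
      field_simp)
    ((h_int z' hne').sub (h_int z hne))
  rw [this, pos_zero, pos_zero]

theorem wind_eq_of_close {ι : Type} {M : TorusMetric} {τ r : ℝ} (hτ : 0 ≤ τ) (hr : r ≤ 1) {ob : ι → Ph}
    {A B : ℝ × ℝ} {K : ℕ} {P P' : ℕ → Ph} (hP : IsBroken M τ r ob A B K P)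
    (hP' : IsBroken M τ r ob A B K P') {p : ℝ × ℝ}
    (h : ∀ i < K, ∀ t ∈ Icc 0 τ,
      ‖toC (pos M t (P' i) - pos M t (P i))‖ < ‖toC (pos M t (P i) - p)‖) :
    ∑ i ∈ Finset.range K, wind M τ p (P' i) = ∑ i ∈ Finset.range K, wind M τ p (P i) := by
  rcases Nat.eq_zero_or_pos K with rfl | hK
  · simp
  have hne : ∀ i < K, ∀ t ∈ Icc 0 τ, toC (pos M t (P i) - p) ≠ 0 := fun i hi t ht h0 => by
    have := h i hi t ht
    rw [h0, norm_zero] at this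
    exact absurd this (norm_nonneg _).not_gt
  set F : ℕ → ℂ := fun i => if i < K then
    Complex.log (toC ((P' i).1 - p) / toC ((P i).1 - p)) else 0 with hF
  have hstep : ∀ i ∈ Finset.range K, wind M τ p (P' i) - wind M τ p (P i) = F (i + 1) - F i := by
    intro i hi
    have hi := Finset.mem_range.mp hi
    rw [wind_sub_of_close M hτ ((hP.energy i hi).trans hr) ((hP'.energy i hi).trans hr) (h i hi)]
    simp only [hF, if_pos hi]
    congr 1
    by_cases h1 : i + 1 < K
    · rw [if_pos h1, hP.link i h1, hP'.link i h1]
    · have h2 : i + 1 = K := by omega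
      have := hne i hi τ (right_mem_Icc.mpr hτ)
      rw [if_neg h1, hP'.finish i h2, hP.finish i h2]
      rw [hP.finish i h2] at this
      rw [div_self this, Complex.log_one]
  have h0 := hne 0 hK 0 (left_mem_Icc.mpr hτ)
  rw [pos_zero] at h0
  have := Finset.sum_range_sub F K
  rw [← Finset.sum_congr rfl hstep, Finset.sum_sub_distrib] at this
  have e1 : F K = 0 := by simp [hF]
  have e2 : F 0 = 0 := by
    simp only [hF, if_pos hK]
    rw [hP'.start, ← hP.start, div_self h0, Complex.log_one]
  rw [e1, e2, sub_zero, sub_eq_zero] at this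
  exact this

/-- `z` is a limit of broken orbits with the same windings as `P₀`. -/
def IsWindLimit {ι : Type} (M : TorusMetric) (τ r : ℝ) (ob : ι → Ph) (A B : ℝ × ℝ) (K : ℕ)
    (P₀ : ℕ → Ph) (z : Ph) : Prop :=
  ∀ ε, 0 < ε → ∃ P, IsBroken M τ r ob A B K P ∧
    (∀ k, ∑ j ∈ Finset.range K, wind M τ (ob k).1 (P j) =
      ∑ j ∈ Finset.range K, wind M τ (ob k).1 (P₀ j)) ∧
    ∀ i < K, ‖P i - flow M (i * τ) z‖ ≤ ε

theorem visits_of_close {ι : Type} {M : TorusMetric} {τ r : ℝ} (hτ : 0 < τ) (hr : r ≤ 1) {ob : ι → Ph}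
    {A B : ℝ × ℝ} {K : ℕ} {P P' : ℕ → Ph} {z z' : Ph} (hz : IsWindLimit M τ r ob A B K P z)
    (hz' : IsWindLimit M τ r ob A B K P' z') {η ε : ℝ} (hε : 0 < ε)
    (hclose : ∀ s ∈ Icc 0 (K * τ), ‖pos M s z - pos M s z'‖ ≤ η) {k : ι}
    (hk : ∑ j ∈ Finset.range K, wind M τ (ob k).1 (P j) ≠
      ∑ j ∈ Finset.range K, wind M τ (ob k).1 (P' j)) :
    ∃ s ∈ Icc 0 (K * τ), ‖pos M s z - (ob k).1‖ ≤ 2 * η + 5 * ε := by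
  by_contra! hfar
  apply hk
  set X := Real.exp (flowK M * τ) with hX
  have hX0 : 0 < X := Real.exp_pos _
  obtain ⟨Q, hQ, hQw, hQz⟩ := hz (ε / X) (by positivity)
  obtain ⟨Q', hQ', hQw', hQz'⟩ := hz' (ε / X) (by positivity)
  have near : ∀ (y w : Ph) (i : ℕ), ‖y - flow M (i * τ) w‖ ≤ ε / X → ∀ t ∈ Icc 0 τ,
      ‖pos M t y - pos M (i * τ + t) w‖ ≤ ε := by
    intro y w i hy t ht
    have h1 := flow_lip M t y (flow M (i * τ) w)
    rw [← flow_add, abs_of_nonneg ht.1, add_comm t] at h1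
    have h2 : Real.exp (flowK M * t) ≤ X :=
      Real.exp_le_exp.mpr (mul_le_mul_of_nonneg_left ht.2 (flowK M).2)
    calc ‖pos M t y - pos M (i * τ + t) w‖ ≤ _ := (_root_.norm_fst_le _).trans h1
      _ ≤ X * (ε / X) := mul_le_mul h2 hy (norm_nonneg _) hX0.le
      _ = ε := by field_simp
  rw [← hQw, ← hQw']
  refine (wind_eq_of_close hτ.le hr hQ hQ' fun i hi t ht => ?_).symm
  have hmem : (i : ℝ) * τ + t ∈ Icc 0 (K * τ) := by
    have : (i : ℝ) + 1 ≤ K := by exact_mod_cast hi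
    exact ⟨by have := ht.1; positivity, by nlinarith [ht.2]⟩
  have a1 := near _ _ i (hQz i hi) t ht
  have a2 := near _ _ i (hQz' i hi) t ht
  have a3 := hclose _ hmem
  have a4 := hfar _ hmem
  set x := pos M t (Q i)
  set x' := pos M t (Q' i)
  set w := pos M (i * τ + t) z
  set w' := pos M (i * τ + t) z'
  have b1 : ‖x' - x‖ ≤ η + 2 * ε := by
    have e : x' - x = (x' - w') - (w - w') - (x - w) := by abel
    rw [e]
    linarith [norm_sub_le ((x' - w') - (w - w')) (x - w), norm_sub_le (x' - w') (w - w')]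
  have b2 : 2 * η + 4 * ε < ‖x - (ob k).1‖ := by
    have e : w - (ob k).1 = (x - (ob k).1) - (x - w) := by abel
    rw [e] at a4
    linarith [norm_sub_le (x - (ob k).1) (x - w)]
  calc ‖toC (x' - x)‖ ≤ 2 * ‖x' - x‖ := norm_toC_le _
    _ < ‖x - (ob k).1‖ := by linarith
    _ ≤ _ := le_norm_toC _

/-! ### Unit speed parametrization and separation -/

theorem exists_vel_bound (M : TorusMetric) : ∃ C : ℝ, 0 < C ∧ ∀ z, ham M z ≤ 1 →
    ‖vel M z.1 z.2‖ ≤ C := by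
  obtain ⟨c, hc, h⟩ := g_lower M
  refine ⟨1 + 2 / c, by positivity, fun z hz => ?_⟩
  have h1 := h z.1 (vel M z.1 z.2)
  rw [g_vel] at h1
  have h2 : ‖vel M z.1 z.2‖ ^ 2 ≤ 2 / c := by
    rw [le_div_iff₀ hc]
    change c * ‖vel M z.1 z.2‖ ^ 2 ≤ 2 * ham M z at h1
    linarith
  have : 0 < 2 / c := by positivity
  nlinarith [sq_nonneg (‖vel M z.1 z.2‖ - 1)]

/-- The unit speed reparametrization of the orbit of `z`. -/
def unitSpeed (M : TorusMetric) (z : Ph) : Ph := scal (√(2 * ham M z))⁻¹ z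

theorem ham_unitSpeed {M : TorusMetric} {z : Ph} (h : 0 < ham M z) : ham M (unitSpeed M z) = 1 / 2 := by
  rw [unitSpeed, ham_scal, inv_pow, Real.sq_sqrt (by positivity)]
  field_simp

theorem pos_eq_unitSpeed {M : TorusMetric} {z : Ph} (h : 0 < ham M z) (h1 : ham M z ≤ 1) (s : ℝ) :
    pos M s z = pos M (√(2 * ham M z) * s) (unitSpeed M z) := by
  rw [unitSpeed, pos_scal M h1 (by rw [← unitSpeed, ham_unitSpeed h]; norm_num)]
  congr 1
  have : √(2 * ham M z) ≠ 0 := by positivity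
  field_simp

theorem ham_pos_of_pos_ne {M : TorusMetric} {z : Ph} {t : ℝ} (h : pos M t z ≠ z.1) : 0 < ham M z := by
  rcases (ham_nonneg M z).lt_or_eq with h1 | h1
  · exact h1
  exfalso
  obtain ⟨c, hc, hl⟩ := ham_lower M
  have h2 : c * ‖z.2‖ ^ 2 ≤ ham M z := hl z.1 z.2
  have h3 : z.2 = 0 := by
    rw [← norm_eq_zero]
    have : ‖z.2‖ ^ 2 ≤ 0 := by
      by_contra! hcon
      nlinarith [mul_pos hc hcon]
    exact pow_eq_zero_iff (two_ne_zero) |>.mp (le_antisymm this (sq_nonneg _))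
  have h4 : scal 0 z = z := Prod.ext rfl (by simp [scal, h3])
  apply h
  have h5 : ham M z ≤ 1 := by rw [← h1]; norm_num
  rw [← h4, pos_scal M h5 (by rwa [h4]), zero_mul, pos_zero, h4]

theorem norm_le_norm2 (p : ℝ × ℝ) : ‖p‖ ≤ norm2 p := by
  rw [Prod.norm_def]
  exact max_le (Real.abs_le_sqrt (by nlinarith [sq_nonneg p.2]))
    (Real.abs_le_sqrt (by nlinarith [sq_nonneg p.1]))

theorem norm_lat (k : ℤ × ℤ) : ‖lat k‖ = ((max |k.1| |k.2| : ℤ) : ℝ) := by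
  simp [lat, Prod.norm_def]

theorem exists_norm_lt_of_phaseDist {p q : Ph} {ε : ℝ} (h : phaseDist p q < ε) :
    ∃ k : ℤ × ℤ, ‖p.1 - (q.1 + lat k)‖ < ε := by
  obtain ⟨_, ⟨k, rfl⟩, hk⟩ := exists_lt_of_csInf_lt
    (s := {r : ℝ | ∃ k : ℤ × ℤ, r = norm2 (p.1 - (q.1 + lat k)) + norm2 (p.2 - q.2)}) ⟨_, 0, rfl⟩ h
  exact ⟨k, ((norm_le_norm2 _).trans (le_add_of_nonneg_right (Real.sqrt_nonneg _))).trans_lt hk⟩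

theorem phaseDist_comm (p q : Ph) : phaseDist p q = phaseDist q p := by
  have key : ∀ p q : Ph, {r : ℝ | ∃ k : ℤ × ℤ, r = norm2 (p.1 - (q.1 + lat k)) + norm2 (p.2 - q.2)} ⊆
      {r : ℝ | ∃ k : ℤ × ℤ, r = norm2 (q.1 - (p.1 + lat k)) + norm2 (q.2 - p.2)} := by
    rintro p q _ ⟨k, rfl⟩
    refine ⟨-k, ?_⟩
    simp only [norm2, lat, Prod.fst_sub, Prod.snd_sub, Prod.fst_add, Prod.snd_add, Prod.fst_neg,
      Prod.snd_neg]
    push_cast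
    congr 2 <;> ring
  rw [phaseDist, phaseDist, (key p q).antisymm (key q p)]

theorem phaseDist_self (p : Ph) : phaseDist p p ≤ 0 :=
  csInf_le ⟨0, by rintro _ ⟨k, rfl⟩; exact add_nonneg (Real.sqrt_nonneg _) (Real.sqrt_nonneg _)⟩
    ⟨0, by simp [norm2, lat]⟩

theorem norm_sub_lt_of_phaseDist {f f' : ℝ → ℝ × ℝ} {v v' : ℝ → ℝ × ℝ} (hf : Continuous f)
    (hf' : Continuous f') (h0 : f 0 = f' 0) {ε T : ℝ} (hε : 0 < ε) (hε8 : ε ≤ 1 / 8)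
    (h : ∀ t ∈ Icc 0 T, phaseDist (f t, v t) (f' t, v' t) ≤ ε) :
    ∀ t ∈ Icc 0 T, ‖f t - f' t‖ < 2 * ε := by
  have hdich : ∀ t ∈ Icc 0 T, ‖f t - f' t‖ < 2 * ε ∨ 1 / 2 < ‖f t - f' t‖ := by
    intro t ht
    obtain ⟨k, hk⟩ := exists_norm_lt_of_phaseDist ((h t ht).trans_lt (by linarith : ε < 2 * ε))
    change ‖f t - (f' t + lat k)‖ < 2 * ε at hk
    rcases le_or_gt (max |k.1| |k.2|) 0 with hl | hl
    · have : ‖lat k‖ ≤ 0 := by rw [norm_lat]; exact_mod_cast hl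
      rw [norm_le_zero_iff.mp this, add_zero] at hk
      exact Or.inl hk
    · right
      have h1 : 1 ≤ ‖lat k‖ := by rw [norm_lat]; exact_mod_cast hl
      have e : lat k = (f t - f' t) - (f t - (f' t + lat k)) := by abel
      have := norm_sub_le (f t - f' t) (f t - (f' t + lat k))
      rw [← e] at this
      linarith
  intro t ht
  rcases hdich t ht with h1 | h1
  · exact h1
  · exfalso
    have hcont : ContinuousOn (fun t => ‖f t - f' t‖) (Icc 0 t) := (hf.sub hf').norm.continuousOn
    obtain ⟨s, hs, hs2⟩ := intermediate_value_Icc ht.1 hcont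
      (show (1 / 2 : ℝ) ∈ Icc _ _ from ⟨by simp [h0], h1.le⟩)
    simp only at hs2
    rcases hdich s ⟨hs.1, hs.2.trans ht.2⟩ with h3 | h3 <;> linarith

theorem norm_sub_le_of_not_separated {M : TorusMetric} {C : ℝ} (hC : ∀ z, ham M z ≤ 1 →
    ‖vel M z.1 z.2‖ ≤ C) {z z' : Ph} (h : 0 < ham M z) (h' : 0 < ham M z') (h1 : ham M z ≤ 1 / 2)
    (h1' : ham M z' ≤ 1 / 2) (hA : z.1 = z'.1) {ε S : ℝ} (hS : 0 < S) (hε : 0 < ε)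
    (hε8 : ε ≤ 1 / 8)
    (hℓ : |√(2 * ham M z) * S - √(2 * ham M z') * S| ≤ ε)
    (hsep : ∀ t ∈ Icc 0 S, phaseDist (pos M t (unitSpeed M z), deriv (fun t => pos M t (unitSpeed M z)) t)
      (pos M t (unitSpeed M z'), deriv (fun t => pos M t (unitSpeed M z')) t) ≤ ε) :
    ∀ s ∈ Icc 0 S, ‖pos M s z - pos M s z'‖ ≤ (2 + C) * ε := by
  intro s hs
  set e := √(2 * ham M z) with he
  set e' := √(2 * ham M z') with he'
  have he0 : 0 ≤ e := Real.sqrt_nonneg _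
  have he1 : e ≤ 1 := Real.sqrt_le_one.mpr (by linarith)
  have hC0 : 0 ≤ C := (norm_nonneg _).trans (hC z (by linarith))
  have k1 := norm_sub_lt_of_phaseDist (f := fun t => pos M t (unitSpeed M z))
    (f' := fun t => pos M t (unitSpeed M z')) (pos_smooth M _).continuous
    (pos_smooth M _).continuous (by simp only [pos_zero]; exact hA) hε hε8 hsep (e * s)
    ⟨mul_nonneg he0 hs.1, by nlinarith [hs.1, hs.2]⟩
  have k2 := pos_lip M (z := unitSpeed M z') (v := C) (by rw [ham_unitSpeed h']; norm_num)
    (fun t => hC _ (by rw [ham_flow, ham_unitSpeed h']; norm_num)) (e * s) (e' * s)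
  have k3 : |e * s - e' * s| ≤ ε := by
    refine le_trans ?_ hℓ
    rw [← sub_mul, ← sub_mul, abs_mul, abs_mul, abs_of_nonneg hs.1, abs_of_pos hS]
    exact mul_le_mul_of_nonneg_left hs.2 (abs_nonneg _)
  rw [pos_eq_unitSpeed h (by linarith), pos_eq_unitSpeed h' (by linarith)]
  have k4 := norm_sub_le_norm_sub_add_norm_sub (pos M (e * s) (unitSpeed M z))
    (pos M (e * s) (unitSpeed M z')) (pos M (e' * s) (unitSpeed M z'))
  have k5 : C * |e * s - e' * s| ≤ C * ε := mul_le_mul_of_nonneg_left k3 hC0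
  linarith

/-! ### Counting visited obstacles -/

/-- The index of an obstacle in block `b`. -/
def blockIdx (L b i j : ℕ) : ℤ × ℤ := ((L * b + i : ℕ), (j : ℕ))

theorem card_visited_le {M : TorusMetric} {C τ : ℝ} (hτ : 0 < τ)
    (hC : ∀ z, ham M z ≤ 1 → ‖vel M z.1 z.2‖ ≤ C) {N L K : ℕ} (hN : 0 < N) (hCN : C * τ ≤ N / 8)
    {p : ℝ × ℝ} {z : Ph} (hz : ham M z ≤ 1) {ε₁ : ℝ} (hε₁ : ε₁ ≤ N / 8) (V : Finset ℕ)
    (hV : ∀ b ∈ V, ∀ i < L, ∀ j < L, ∃ s ∈ Icc 0 (K * τ),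
      ‖pos M s z - (p + lat ((N : ℤ) • blockIdx L b i j))‖ ≤ ε₁) :
    V.card * (L * L) ≤ K + 1 := by
  have hV' : ∀ x : ℕ × ℕ × ℕ, ∃ s, x.1 ∈ V → x.2.1 < L → x.2.2 < L → s ∈ Icc 0 (K * τ) ∧
      ‖pos M s z - (p + lat ((N : ℤ) • blockIdx L x.1 x.2.1 x.2.2))‖ ≤ ε₁ := by
    intro x
    by_cases hx : x.1 ∈ V ∧ x.2.1 < L ∧ x.2.2 < L
    · obtain ⟨s, h1, h2⟩ := hV _ hx.1 _ hx.2.1 _ hx.2.2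
      exact ⟨s, fun _ _ _ => ⟨h1, h2⟩⟩
    · exact ⟨0, fun h1 h2 h3 => absurd ⟨h1, h2, h3⟩ hx⟩
  choose s hs using hV'
  have hcard : (V ×ˢ Finset.range L ×ˢ Finset.range L).card ≤ (Finset.range (K + 1)).card := by
    refine Finset.card_le_card_of_injOn (fun x => ⌊s x / τ⌋₊) ?_ ?_
    · rintro x hx
      simp only [Finset.coe_product, Finset.coe_range, Set.mem_prod, Finset.mem_coe, Set.mem_Iio] at hx
      have h1 := (hs x hx.1 hx.2.1 hx.2.2).1
      simp only [Finset.coe_range, Set.mem_Iio]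
      rw [Nat.lt_succ_iff]
      refine Nat.floor_le_of_le ?_
      rw [div_le_iff₀ hτ]; exact h1.2
    · rintro x hx y hy hxy
      simp only [Finset.coe_product, Finset.coe_range, Set.mem_prod, Finset.mem_coe, Set.mem_Iio] at hx hy
      obtain ⟨x1, x2⟩ := hs x hx.1 hx.2.1 hx.2.2
      obtain ⟨y1, y2⟩ := hs y hy.1 hy.2.1 hy.2.2
      have hst : |s x - s y| ≤ τ := by
        have a1 := Nat.floor_le (div_nonneg x1.1 hτ.le)
        have a2 := Nat.lt_floor_add_one (s x / τ)
        have b1 := Nat.floor_le (div_nonneg y1.1 hτ.le)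
        have b2 := Nat.lt_floor_add_one (s y / τ)
        simp only at hxy
        rw [hxy] at a1 a2
        have : |s x / τ - s y / τ| ≤ 1 := abs_le.mpr ⟨by linarith, by linarith⟩
        rwa [← sub_div, abs_div, abs_of_pos hτ, div_le_one hτ] at this
      have hl := pos_lip M hz (v := C) (fun t => hC _ (by rwa [ham_flow])) (s x) (s y)
      have hC0 : 0 ≤ C := (norm_nonneg _).trans (hC z hz)
      have hl' : C * |s x - s y| ≤ N / 8 := (mul_le_mul_of_nonneg_left hst hC0).trans hCN
      set k : ℤ × ℤ := blockIdx L x.1 x.2.1 x.2.2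
      set k' : ℤ × ℤ := blockIdx L y.1 y.2.1 y.2.2
      have hN' : (0 : ℝ) < N := by exact_mod_cast hN
      have hkk : k = k' := by
        have h1 : ‖lat ((N : ℤ) • k) - lat ((N : ℤ) • k')‖ < N := by
          have e : lat ((N : ℤ) • k) - lat ((N : ℤ) • k') =
              (pos M (s x) z - pos M (s y) z) - (pos M (s x) z - (p + lat ((N : ℤ) • k))) +
                (pos M (s y) z - (p + lat ((N : ℤ) • k'))) := by abel
          rw [e]
          have m1 := norm_add_le ((pos M (s x) z - pos M (s y) z) -
            (pos M (s x) z - (p + lat ((N : ℤ) • k)))) (pos M (s y) z - (p + lat ((N : ℤ) • k')))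
          have m2 := norm_sub_le (pos M (s x) z - pos M (s y) z)
            (pos M (s x) z - (p + lat ((N : ℤ) • k)))
          linarith
        have h2 : ∀ a b : ℤ, |(N : ℝ) * a - N * b| < N → a = b := fun a b hab => by
          rw [← mul_sub, abs_mul, abs_of_pos hN'] at hab
          have : |(a : ℝ) - b| < 1 := by nlinarith
          have : |a - b| < 1 := by exact_mod_cast this
          have := abs_lt.mp this
          omega
        refine Prod.ext (h2 _ _ ?_) (h2 _ _ ?_)
        · refine lt_of_le_of_lt (le_of_eq ?_) ((_root_.norm_fst_le _).trans_lt h1)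
          simp [lat]
        · refine lt_of_le_of_lt (le_of_eq ?_) ((_root_.norm_snd_le _).trans_lt h1)
          simp [lat]
      have e1 : L * x.1 + x.2.1 = L * y.1 + y.2.1 := by
        have := congrArg Prod.fst hkk
        simp only [k, k', blockIdx] at this
        exact_mod_cast this
      have e2 : x.2.2 = y.2.2 := by
        have := congrArg Prod.snd hkk
        simp only [k, k', blockIdx] at this
        exact_mod_cast this
      have hL : 0 < L := by omega
      have e3 : x.1 = y.1 := by
        have := congrArg (· / L) e1
        simpa [Nat.mul_add_div hL, Nat.div_eq_of_lt hx.2.1, Nat.div_eq_of_lt hy.2.1] using this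
      have e4 : x.2.1 = y.2.1 := by rw [e3] at e1; omega
      exact Prod.ext e3 (Prod.ext e4 e2)
  simpa [Finset.card_product] using hcard

/-! ### Large separated families of codes -/

theorem card_agree_off_le {ι : Type} [Fintype ι] [DecidableEq ι] (B : Finset ι) (σ : ι → Bool) :
    (Finset.univ.filter fun σ' : ι → Bool => ∀ b, σ b ≠ σ' b → b ∈ B).card ≤ 2 ^ B.card := by
  rw [← Finset.card_powerset]
  refine Finset.card_le_card_of_injOn (fun σ' => B.filter fun b => σ' b = true) ?_ ?_
  · intro σ' _
    exact Finset.mem_coe.mpr (Finset.mem_powerset.mpr (Finset.filter_subset _ _))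
  · intro σ₁ h1 σ₂ h2 h
    simp only [Finset.coe_filter, Finset.mem_univ, true_and, Set.mem_ofPred_eq] at h1 h2
    funext b
    by_cases hb : b ∈ B
    · have := congrArg (b ∈ ·) h
      simp only [Finset.mem_filter, hb, true_and, eq_iff_iff] at this
      exact Bool.eq_iff_iff.mpr this
    · have e1 : σ b = σ₁ b := by_contra fun hn => hb (h1 b hn)
      have e2 : σ b = σ₂ b := by_contra fun hn => hb (h2 b hn)
      exact e1.symm.trans e2

/-- A maximal separated subset of a finite set is large if the set of elements not separated from
any given element is small. -/
theorem exists_separated_of_card {α : Type} (S : Finset α) {sep : α → α → Prop}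
    (hsymm : ∀ a b, sep a b → sep b a) {n : ℕ} (near : α → Finset α)
    (hnear : ∀ a, (near a).card ≤ n) (hself : ∀ a, a ∈ near a)
    (h : ∀ a ∈ S, ∀ b ∈ S, ¬ sep a b → b ∈ near a) :
    ∃ F : Finset α, S.card ≤ F.card * n ∧ ∀ a ∈ F, ∀ b ∈ F, a ≠ b → sep a b := by
  classical
  obtain ⟨good, hgood⟩ : ∃ good : Finset α → Prop,
      ∀ F, good F ↔ ∀ a ∈ F, ∀ b ∈ F, a ≠ b → sep a b := ⟨_, fun _ => Iff.rfl⟩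
  obtain ⟨F, hF, hmax⟩ := Finset.exists_max_image (S.powerset.filter good) Finset.card
    ⟨∅, by simp [hgood]⟩
  rw [Finset.mem_filter, Finset.mem_powerset, hgood] at hF
  refine ⟨F, ?_, hF.2⟩
  have hcover : S ⊆ F.biUnion near := by
    intro x hx
    rw [Finset.mem_biUnion]
    by_cases hmem : x ∈ F
    · exact ⟨x, hmem, hself x⟩
    by_contra! hcon
    have hsep : ∀ a ∈ F, sep a x := fun a ha =>
      by_contra fun hns => hcon a ha (h a (hF.1 ha) x hx hns)
    have := hmax (insert x F) (by
      rw [Finset.mem_filter, Finset.mem_powerset, hgood]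
      refine ⟨Finset.insert_subset hx hF.1, ?_⟩
      intro a ha b hb hab
      rcases Finset.mem_insert.mp ha with ha | ha <;> rcases Finset.mem_insert.mp hb with hb | hb
      · exact absurd (ha.trans hb.symm) hab
      · rw [ha]
        exact hsymm _ _ (hsep b hb)
      · rw [hb]
        exact hsep a ha
      · exact hF.2 a ha b hb hab)
    rw [Finset.card_insert_of_notMem hmem] at this
    omega
  exact (Finset.card_le_card hcover).trans (Finset.card_biUnion_le_card_mul _ _ _ fun a _ => hnear a)

theorem exists_large_separated {m D : ℕ} (hD : D ≤ 2 ^ (6 * m))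
    {sep : (Fin (8 * m) → Bool) → (Fin (8 * m) → Bool) → Prop} (hsymm : ∀ σ σ', sep σ σ' → sep σ' σ)
    {bucket : (Fin (8 * m) → Bool) → ℕ} (hbk : ∀ σ, bucket σ < D)
    {Bad : (Fin (8 * m) → Bool) → Finset (Fin (8 * m))} (hBad : ∀ σ, (Bad σ).card ≤ m)
    (h : ∀ σ σ', bucket σ = bucket σ' → ¬ sep σ σ' → ∀ b, σ b ≠ σ' b → b ∈ Bad σ) :
    ∃ F : Finset (Fin (8 * m) → Bool), 2 ^ m ≤ F.card ∧
      ∀ σ ∈ F, ∀ σ' ∈ F, σ ≠ σ' → sep σ σ' := by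
  obtain ⟨y, -, hy⟩ := Finset.exists_le_card_fiber_of_mul_le_card_of_maps_to
    (s := (Finset.univ : Finset (Fin (8 * m) → Bool))) (t := Finset.range D) (f := bucket)
    (n := 2 ^ (2 * m)) (fun σ _ => Finset.mem_range.mpr (hbk σ))
    ⟨bucket fun _ => true, Finset.mem_range.mpr (hbk _)⟩ (by
      rw [Finset.card_range, Finset.card_univ, Fintype.card_fun, Fintype.card_bool, Fintype.card_fin,
        show 8 * m = 6 * m + 2 * m by ring, pow_add]
      exact Nat.mul_le_mul_right _ hD)
  obtain ⟨F, hF, hFsep⟩ := exists_separated_of_card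
    (Finset.univ.filter fun σ => bucket σ = y) hsymm (n := 2 ^ m)
    (fun σ => Finset.univ.filter fun σ' => ∀ b, σ b ≠ σ' b → b ∈ Bad σ)
    (fun σ => le_trans (congrArg Finset.card (by ext; simp only [Finset.mem_filter])).le
      ((card_agree_off_le (Bad σ) σ).trans (Nat.pow_le_pow_right Nat.two_pos (hBad σ))))
    (fun σ => by
      rw [Finset.mem_filter]
      exact ⟨Finset.mem_univ _, fun b hb => absurd rfl hb⟩)
    (fun σ hσ σ' hσ' hns => by
      rw [Finset.mem_filter] at hσ hσ' ⊢
      exact ⟨Finset.mem_univ _, h σ σ' (hσ.2.trans hσ'.2.symm) hns⟩)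
  refine ⟨F, ?_, hFsep⟩
  have h2 : 2 ^ m * 2 ^ m ≤ F.card * 2 ^ m := by
    rw [← pow_add, ← two_mul]
    exact hy.trans hF
  exact Nat.le_of_mul_le_mul_right h2 (Nat.two_pow_pos m)

/-! ### Entropy from exponentially many separated orbits -/

theorem le_elog {x : ℝ≥0∞} {m : ℕ} (h : (2 : ℝ≥0∞) ^ m ≤ x) :
    ((m * Real.log 2 : ℝ) : EReal) ≤ elog x := by
  have hx0 : x ≠ 0 := fun h0 => by
    rw [h0] at h
    exact absurd h (by simp)
  rw [elog, if_neg hx0]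
  split_ifs with hx
  · exact le_top
  · rw [EReal.coe_le_coe_iff, ← Real.log_pow]
    refine Real.log_le_log (by positivity) ?_
    have := ENNReal.toReal_mono hx h
    simpa using this

theorem topEnt_pos {M : TorusMetric} {ε κ : ℝ} (hε : 0 < ε) (hκ : 0 < κ)
    (h : ∀ᶠ m : ℕ in atTop, (2 : ℝ≥0∞) ^ m ≤ sepCount M ε (κ * m)) : 0 < topEnt M := by
  have h1 : (0 : EReal) < ((Real.log 2 / κ : ℝ) : EReal) := by
    exact_mod_cast div_pos (Real.log_pos (by norm_num)) hκ
  refine h1.trans_le (le_trans ?_ (le_iSup₂ (f := fun (ε : ℝ) (_ : 0 < ε) =>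
    Filter.limsup (fun T : ℝ => ((T⁻¹ : ℝ) : EReal) * elog (sepCount M ε T)) Filter.atTop) ε hε))
  have htend : Tendsto (fun m : ℕ => κ * (m : ℝ)) atTop atTop :=
    (tendsto_natCast_atTop_atTop).const_mul_atTop hκ
  refine le_limsup_of_frequently_le ?_
  refine htend.frequently (Eventually.frequently ?_)
  filter_upwards [h, eventually_gt_atTop 0] with m hm hm0
  have hm0' : (0 : ℝ) < m := by exact_mod_cast hm0
  calc ((Real.log 2 / κ : ℝ) : EReal) = (((κ * m)⁻¹ : ℝ) : EReal) * ((m * Real.log 2 : ℝ) : EReal) := by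
        rw [← EReal.coe_mul]
        congr 1
        field_simp
    _ ≤ _ := mul_le_mul_of_nonneg_left (le_elog hm) (by exact_mod_cast (by positivity : 0 ≤ (κ * m)⁻¹))

/-! ### The main theorem -/

/-- Extension of a finite code by `false`. -/
def extCode {n : ℕ} (σ : Fin n → Bool) (b : ℕ) : Bool := if h : b < n then σ ⟨b, h⟩ else false

theorem extCode_val {n : ℕ} (σ : Fin n → Bool) (b : Fin n) : extCode σ b = σ b := by
  simp [extCode]

theorem refV_block_start {N μ m : ℕ} (hm : 0 < m) (p : ℝ × ℝ) (σ σ' : ℕ → Bool) (b : ℕ) :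
    refV N μ m p σ (3 * m * b) = refV N μ m p σ' (3 * m * b) := by
  simp only [refV, refY_start hm]

theorem refV_zero {N μ m : ℕ} (hm : 0 < m) (p : ℝ × ℝ) (σ σ' : ℕ → Bool) :
    refV N μ m p σ 0 = refV N μ m p σ' 0 := by
  have := refV_block_start (N := N) (μ := μ) hm p σ σ' 0
  rwa [mul_zero] at this

theorem refV_end_ne {N μ m n : ℕ} (hN : 0 < N) (hμ : 0 < μ) (hm : 0 < m) (hn : 0 < n) (p : ℝ × ℝ)
    (σ : ℕ → Bool) : refV N μ m p σ (3 * m * n) ≠ refV N μ m p σ 0 := by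
  have h0 := refX_start hm 0
  rw [mul_zero, mul_zero] at h0
  intro h
  have h1 := congrArg Prod.fst h
  simp only [refV, refX_start hm, h0] at h1
  have h2 : (0 : ℝ) < N / μ * (m * n : ℕ) := by positivity
  push_cast at h1 h2
  linarith

/-- Exponentially many separated orbits, given reference paths with limit orbits. -/
theorem sepCount_ge {M : TorusMetric} {τ r C ε : ℝ} (hτ : 0 < τ) (hr : r ≤ 1 / 8)
    (hC : ∀ z, ham M z ≤ 1 → ‖vel M z.1 z.2‖ ≤ C) {N μ : ℕ} (hN : 0 < N) (hμ : 0 < μ)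
    (hCN : C * τ ≤ N / 8) {ζ : Ph} (hε : 0 < ε) (hε8 : ε ≤ 1 / 8)
    (hεN : 2 * ((2 + C) * ε) + 5 * ε ≤ N / 8) {m : ℕ} (hm : 0 < m)
    (hmε : 3 * (μ * (48 * μ)) * 8 * τ / ε ≤ m)
    (hex : ∀ σ : ℕ → Bool, ∃ P z, OrbitChain M τ r ((N : ℝ) / 8) (refV N μ (μ * (48 * μ)) ζ.1 σ) P ∧
      ham M z ≤ r ∧ z.1 = refV N μ (μ * (48 * μ)) ζ.1 σ 0 ∧
      pos M ((3 * (μ * (48 * μ)) * (8 * m) : ℕ) * τ) z =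
        refV N μ (μ * (48 * μ)) ζ.1 σ (3 * (μ * (48 * μ)) * (8 * m)) ∧
      IsWindLimit M τ r (obst N ζ) (refV N μ (μ * (48 * μ)) ζ.1 σ 0)
        (refV N μ (μ * (48 * μ)) ζ.1 σ (3 * (μ * (48 * μ)) * (8 * m)))
        (3 * (μ * (48 * μ)) * (8 * m)) P z) :
    (2 : ℝ≥0∞) ^ m ≤ sepCount M ε (3 * (μ * (48 * μ)) * 8 * τ * m) := by
  classical
  set L := 48 * μ with hL
  have hL0 : 0 < L := by omega
  have hmm : 0 < μ * L := Nat.mul_pos hμ hL0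
  set K := 3 * (μ * L) * (8 * m) with hK
  have hK0 : 0 < K := by positivity
  have hT : (3 * (μ * (48 * μ)) * 8 * τ * m : ℝ) = K * τ := by
    rw [hK, hL]; push_cast; ring
  set S : ℝ := K * τ with hS
  have hS0 : 0 < S := by positivity
  choose P z hchain hzr hzA hzB hzlim using hex
  have hz1 : ∀ σ, ham M (z σ) ≤ 1 / 8 := fun σ => (hzr σ).trans hr
  have hzpos : ∀ σ, 0 < ham M (z σ) := fun σ => ham_pos_of_pos_ne (t := S) (by
    rw [hzA, hzB]
    exact refV_end_ne hN hμ hmm (by omega) _ _)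
  set c : (Fin (8 * m) → Bool) → ℝ → ℝ × ℝ := fun σ t => pos M t (unitSpeed M (z (extCode σ))) with hc
  set sep : (Fin (8 * m) → Bool) → (Fin (8 * m) → Bool) → Prop := fun σ σ' =>
    ∃ t ∈ Icc 0 S, ε < phaseDist (c σ t, deriv (c σ) t) (c σ' t, deriv (c σ') t) with hsep
  set bucket : (Fin (8 * m) → Bool) → ℕ := fun σ =>
    ⌊√(2 * ham M (z (extCode σ))) * S / ε⌋₊ with hbucket
  set Bad : (Fin (8 * m) → Bool) → Finset (Fin (8 * m)) := fun σ =>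
    Finset.univ.filter fun b => ∀ i < L, ∀ j < L, ∃ s ∈ Icc 0 S,
      ‖pos M s (z (extCode σ)) - (ζ.1 + lat ((N : ℤ) • blockIdx L b i j))‖ ≤
        2 * ((2 + C) * ε) + 5 * ε with hBadDef
  have hfam : ∃ F : Finset (Fin (8 * m) → Bool), 2 ^ m ≤ F.card ∧
      ∀ σ ∈ F, ∀ σ' ∈ F, σ ≠ σ' → sep σ σ' := by
    refine exists_large_separated (D := ⌊S / ε⌋₊ + 1) (bucket := bucket) (Bad := Bad) ?_ ?_ ?_ ?_ ?_
    · have h1 : S / ε ≤ (m * m : ℕ) := by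
        have : S / ε = 3 * (μ * (48 * μ)) * 8 * τ / ε * m := by rw [← hT]; ring
        rw [this]
        push_cast
        exact mul_le_mul_of_nonneg_right hmε (Nat.cast_nonneg m)
      have h2 : ⌊S / ε⌋₊ ≤ m * m := Nat.floor_le_of_le h1
      have h3 : m + 1 ≤ 2 ^ m := Nat.lt_two_pow_self
      calc ⌊S / ε⌋₊ + 1 ≤ (m + 1) * (m + 1) := by nlinarith
        _ ≤ 2 ^ m * 2 ^ m := Nat.mul_le_mul h3 h3
        _ = 2 ^ (2 * m) := by rw [← pow_add, two_mul]
        _ ≤ 2 ^ (6 * m) := Nat.pow_le_pow_right (by norm_num) (by omega)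
    · rintro σ σ' ⟨t, ht, h⟩
      exact ⟨t, ht, by rwa [phaseDist_comm]⟩
    · intro σ
      rw [Nat.lt_succ_iff]
      refine Nat.floor_le_floor ?_
      refine div_le_div_of_nonneg_right ?_ hε.le
      have : √(2 * ham M (z (extCode σ))) ≤ 1 := Real.sqrt_le_one.mpr (by linarith [hz1 (extCode σ)])
      nlinarith
    · intro σ
      have h1 := card_visited_le (K := K) (L := L) hτ hC hN hCN (p := ζ.1) (z := z (extCode σ))
        ((hz1 _).trans (by norm_num)) hεN ((Bad σ).map Fin.valEmbedding) (by
          intro b hb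
          obtain ⟨b', hb', rfl⟩ := Finset.mem_map.mp hb
          exact (Finset.mem_filter.mp hb').2)
      rw [Finset.card_map] at h1
      by_contra! hlt
      have h2 : 2 * (3 * (μ * L) * (8 * m)) = L * L * m := by rw [hL]; ring
      have h3 : 2 ≤ L * L := by nlinarith
      have h4 : (m + 1) * (L * L) ≤ (Bad σ).card * (L * L) := Nat.mul_le_mul_right _ hlt
      nlinarith
    · intro σ σ' hb hns b hne
      rw [hBadDef, Finset.mem_filter]
      refine ⟨Finset.mem_univ _, fun i hi j hj => ?_⟩
      simp only [hsep] at hns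
      push Not at hns
      have hℓ : |√(2 * ham M (z (extCode σ))) * S - √(2 * ham M (z (extCode σ'))) * S| ≤ ε := by
        have p1 : 0 ≤ √(2 * ham M (z (extCode σ))) * S / ε := by positivity
        have p2 : 0 ≤ √(2 * ham M (z (extCode σ'))) * S / ε := by positivity
        have a1 := Nat.floor_le p1
        have a2 := Nat.lt_floor_add_one (√(2 * ham M (z (extCode σ))) * S / ε)
        have b1 := Nat.floor_le p2
        have b2 := Nat.lt_floor_add_one (√(2 * ham M (z (extCode σ'))) * S / ε)
        simp only [hbucket] at hb
        rw [hb] at a1 a2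
        have h1 : |√(2 * ham M (z (extCode σ))) * S / ε - √(2 * ham M (z (extCode σ'))) * S / ε| ≤ 1 :=
          abs_le.mpr ⟨by linarith, by linarith⟩
        rwa [← sub_div, abs_div, abs_of_pos hε, div_le_one hε] at h1
      have hA : (z (extCode σ)).1 = (z (extCode σ')).1 := by
        rw [hzA, hzA]; exact refV_zero hmm _ _ _
      have hclose := norm_sub_le_of_not_separated hC (hzpos (extCode σ)) (hzpos (extCode σ'))
        ((hz1 _).trans (by norm_num)) ((hz1 _).trans (by norm_num)) hA hS0 hε hε8 hℓ hns
      have hlim' := hzlim (extCode σ')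
      rw [refV_zero hmm _ (extCode σ') (extCode σ), refV_block_start hmm _ (extCode σ') (extCode σ)]
        at hlim'
      refine visits_of_close hτ (by linarith) (hzlim (extCode σ)) hlim' hε hclose
        (k := blockIdx L b i j) ?_
      refine wind_ref_ne hτ.le (by linarith) hN hμ hL0 (hchain (extCode σ)) (hchain (extCode σ'))
        (b := b) b.2 (by rwa [extCode_val, extCode_val]) ?_ ?_ ?_ ?_
      · simp only [blockIdx]; push_cast; linarith [Int.natCast_nonneg i]
      · simp only [blockIdx]; push_cast
        have : (i : ℤ) < L := by exact_mod_cast hi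
        linarith
      · exact Int.natCast_nonneg j
      · simp only [blockIdx]; exact_mod_cast hj
  obtain ⟨F, hF, hFsep⟩ := hfam
  rw [hT, sepCount]
  have hcard : (F.image c).card = F.card := by
    refine Finset.card_image_of_injOn fun σ hσ σ' hσ' heq => ?_
    by_contra hne
    obtain ⟨t, -, ht⟩ := hFsep σ hσ σ' hσ' hne
    rw [heq] at ht
    exact absurd ht (not_lt.mpr ((phaseDist_self _).trans hε.le))
  have hsepF : IsSeparated M ε S (F.image c) := by
    constructor
    · intro f hf
      obtain ⟨σ, -, rfl⟩ := Finset.mem_image.mp hf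
      exact isGeodesic_orbit M (ham_unitSpeed (hzpos _))
    · intro f hf f' hf' hne
      obtain ⟨σ, hσ, rfl⟩ := Finset.mem_image.mp hf
      obtain ⟨σ', hσ', rfl⟩ := Finset.mem_image.mp hf'
      exact hFsep σ hσ σ' hσ' fun h => hne (by rw [h])
  refine le_trans ?_ (le_iSup₂ (f := fun (F : Finset (ℝ → ℝ × ℝ)) (_ : IsSeparated M ε S F) =>
    (F.card : ℝ≥0∞)) (F.image c) hsepF)
  rw [hcard]
  exact_mod_cast hF

/-- If there exists a bounded geodesic ray on the universal covering `ℝ²` (realized as the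
forward ray `c|_{[0,∞)}` of a complete geodesic `c`), then the geodesic flow of `g` has
positive topological entropy. -/
theorem stmt6 (M : TorusMetric) (c : ℝ → ℝ × ℝ) (hc : M.IsGeodesic c)
    (hb : Bornology.IsBounded (c '' Set.Ici 0)) :
    0 < topEnt M := by
  obtain ⟨ζ, hζ, R, hR⟩ := exists_bounded_orbit M hc hb
  obtain ⟨τ₂, a, hτ₂, ha, h₂⟩ := energy_lower M
  have hE₂ : EnergyBound M τ₂ a := ⟨hτ₂, ha, h₂⟩
  obtain ⟨τ₁, hτ₁, hshort⟩ := exists_short_orbit M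
  set τ := min τ₁ τ₂ with hτdef
  have hτ : 0 < τ := lt_min hτ₁ hE₂.1
  have hE : EnergyBound M τ a := hE₂.mono hτ (min_le_right _ _)
  have hshort := hshort τ hτ (min_le_left _ _)
  obtain ⟨r, hr⟩ := exists_corner_cut hE hshort
  obtain ⟨C, hC0, hC⟩ := exists_vel_bound M
  obtain ⟨N, hN⟩ := exists_nat_ge (max (16 * R) (8 * (C * τ)) + 1)
  have hR0 : 0 ≤ R := (norm_nonneg _).trans (hR 0)
  have hN1 : 16 * R ≤ N := by linarith [le_max_left (16 * R) (8 * (C * τ))]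
  have hN2 : 8 * (C * τ) ≤ N := by linarith [le_max_right (16 * R) (8 * (C * τ))]
  have hN0' : (0 : ℝ) < N := by linarith [le_max_left (16 * R) (8 * (C * τ))]
  have hN0 : 0 < N := by exact_mod_cast hN0'
  have hζN : ∀ s, ‖pos M s ζ - ζ.1‖ ≤ (N : ℝ) / 8 := fun s => by
    have h1 := hR 0
    rw [pos_zero] at h1
    linarith [norm_sub_le (pos M s ζ) ζ.1, hR s]
  obtain ⟨r₁, hr₁, hchain⟩ := exists_chain hτ hr.1 (hr.2.1.trans (by norm_num))
    (by positivity : (0 : ℝ) < N / 8) hshort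
  obtain ⟨μ, hμ⟩ := exists_nat_ge (N / r₁)
  have hμ0' : (0 : ℝ) < μ := (by positivity : (0 : ℝ) < N / r₁).trans_le hμ
  have hμ0 : 0 < μ := by exact_mod_cast hμ0'
  have hmesh : (N : ℝ) / μ ≤ r₁ := by
    rw [div_le_iff₀ hr₁] at hμ
    rw [div_le_iff₀ hμ0']; linarith
  have hmm : 0 < μ * (48 * μ) := by positivity
  set ε := min (1 / 8) ((N : ℝ) / 8 / (2 * (2 + C) + 5)) with hεdef
  have hε : 0 < ε := lt_min (by norm_num) (by positivity)
  have hεN : 2 * ((2 + C) * ε) + 5 * ε ≤ N / 8 := by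
    have h1 : ε ≤ (N : ℝ) / 8 / (2 * (2 + C) + 5) := min_le_right _ _
    rw [le_div_iff₀ (by positivity)] at h1
    linarith
  refine topEnt_pos (ε := ε) (κ := 3 * (μ * (48 * μ)) * 8 * τ) hε (by positivity) ?_
  obtain ⟨m₀, hm₀⟩ := exists_nat_ge (3 * (μ * (48 * μ)) * 8 * τ / ε)
  filter_upwards [eventually_ge_atTop m₀, eventually_gt_atTop 0] with m hm hm0
  refine sepCount_ge hτ hr.2.1 hC hN0 hμ0 (by linarith) (ζ := ζ) hε (min_le_left _ _) hεN hm0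
    (hm₀.trans (by exact_mod_cast hm)) fun σ => ?_
  obtain ⟨P, hP⟩ := hchain (refV N μ (μ * (48 * μ)) ζ.1 σ) fun j => (refV_step hmm _ _ _).trans hmesh
  obtain ⟨z, hz1, hz2, hz3, hz4⟩ := exists_limit_orbit hE hr
    (ob := obst N ζ) (fun k => (ham_obst M N ζ k).trans hζ) (by positivity)
    (hP.isBroken hN0 hμ0 (by positivity) hζN (3 * (μ * (48 * μ)) * (8 * m)))
  exact ⟨P, z, hP, hz1, hz2, hz3, hz4⟩
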